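/- arXiv:1801.00737 — 2 statements merged into one kernel-verified Lean document; each statement's English description precedes it below -/
import Mathlib

section
/- For every k ∈ {2, 3, 5} and every ε > 0 there exists N such that for all n ≥ N, H(n,2k) ≤ n^{(1 − 1/k² + ε)n}. -/
open SimpleGraph

/-- `G` contains a cycle of length `k` as a subgraph. -/
def ContainsCycleLen {V : Type*} (G : SimpleGraph V) (k : ℕ) : Prop :=
  ∃ (u : V) (w : G.Walk u u), w.IsCycle ∧ w.length = k

/-- `H` is a Hamiltonian path of the complete graph on `Fin n`:
it is the path graph on `n` vertices up to a relabeling of the vertices. -/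
def IsHamPathGraph {n : ℕ} (H : SimpleGraph (Fin n)) : Prop :=
  ∃ σ : Equiv.Perm (Fin n), ∀ a b, H.Adj a b ↔ (pathGraph n).Adj (σ a) (σ b)

/-- The maximum size of a family of Hamiltonian paths of `K_n` that are
pairwise `C_k`-creating. -/
noncomputable def Hnum (n k : ℕ) : ℕ :=
  sSup {m | ∃ F : Finset (SimpleGraph (Fin n)), F.card = m ∧
    (∀ G ∈ F, IsHamPathGraph G) ∧
    ∀ G₁ ∈ F, ∀ G₂ ∈ F, G₁ ≠ G₂ → ContainsCycleLen (G₁ ⊔ G₂) k}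

/-- `H` is a perfect matching (as a graph): every vertex has a unique neighbor. -/
def IsPMGraph {V : Type*} (H : SimpleGraph V) : Prop :=
  ∀ v : V, ∃! w : V, H.Adj v w

/-- The maximum size of a family of perfect matchings of `K_n` that are
pairwise `C_k`-creating. -/
noncomputable def Mnum (n k : ℕ) : ℕ :=
  sSup {m | ∃ F : Finset (SimpleGraph (Fin n)), F.card = m ∧
    (∀ G ∈ F, IsPMGraph G) ∧
    ∀ G₁ ∈ F, ∀ G₂ ∈ F, G₁ ≠ G₂ → ContainsCycleLen (G₁ ⊔ G₂) k}

theorem cc_mono {V W : Type*} {G : SimpleGraph V} {G' : SimpleGraph W} (f : V → W)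
    (hf : Function.Injective f) (h : ∀ a b, G.Adj a b → G'.Adj (f a) (f b)) {k : ℕ}
    (hc : ContainsCycleLen G k) : ContainsCycleLen G' k := by
  obtain ⟨u, w, hw, hl⟩ := hc
  refine ⟨f u, w.map ⟨f, fun {a b} => h a b⟩, ?_, ?_⟩
  · exact hw.map hf
  · simpa using hl

theorem cc_fun {V : Type*} {G : SimpleGraph V} {L : ℕ} (hc : ContainsCycleLen G L) :
    3 ≤ L ∧ ∃ f : ℕ → V, (∀ i, G.Adj (f i) (f (i+1))) ∧ (∀ i, f (i + L) = f i) ∧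
      ∀ i j, f i = f j → i % L = j % L := by
  obtain ⟨u, w, hw, hl⟩ := hc
  have h3 := hw.three_le_length
  subst hl
  refine ⟨h3, fun i => w.getVert (i % w.length), ?_, ?_, ?_⟩
  · intro i
    have hi : i % w.length < w.length := Nat.mod_lt _ (by omega)
    have h1 := w.adj_getVert_succ hi
    have h2 : w.getVert ((i+1) % w.length) = w.getVert (i % w.length + 1) := by
      rw [Nat.add_mod]
      by_cases h : i % w.length + 1 = w.length
      · have : (1 % w.length) = 1 := Nat.mod_eq_of_lt (by omega)
        rw [this, h]; simp
      · have : (1 % w.length) = 1 := Nat.mod_eq_of_lt (by omega)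
        rw [this, Nat.mod_eq_of_lt (by omega)]
    simp only [h2]; exact h1
  · intro i; simp
  · intro i j hij
    have hi : i % w.length < w.length := Nat.mod_lt _ (by omega)
    have hj : j % w.length < w.length := Nat.mod_lt _ (by omega)
    exact hw.getVert_injOn' (by simp; omega) (by simp; omega) hij

theorem clique_bound {n L : ℕ} {U : Type*} [Fintype U] [DecidableEq U] (hU : Fintype.card U = n)
    (G : SimpleGraph U) (hG : ¬ ContainsCycleLen G L) (T : Finset (List U))
    (hT : ∀ l ∈ T, l.Nodup ∧ (∀ u, u ∈ l) ∧ l.IsChain G.Adj)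
    (F : Finset (SimpleGraph (Fin n))) (hF : ∀ G ∈ F, IsHamPathGraph G)
    (hF2 : ∀ G₁ ∈ F, ∀ G₂ ∈ F, G₁ ≠ G₂ → ContainsCycleLen (G₁ ⊔ G₂) L) :
    F.card * T.card ≤ n.factorial := by
  classical
  choose! σ hσ using hF
  have hlen : ∀ l ∈ T, l.length = n := by
    intro l hl
    obtain ⟨h1, h2, h3⟩ := hT l hl
    rw [← hU, ← List.toFinset_card_of_nodup h1, ← Finset.card_univ]
    congr 1; ext u; simp [h2]
  have key : ∀ l ∈ T, ∃ e : Fin n ≃ U, ∀ i : Fin n, l[i.1]? = some (e i) := by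
    intro l hl
    obtain ⟨h1, h2, h3⟩ := hT l hl
    refine ⟨(finCongr (hlen l hl).symm).trans (h1.getEquivOfForallMemList l h2), ?_⟩
    intro i
    have : i.1 < l.length := by rw [hlen l hl]; exact i.2
    simp [List.getElem?_eq_getElem this]
  haveI : Nonempty (Fin n ≃ U) := ⟨Fintype.equivOfCardEq (by simp [hU])⟩
  choose! e he using key
  have hchain : ∀ l ∈ T, ∀ a b : Fin n, (pathGraph n).Adj a b → G.Adj (e l a) (e l b) := by
    intro l hl a b hab
    obtain ⟨h1, h2, h3⟩ := hT l hl
    rw [List.isChain_iff_getElem] at h3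
    have aux : ∀ a b : Fin n, a.1 + 1 = b.1 → G.Adj (e l a) (e l b) := by
      intro a b hab
      have hb : b.1 < l.length := by rw [hlen l hl]; exact b.2
      have ha : a.1 < l.length := by rw [hlen l hl]; exact a.2
      have := h3 a.1 (by omega)
      have e1 := he l hl a
      have e2 := he l hl b
      rw [List.getElem?_eq_getElem ha] at e1
      rw [List.getElem?_eq_getElem hb] at e2
      simp only [Option.some.injEq] at e1 e2
      rw [← e1, ← e2]
      simpa [hab] using this
    rw [pathGraph_adj] at hab
    rcases hab with h | h
    · exact aux a b h
    · exact (aux b a h).symm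
  have hc : Fintype.card (Fin n ≃ U) = n.factorial := by
    rw [Fintype.card_equiv (Fintype.equivOfCardEq (by simp [hU]))]; simp
  rw [← Finset.card_product, ← hc, ← Finset.card_univ]
  apply Finset.card_le_card_of_injOn (fun p => (σ p.1).trans (e p.2)) (by simp)
  rintro ⟨H, l⟩ h1 ⟨H', l'⟩ h2 heq
  simp only [Finset.coe_product, Set.mem_prod, Finset.mem_coe] at h1 h2
  simp only at heq
  have hHH : H = H' := by
    by_contra hne
    apply hG
    refine cc_mono ((σ H).trans (e l)) (Equiv.injective _) ?_ (hF2 H h1.1 H' h2.1 hne)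
    intro a b hab
    rcases hab with hab | hab
    · exact hchain l h1.2 _ _ ((hσ H h1.1 a b).1 hab)
    · rw [heq]
      exact hchain l' h2.2 _ _ ((hσ H' h2.1 a b).1 hab)
  subst hHH
  have hee : e l = e l' := by
    ext i
    have := congrArg (fun q => q ((σ H).symm i)) heq
    simpa using this
  have : l = l' := by
    apply List.ext_getElem?
    intro i
    by_cases hi : i < n
    · rw [he l h1.2 ⟨i, hi⟩, he l' h2.2 ⟨i, hi⟩, hee]
    · rw [List.getElem?_eq_none (by rw [hlen l h1.2]; omega), List.getElem?_eq_none (by rw [hlen l' h2.2]; omega)]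
  rw [this]

/-- Functional form of a cycle of length `L`. -/
def FunCyc {V : Type*} (G : SimpleGraph V) (L : ℕ) (f : ℕ → V) : Prop :=
  (∀ i, G.Adj (f i) (f (i+1))) ∧ (∀ i, f (i + L) = f i) ∧ ∀ i j, f i = f j → i % L = j % L

/-- Bipartite graph of a relation. -/
def Wg {V : Type*} (R : V → V → Prop) : SimpleGraph (V × Bool) :=
  SimpleGraph.fromRel (fun a b => a.2 = true ∧ b.2 = false ∧ R a.1 b.1)

/-- one directed step in the big graph -/
def Bstep {V : Type*} (R : V → V → Prop) (len : V → ℕ) (f : V → V) :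
    (V × Bool) ⊕ (Σ u : V, Fin (len u)) → (V × Bool) ⊕ (Σ u : V, Fin (len u)) → Prop
  | .inl a, .inl b => a.2 = true ∧ b.2 = false ∧ R a.1 b.1
  | .inl a, .inr p => a = (p.1, true) ∧ p.2.val = 0
  | .inr p, .inr q => p.1 = q.1 ∧ p.2.val + 1 = q.2.val
  | .inr p, .inl b => b = (f p.1, false) ∧ p.2.val + 1 = len p.1

def Bg {V : Type*} (R : V → V → Prop) (len : V → ℕ) (f : V → V) :
    SimpleGraph ((V × Bool) ⊕ (Σ u : V, Fin (len u))) :=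
  SimpleGraph.fromRel (Bstep R len f)

theorem Bg_nbr {V : Type*} (R : V → V → Prop) (len : V → ℕ) (f : V → V) (u : V) (i : Fin (len u))
    (y) (h : (Bg R len f).Adj (.inr ⟨u, i⟩) y) :
    y = (if h : i.1 + 1 < len u then .inr ⟨u, ⟨i.1+1, h⟩⟩ else .inl (f u, false)) ∨
    y = (if h : 0 < i.1 then .inr ⟨u, ⟨i.1-1, by omega⟩⟩ else .inl (u, true)) := by
  have hi := i.2
  rw [Bg, SimpleGraph.fromRel_adj] at h
  rcases y with y | ⟨w, j⟩
  · rcases h.2 with h | h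
    · left
      obtain ⟨h1, h2⟩ := h
      simp only at h1 h2
      rw [dif_neg (by omega), h1]
    · right
      obtain ⟨h1, h2⟩ := h
      simp only at h1 h2
      rw [dif_neg (by omega), h1]
  · rcases h.2 with h | h
    · left
      obtain ⟨h1, h2⟩ := h
      simp only at h1 h2
      subst h1
      rw [dif_pos (by omega)]
      congr 2; exact Fin.ext h2.symm
    · right
      obtain ⟨h1, h2⟩ := h
      simp only at h1 h2
      subst h1
      rw [dif_pos (by omega)]
      congr 2; apply Fin.ext; simp only; omega

theorem Bg_free {V : Type*} (R : V → V → Prop) (len : V → ℕ) (f : V → V) (L : ℕ)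
    (hW : ∀ g, ¬ FunCyc (Wg R) L g) (hlen : ∀ u, len u = 0 ∨ L < len u) :
    ¬ ContainsCycleLen (Bg R len f) L := by
  classical
  intro hc
  obtain ⟨h3, g, g1, g2, g3⟩ := cc_fun hc
  by_cases hall : ∀ i, ∃ a, g i = .inl a
  · choose g' hg' using hall
    apply hW g'
    refine ⟨?_, ?_, ?_⟩
    · intro i
      have := g1 i
      rw [hg', hg', Bg, SimpleGraph.fromRel_adj] at this
      rw [Wg, SimpleGraph.fromRel_adj]
      refine ⟨fun h => this.1 (by rw [h]), this.2⟩
    · intro i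
      have := g2 i
      rw [hg', hg'] at this
      exact Sum.inl_injective this
    · intro i j h
      apply g3
      rw [hg', hg', h]
  · push Not at hall
    obtain ⟨a, ha⟩ := hall
    obtain ⟨⟨u, i⟩, hu⟩ : ∃ p, g a = .inr p := by
      rcases hga : g a with y | y
      · exact absurd hga (ha y)
      · exact ⟨y, rfl⟩
    have both : ∀ b, ∀ i : Fin (len u), g b = .inr ⟨u, i⟩ →
        (∃ c, g c = (if h : i.1 + 1 < len u then .inr ⟨u, ⟨i.1+1, h⟩⟩ else .inl (f u, false))) ∧
        (∃ c, g c = (if h : 0 < i.1 then .inr ⟨u, ⟨i.1-1, by omega⟩⟩ else .inl (u, true))) := by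
      intro b i hb
      have n1 := g1 b
      rw [hb] at n1
      have n2 := g1 (b + L - 1)
      rw [show b + L - 1 + 1 = b + L by omega, g2, hb] at n2
      have hne : g (b+1) ≠ g (b + L - 1) := by
        intro h
        have := g3 _ _ h
        have h5 : (b + 1) ≡ (b + L - 1) [MOD L] := this
        rw [Nat.modEq_iff_dvd' (by omega)] at h5
        have := Nat.le_of_dvd (by omega) h5
        omega
      rcases Bg_nbr R len f u i _ n1 with h | h <;> rcases Bg_nbr R len f u i _ n2.symm with h' | h'
      · exact absurd (h.trans h'.symm) hne
      · exact ⟨⟨_, h⟩, ⟨_, h'⟩⟩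
      · exact ⟨⟨_, h'⟩, ⟨_, h⟩⟩
      · exact absurd (h.trans h'.symm) hne
    have down : ∀ m, ∀ (i : Fin (len u)) b, i.1 = m → g b = .inr ⟨u, i⟩ →
        ∃ c, g c = .inr ⟨u, ⟨0, lt_of_le_of_lt (Nat.zero_le _) i.2⟩⟩ := by
      intro m
      induction m with
      | zero =>
        intro i b hi hb
        refine ⟨b, ?_⟩
        rw [hb]; congr 2; exact Fin.ext hi
      | succ m ih =>
        intro i b hi hb
        obtain ⟨c, hc⟩ := (both b i hb).2
        rw [dif_pos (by omega)] at hc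
        exact ih _ c (by simp; omega) hc
    obtain ⟨c0, hc0⟩ := down _ i a rfl hu
    have up : ∀ m (hm : m < len u), ∃ c, g c = .inr ⟨u, ⟨m, hm⟩⟩ := by
      intro m
      induction m with
      | zero => intro hm; exact ⟨c0, hc0⟩
      | succ m ih =>
        intro hm
        obtain ⟨c, hc⟩ := ih (by omega)
        obtain ⟨c', hc'⟩ := (both c _ hc).1
        rw [dif_pos (by simpa using hm)] at hc'
        exact ⟨c', hc'⟩
    have hL : L < len u := by
      rcases hlen u with h | h
      · have := i.2; omega
      · exact h
    choose! c hc using up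
    have hmaps : ∀ m ∈ Finset.range (len u), c m % L ∈ Finset.range L := by
      intro m _; simp; exact Nat.mod_lt _ (by omega)
    obtain ⟨x, hx, y, hy, hxy, he⟩ := Finset.exists_ne_map_eq_of_card_lt_of_maps_to
      (by simpa using hL) hmaps
    simp only [Finset.mem_range] at hx hy
    apply hxy
    have hmod : ∀ z, g (z % L) = g z := by
      intro z
      induction z using Nat.strong_induction_on with
      | _ z ih =>
        by_cases hz : z < L
        · rw [Nat.mod_eq_of_lt hz]
        · have h1 := ih (z - L) (by omega)
          have h2 := g2 (z - L)
          rw [Nat.sub_add_cancel (by omega)] at h2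
          rw [h2, ← h1]
          congr 1
          exact Nat.mod_eq_sub_mod (by omega)
    have : g (c x) = g (c y) := by rw [← hmod (c x), ← hmod (c y), he]
    rw [hc x hx, hc y hy] at this
    have := Sum.inr_injective this
    simpa using this

/-- the Hamiltonian path list -/
def plist {V : Type*} (len : V → ℕ) (es : List V) : List ((V × Bool) ⊕ (Σ u : V, Fin (len u))) :=
  es.flatMap (fun u => .inl (u, false) :: .inl (u, true) ::
    (List.finRange (len u)).map (fun i => .inr ⟨u, i⟩))

def lineOf {V : Type*} (len : V → ℕ) : (V × Bool) ⊕ (Σ u : V, Fin (len u)) → Option V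
  | .inl (u, false) => some u
  | _ => none

theorem plist_inj {V : Type*} (len : V → ℕ) (es : List V) :
    (plist len es).filterMap (lineOf len) = es := by
  induction es with
  | nil => rfl
  | cons u es ih =>
    simp only [plist, List.flatMap_cons, List.filterMap_append] at ih ⊢
    rw [ih]
    simp [lineOf]

theorem plist_nodup {V : Type*} (len : V → ℕ) (es : List V) (h : es.Nodup) :
    (plist len es).Nodup := by
  rw [plist, List.nodup_flatMap]
  refine ⟨?_, ?_⟩
  · intro u _
    simp only [List.nodup_cons]
    refine ⟨by simp, by simp, ?_⟩
    apply List.Nodup.map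
    · intro i j hij
      simpa using hij
    · exact List.nodup_finRange _
  · refine h.imp ?_
    intro u w huw
    simp only [Function.onFun]
    intro x hx hy
    simp only [List.mem_cons, List.mem_map, List.mem_finRange, true_and] at hx hy
    rcases hx with rfl | rfl | ⟨i, rfl⟩ <;> rcases hy with hy | hy | ⟨j, hy⟩ <;> simp_all

theorem plist_mem {V : Type*} (len : V → ℕ) (es : List V) (h : ∀ u, u ∈ es) (x) :
    x ∈ plist len es := by
  rw [plist, List.mem_flatMap]
  rcases x with ⟨u, _ | _⟩ | ⟨u, i⟩
  · exact ⟨u, h u, by simp⟩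
  · exact ⟨u, h u, by simp⟩
  · exact ⟨u, h u, by simp⟩

theorem plist_chain {V : Type*} (R : V → V → Prop) (hR : ∀ u, R u u) (len : V → ℕ) (f : V → V)
    (es : List V) (h : es.IsChain (fun u w => if len u = 0 then R u w else f u = w)) :
    (plist len es).IsChain (Bg R len f).Adj := by
  induction es with
  | nil => simp [plist]
  | cons u es ih =>
    have ih := ih h.of_cons
    simp only [plist, List.flatMap_cons] at ih ⊢
    rw [List.isChain_append]
    refine ⟨?_, ih, ?_⟩
    · rw [List.isChain_cons_cons]
      refine ⟨by simp [Bg, Bstep, hR], ?_⟩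
      rw [List.isChain_iff_getElem]
      intro i hi
      simp only [List.length_cons, List.length_map, List.length_finRange] at hi
      rcases i with _ | i
      · simp [Bg, Bstep]
      · simp [Bg, Bstep]
    · intro x hx y hy
      rcases es with _ | ⟨w, es⟩
      · simp at hy
      · simp at hy
        subst hy
        rw [List.isChain_cons_cons] at h
        have h := h.1
        split_ifs at h with h0
        · have hx' : x = .inl (u, true) := by
            have : List.finRange (len u) = [] := by simp [h0]
            rw [this] at hx
            simpa using hx.symm
          subst hx'
          simp [Bg, Bstep, h]
        · obtain ⟨m, hm⟩ : ∃ m, len u = m + 1 := ⟨len u - 1, by omega⟩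
          have hx' : x = .inr ⟨u, ⟨m, by omega⟩⟩ := by
            rw [List.getLast?_eq_getElem?] at hx
            simp [hm] at hx
            exact hx.symm
          subst hx'
          simp [Bg, Bstep, h, hm]

theorem embed_bound {n L : ℕ} {V : Type*} [Fintype V] [DecidableEq V] (R : V → V → Prop)
    (hR : ∀ u, R u u) (hW : ∀ g, ¬ FunCyc (Wg R) L g) (D : Finset V) (f : V → V)
    (hD : D.Nonempty) (hn : 2 * Fintype.card V + (L + 1) * D.card ≤ n)
    (T : Finset (List V))
    (hT : ∀ l ∈ T, l.Nodup ∧ (∀ u, u ∈ l) ∧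
      l.IsChain (fun u w => if u ∈ D then f u = w else R u w))
    (F : Finset (SimpleGraph (Fin n))) (hF : ∀ G ∈ F, IsHamPathGraph G)
    (hF2 : ∀ G₁ ∈ F, ∀ G₂ ∈ F, G₁ ≠ G₂ → ContainsCycleLen (G₁ ⊔ G₂) L) :
    F.card * T.card ≤ n.factorial := by
  classical
  obtain ⟨d, hd⟩ := hD
  set ex := n - (2 * Fintype.card V + (L + 1) * D.card) with hex
  let len : V → ℕ := fun u => if u ∈ D then (L + 1) + (if u = d then ex else 0) else 0
  have hl0 : ∀ u, len u = 0 ↔ u ∉ D := by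
    intro u; simp only [len]; split_ifs <;> simp_all
  have hcard : Fintype.card ((V × Bool) ⊕ (Σ u : V, Fin (len u))) = n := by
    have : ∑ u, len u = (L+1) * D.card + ex := by
      simp only [len]
      rw [← Finset.sum_filter]
      simp [Finset.sum_add_distrib, hd, mul_comm]
    simp [this]; omega
  have := clique_bound (L := L) hcard (Bg R len f) (Bg_free R len f L hW ?_) (T.image (plist len)) ?_ F hF hF2
  · rwa [Finset.card_image_of_injective] at this
    intro a b hab
    rw [← plist_inj len a, hab, plist_inj]
  · intro u
    simp only [len]
    split_ifs <;> simp <;> omega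
  · intro l hl
    rw [Finset.mem_image] at hl
    obtain ⟨es, hes, rfl⟩ := hl
    obtain ⟨h1, h2, h3⟩ := hT es hes
    refine ⟨plist_nodup _ _ h1, plist_mem _ _ h2, plist_chain R hR len f es ?_⟩
    refine h3.imp ?_
    intro a b hab
    by_cases h : a ∈ D
    · rw [if_pos h] at hab
      rw [if_neg (by rw [hl0]; simpa using h)]; exact hab
    · rw [if_neg h] at hab
      rw [if_pos ((hl0 a).2 h)]; exact hab

/-- Wenger relation. -/
def WR {V K : Type*} [Field K] (k : ℕ) (x : V → K) (g : V → Fin (k-1) → K) (u w : V) : Prop :=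
  ∀ m : Fin (k-1), g w m - g u m = x w * (x w ^ (m.1+1) - x u ^ (m.1+1))

theorem wenger_alg2 {K : Type*} [Field K] (x y : ℕ → K) (hx : ∀ i, x i ≠ x (i+1))
    (hy : ∀ i, y i ≠ y (i+1)) (px : ∀ i, x (i+2) = x i) (py : ∀ i, y (i+2) = y i)
    (hs : ∀ m : ℕ, m < 1 → ∑ i ∈ Finset.range 2, y i * (x (i+1) ^ (m+1) - x i ^ (m+1)) = 0) :
    False := by
  have h := hs 0 (by norm_num)
  simp only [Finset.sum_range_succ, Finset.sum_range_zero] at h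
  have p0 := px 0
  simp only [zero_add] at h p0
  norm_num at h
  rw [p0] at h
  have : (y 0 - y 1) * (x 1 - x 0) = 0 := by linear_combination h
  rcases mul_eq_zero.1 this with h | h
  · exact hy 0 (sub_eq_zero.1 h)
  · exact hx 0 (sub_eq_zero.1 h).symm

theorem wenger_alg3 {K : Type*} [Field K] (x y : ℕ → K) (hx : ∀ i, x i ≠ x (i+1))
    (hy : ∀ i, y i ≠ y (i+1)) (px : ∀ i, x (i+3) = x i) (py : ∀ i, y (i+3) = y i)
    (hs : ∀ m : ℕ, m < 2 → ∑ i ∈ Finset.range 3, y i * (x (i+1) ^ (m+1) - x i ^ (m+1)) = 0) :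
    False := by
  have h := hs 0 (by norm_num)
  have h' := hs 1 (by norm_num)
  simp only [Finset.sum_range_succ, Finset.sum_range_zero] at h h'
  have p0 := px 0
  have x0 := hx 0
  have x1 := hx 1
  have x2 := hx 2
  simp only [zero_add] at h h' p0 x0
  norm_num at h h' x1 x2
  rw [p0] at h h' x2
  have : (y 0 - y 1) * ((x 1 - x 0) * (x 1 - x 2)) = 0 := by
    linear_combination h' - (x 0 + x 2) * h
  rcases mul_eq_zero.1 this with h | h
  · exact hy 0 (sub_eq_zero.1 h)
  · rcases mul_eq_zero.1 h with h | h
    · exact x0 (sub_eq_zero.1 h).symm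
    · exact x1 (sub_eq_zero.1 h)

theorem wenger_alg5 {K : Type*} [Field K] (x y : ℕ → K) (hx : ∀ i, x i ≠ x (i+1))
    (hy : ∀ i, y i ≠ y (i+1)) (px : ∀ i, x (i+5) = x i) (py : ∀ i, y (i+5) = y i)
    (hs : ∀ m : ℕ, m < 4 → ∑ i ∈ Finset.range 5, y i * (x (i+1) ^ (m+1) - x i ^ (m+1)) = 0) :
    False := by
  have hsh : ∀ j m : ℕ, m < 4 →
      ∑ i ∈ Finset.range 5, y (j+i) * (x (j+i+1) ^ (m+1) - x (j+i) ^ (m+1)) = 0 := by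
    intro j
    induction j with
    | zero => intro m hm; simpa using hs m hm
    | succ j ih =>
      intro m hm
      have := ih m hm
      rw [Finset.sum_range_succ'] at this
      rw [Finset.sum_range_succ, ← this]
      refine congrArg₂ (· + ·) (Finset.sum_congr rfl fun i _ => ?_) ?_
      · rw [show j + 1 + i = j + (i + 1) by ring]
      · rw [show j + 1 + 4 = j + 5 by ring, py, show j + 5 + 1 = j + 1 + 5 by ring, px, px]; simp
  -- each `x j` is repeated among the other ones
  have rep : ∀ j, x (j+1) = x (j+3) ∨ x (j+1) = x (j+4) := by
    intro j
    by_contra hcon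
    push Not at hcon
    have h1 := hsh j 0 (by norm_num)
    have h2 := hsh j 1 (by norm_num)
    have h3 := hsh j 2 (by norm_num)
    have h4 := hsh j 3 (by norm_num)
    simp only [Finset.sum_range_succ, Finset.sum_range_zero, add_zero, add_assoc] at h1 h2 h3 h4
    have p0 := px j
    norm_num at h1 h2 h3 h4
    rw [p0] at h1 h2 h3 h4
    have : (y j - y (j+1)) * ((x (j+1) - x j) * (x (j+1) - x (j+2)) * (x (j+1) - x (j+3)) *
        (x (j+1) - x (j+4))) = 0 := by
      linear_combination h4 - (x j + x (j+2) + x (j+3) + x (j+4)) * h3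
        + (x j * x (j+2) + x j * x (j+3) + x j * x (j+4) + x (j+2) * x (j+3) + x (j+2) * x (j+4)
          + x (j+3) * x (j+4)) * h2
        - (x j * x (j+2) * x (j+3) + x j * x (j+2) * x (j+4) + x j * x (j+3) * x (j+4)
          + x (j+2) * x (j+3) * x (j+4)) * h1
    have a1 : y j - y (j+1) ≠ 0 := sub_ne_zero.2 (hy j)
    have a2 : x (j+1) - x j ≠ 0 := sub_ne_zero.2 (hx j).symm
    have a3 : x (j+1) - x (j+2) ≠ 0 := sub_ne_zero.2 (hx (j+1))
    have a4 : x (j+1) - x (j+3) ≠ 0 := sub_ne_zero.2 hcon.1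
    have a5 : x (j+1) - x (j+4) ≠ 0 := sub_ne_zero.2 hcon.2
    simp_all
  have r0 := rep 0
  have r1 := rep 1
  have r2 := rep 2
  have r3 := rep 3
  have r4 := rep 4
  have q5 := px 0
  have q6 := px 1
  have q7 := px 2
  have q8 := px 3
  have n0 := hx 0
  have n1 := hx 1
  have n2 := hx 2
  have n3 := hx 3
  have n4 := hx 4
  norm_num at *
  rw [q5] at n4
  rw [q5] at r1 r2 r4
  rw [q6] at r2 r3
  rw [q7] at r3 r4
  rw [q8] at r4
  grind

theorem wenger_free {V K : Type*} [Field K] (k : ℕ) (hk : k = 2 ∨ k = 3 ∨ k = 5)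
    (x : V → K) (g : V → Fin (k-1) → K) (hinj : ∀ u w, x u = x w → g u = g w → u = w) (f) :
    ¬ FunCyc (Wg (WR k x g)) (2*k) f := by
  have hk2 : 2 ≤ k := by omega
  have main : ∀ f, (f 0).2 = true → ¬ FunCyc (Wg (WR k x g)) (2*k) f := by
    rintro f h0 ⟨f1, f2, f3⟩
    have hb : ∀ i, (f (2*i)).2 = true ∧ (f (2*i+1)).2 = false := by
      have step : ∀ i, (f (i+1)).2 = !(f i).2 := by
        intro i
        have := f1 i
        rw [Wg, SimpleGraph.fromRel_adj] at this
        rcases this.2 with h | h <;> simp [h.1, h.2.1]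
      intro i
      induction i with
      | zero => exact ⟨h0, by rw [mul_zero, step, h0]; rfl⟩
      | succ i ih =>
        have e1 : (f (2*(i+1))).2 = true := by
          rw [show 2*(i+1) = 2*i+1+1 by ring, step, ih.2]; rfl
        exact ⟨e1, by rw [step, e1]; rfl⟩
    have r1 : ∀ i, WR k x g (f (2*i)).1 (f (2*i+1)).1 := by
      intro i
      have := f1 (2*i)
      rw [Wg, SimpleGraph.fromRel_adj] at this
      rcases this.2 with h | h
      · exact h.2.2
      · have := h.1; rw [(hb i).2] at this; simp at this
    have r2 : ∀ i, WR k x g (f (2*(i+1))).1 (f (2*i+1)).1 := by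
      intro i
      have := f1 (2*i+1)
      rw [show 2*i+1+1 = 2*(i+1) by ring] at this
      rw [Wg, SimpleGraph.fromRel_adj] at this
      rcases this.2 with h | h
      · have := h.1; rw [(hb i).2] at this; simp at this
      · exact h.2.2
    have ne2 : ∀ j, f j ≠ f (j+2) := by
      intro j h
      have h5 : j ≡ j + 2 [MOD 2*k] := f3 _ _ h
      rw [Nat.modEq_iff_dvd' (by omega)] at h5
      have := Nat.le_of_dvd (by omega) h5
      omega
    have hx : ∀ i, x (f (2*i)).1 ≠ x (f (2*(i+1))).1 := by
      intro i h
      apply ne2 (2*i)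
      rw [show 2*i+2 = 2*(i+1) by ring]
      apply Prod.ext
      · apply hinj _ _ h
        funext m
        have a := r1 i m
        have b := r2 i m
        rw [← h] at b
        linear_combination b - a
      · rw [(hb i).1, (hb (i+1)).1]
    have hy : ∀ i, x (f (2*i+1)).1 ≠ x (f (2*(i+1)+1)).1 := by
      intro i h
      apply ne2 (2*i+1)
      rw [show 2*i+1+2 = 2*(i+1)+1 by ring]
      apply Prod.ext
      · apply hinj _ _ h
        funext m
        have a := r2 i m
        have b := r1 (i+1) m
        rw [← h] at b
        linear_combination a - b
      · rw [(hb i).2, (hb (i+1)).2]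
    have px : ∀ i, x (f (2*(i+k))).1 = x (f (2*i)).1 := by
      intro i; rw [mul_add, f2]
    have py : ∀ i, x (f (2*(i+k)+1)).1 = x (f (2*i+1)).1 := by
      intro i; rw [show 2*(i+k)+1 = 2*i+1+2*k by ring, f2]
    have hs : ∀ m : ℕ, m < k-1 → ∑ i ∈ Finset.range k, x (f (2*i+1)).1 *
        (x (f (2*(i+1))).1 ^ (m+1) - x (f (2*i)).1 ^ (m+1)) = 0 := by
      intro m hm
      have : ∀ i, x (f (2*i+1)).1 * (x (f (2*(i+1))).1 ^ (m+1) - x (f (2*i)).1 ^ (m+1)) =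
          g (f (2*(i+1))).1 ⟨m, hm⟩ - g (f (2*i)).1 ⟨m, hm⟩ := by
        intro i
        have a := r1 i ⟨m, hm⟩
        have b := r2 i ⟨m, hm⟩
        simp only at a b
        linear_combination b - a
      rw [Finset.sum_congr rfl (fun i _ => this i)]
      rw [Finset.sum_range_sub (fun i => g (f (2*i)).1 ⟨m, hm⟩)]
      have := f2 0
      simp only [zero_add] at this
      simp [this]
    rcases hk with rfl | rfl | rfl
    · exact wenger_alg2 (fun i => x (f (2*i)).1) (fun i => x (f (2*i+1)).1) hx hy px py hs
    · exact wenger_alg3 (fun i => x (f (2*i)).1) (fun i => x (f (2*i+1)).1) hx hy px py hs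
    · exact wenger_alg5 (fun i => x (f (2*i)).1) (fun i => x (f (2*i+1)).1) hx hy px py hs
  intro hf
  rcases hbool : (f 0).2 with _ | _
  · apply main (fun i => f (i+1))
    · have := hf.1 0
      rw [Wg, SimpleGraph.fromRel_adj] at this
      rcases this.2 with h | h
      · rw [h.1] at hbool; simp at hbool
      · exact h.1
    · refine ⟨fun i => hf.1 (i+1), fun i => ?_, fun i j h => ?_⟩
      · simp only []
        rw [show i + 2*k + 1 = i + 1 + 2*k by ring, hf.2.1]
      · have h5 : i + 1 ≡ j + 1 [MOD 2*k] := hf.2.2 _ _ h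
        exact Nat.ModEq.add_right_cancel' 1 h5
  · exact main f hbool hf

section matchings
open Classical

variable {V : Type*}

/-- Matchings of the bipartite graph of the relation `R` between `A` and `B`. -/
noncomputable def Mt (R : V → V → Prop) (A B : Finset V) : Finset (Finset (V × V)) :=
  ((A ×ˢ B).filter (fun e => R e.1 e.2)).powerset.filter
    (fun M => ∀ e ∈ M, ∀ e' ∈ M, (e.1 = e'.1 ∨ e.2 = e'.2) → e = e')

noncomputable def Zm (R : V → V → Prop) (l : ℝ) (A B : Finset V) : ℝ :=
  ∑ M ∈ Mt R A B, l ^ M.card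

theorem mem_Mt {R : V → V → Prop} {A B : Finset V} {M : Finset (V × V)} :
    M ∈ Mt R A B ↔ (∀ e ∈ M, e.1 ∈ A ∧ e.2 ∈ B ∧ R e.1 e.2) ∧
      ∀ e ∈ M, ∀ e' ∈ M, (e.1 = e'.1 ∨ e.2 = e'.2) → e = e' := by
  simp only [Mt, Finset.mem_filter, Finset.mem_powerset, Finset.subset_iff, Finset.mem_product]
  simp only [and_assoc]

variable [DecidableEq V]

theorem Zm_edge (R : V → V → Prop) (l : ℝ) (A B : Finset V) (u w : V) (hu : u ∈ A) (hw : w ∈ B)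
    (hR : R u w) : ∑ M ∈ (Mt R A B).filter (fun M => (u, w) ∈ M), l ^ M.card =
      l * Zm R l (A.erase u) (B.erase w) := by
  rw [Zm, Finset.mul_sum]
  refine Finset.sum_bij' (fun M _ => M.erase (u, w)) (fun M _ => insert (u, w) M) ?_ ?_ ?_ ?_ ?_
  · intro M hM
    rw [Finset.mem_filter, mem_Mt] at hM
    obtain ⟨⟨h1, h2⟩, h3⟩ := hM
    rw [mem_Mt]
    refine ⟨?_, ?_⟩
    · intro e he
      rw [Finset.mem_erase] at he
      obtain ⟨a, b, c⟩ := h1 e he.2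
      refine ⟨Finset.mem_erase.2 ⟨fun h => he.1 (h2 e he.2 _ h3 (Or.inl h)), a⟩,
        Finset.mem_erase.2 ⟨fun h => he.1 (h2 e he.2 _ h3 (Or.inr h)), b⟩, c⟩
    · intro e he e' he' h
      exact h2 e (Finset.mem_of_mem_erase he) e' (Finset.mem_of_mem_erase he') h
  · intro M hM
    rw [mem_Mt] at hM
    obtain ⟨h1, h2⟩ := hM
    rw [Finset.mem_filter, mem_Mt]
    refine ⟨⟨?_, ?_⟩, Finset.mem_insert_self _ _⟩
    · intro e he
      rcases Finset.mem_insert.1 he with rfl | he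
      · exact ⟨hu, hw, hR⟩
      · obtain ⟨a, b, c⟩ := h1 e he
        exact ⟨Finset.mem_of_mem_erase a, Finset.mem_of_mem_erase b, c⟩
    · intro e he e' he' h
      rcases Finset.mem_insert.1 he with rfl | he <;> rcases Finset.mem_insert.1 he' with rfl | he'
      · rfl
      · obtain ⟨a, b, c⟩ := h1 e' he'
        rw [Finset.mem_erase] at a b
        rcases h with h | h
        · exact absurd h.symm a.1
        · exact absurd h.symm b.1
      · obtain ⟨a, b, c⟩ := h1 e he
        rw [Finset.mem_erase] at a b
        rcases h with h | h
        · exact absurd h a.1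
        · exact absurd h b.1
      · exact h2 e he e' he' h
  · intro M hM
    rw [Finset.mem_filter] at hM
    exact Finset.insert_erase hM.2
  · intro M hM
    rw [mem_Mt] at hM
    apply Finset.erase_insert
    intro h
    have := (hM.1 _ h).1
    simp at this
  · intro M hM
    rw [Finset.mem_filter] at hM
    rw [← pow_succ', Finset.card_erase_add_one hM.2]

theorem Mt_erase (R : V → V → Prop) (A B : Finset V) (u : V) :
    (Mt R A B).filter (fun M => ∀ e ∈ M, e.1 ≠ u) = Mt R (A.erase u) B := by
  ext M
  rw [Finset.mem_filter, mem_Mt, mem_Mt]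
  simp only [Finset.mem_erase]
  constructor
  · rintro ⟨⟨h1, h2⟩, h3⟩
    exact ⟨fun e he => ⟨⟨h3 e he, (h1 e he).1⟩, (h1 e he).2⟩, h2⟩
  · rintro ⟨h1, h2⟩
    exact ⟨⟨fun e he => ⟨(h1 e he).1.2, (h1 e he).2⟩, h2⟩, fun e he => (h1 e he).1.1⟩

theorem Zm_rec (R : V → V → Prop) (l : ℝ) (A B : Finset V) (u : V) (hu : u ∈ A) :
    Zm R l A B = Zm R l (A.erase u) B +
      ∑ w ∈ B.filter (fun w => R u w), l * Zm R l (A.erase u) (B.erase w) := by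
  have e1 : ∀ w ∈ B.filter (fun w => R u w), l * Zm R l (A.erase u) (B.erase w) =
      ∑ M ∈ Mt R A B, if (u, w) ∈ M then l ^ M.card else 0 := by
    intro w hw
    rw [Finset.mem_filter] at hw
    rw [← Zm_edge R l A B u w hu hw.1 hw.2, Finset.sum_filter]
  rw [Finset.sum_congr rfl e1, Finset.sum_comm]
  conv_rhs => rw [Zm, ← Mt_erase, Finset.sum_filter, ← Finset.sum_add_distrib]
  rw [Zm]
  apply Finset.sum_congr rfl
  intro M hM
  rw [mem_Mt] at hM
  obtain ⟨h1, h2⟩ := hM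
  by_cases h : ∀ e ∈ M, e.1 ≠ u
  · rw [if_pos h, Finset.sum_eq_zero, add_zero]
    intro w _
    rw [if_neg]
    intro hm
    exact h _ hm rfl
  · rw [if_neg h, zero_add]
    push Not at h
    obtain ⟨⟨u', w⟩, he, rfl⟩ := h
    rw [Finset.sum_eq_single w, if_pos he]
    · intro w' _ hne
      rw [if_neg]
      intro hm
      have := h2 _ hm _ he (Or.inl rfl)
      simp at this
      exact hne this
    · intro hw
      exfalso; apply hw
      rw [Finset.mem_filter]
      exact (h1 _ he).2

theorem Zm_swap (R : V → V → Prop) (l : ℝ) (A B : Finset V) :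
    Zm R l A B = Zm (fun a b => R b a) l B A := by
  have aux : ∀ (R : V → V → Prop) (A B : Finset V) M, M ∈ Mt R A B →
      M.image Prod.swap ∈ Mt (fun a b => R b a) B A := by
    intro R A B M hM
    rw [mem_Mt] at hM ⊢
    refine ⟨?_, ?_⟩
    · intro e he
      rw [Finset.mem_image] at he
      obtain ⟨e, he, rfl⟩ := he
      have := hM.1 e he
      exact ⟨this.2.1, this.1, this.2.2⟩
    · intro e he e' he' h
      rw [Finset.mem_image] at he he'
      obtain ⟨e, he, rfl⟩ := he
      obtain ⟨e', he', rfl⟩ := he'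
      rw [hM.2 e he e' he' h.symm]
  have sw : ∀ M : Finset (V × V), (M.image Prod.swap).image Prod.swap = M := by
    intro M
    rw [Finset.image_image]
    simp
  refine Finset.sum_bij' (fun M _ => M.image Prod.swap) (fun M _ => M.image Prod.swap) ?_ ?_ ?_ ?_ ?_
  · intro M hM; exact aux _ _ _ _ hM
  · intro M hM; exact aux _ _ _ _ hM
  · intro M _; exact sw M
  · intro M _; exact sw M
  · intro M _
    rw [Finset.card_image_of_injective _ Prod.swap_injective]

theorem Zm_rec' (R : V → V → Prop) (l : ℝ) (A B : Finset V) (v : V) (hv : v ∈ B) :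
    Zm R l A B = Zm R l A (B.erase v) +
      ∑ w ∈ A.filter (fun w => R w v), l * Zm R l (A.erase w) (B.erase v) := by
  rw [Zm_swap, Zm_rec _ _ _ _ v hv, Zm_swap R l A (B.erase v)]
  congr 1
  apply Finset.sum_congr rfl
  intro w _
  rw [Zm_swap R]

theorem Zm_nonneg (R : V → V → Prop) (l : ℝ) (hl : 0 ≤ l) (A B : Finset V) : 0 ≤ Zm R l A B :=
  Finset.sum_nonneg fun _ _ => pow_nonneg hl _

theorem Zm_corr (R : V → V → Prop) (l : ℝ) (hl : 0 ≤ l) (n : ℕ) : ∀ A B : Finset V,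
    A.card + B.card ≤ n →
    (∀ u ∈ A, ∀ v ∈ B, Zm R l (A.erase u) B * Zm R l A (B.erase v) ≤
      Zm R l A B * Zm R l (A.erase u) (B.erase v)) ∧
    (∀ v ∈ B, ∀ v' ∈ B, v ≠ v' → Zm R l A B * Zm R l A ((B.erase v).erase v') ≤
      Zm R l A (B.erase v) * Zm R l A (B.erase v')) := by
  induction n with
  | zero =>
    intro A B h
    have hA : A = ∅ := by rw [← Finset.card_eq_zero]; omega
    have hB : B = ∅ := by rw [← Finset.card_eq_zero]; omega
    subst hA hB
    simp
  | succ n ih =>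
    intro A B h
    refine ⟨?_, ?_⟩
    · intro u hu v hv
      have ih' := (ih (A.erase u) B (by rw [Finset.card_erase_of_mem hu]; have := Finset.card_pos.2 ⟨u, hu⟩; omega)).2
      rw [Zm_rec R l A B u hu, Zm_rec R l A (B.erase v) u hu, mul_add, add_mul]
      refine add_le_add le_rfl ?_
      rw [Finset.mul_sum, Finset.sum_mul]
      refine le_trans (Finset.sum_le_sum (g := fun w => l * Zm R l (A.erase u) (B.erase w) *
        Zm R l (A.erase u) (B.erase v)) ?_) (Finset.sum_le_sum_of_subset_of_nonneg ?_ ?_)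
      · intro w hw
        rw [Finset.mem_filter, Finset.mem_erase] at hw
        have := ih' v hv w hw.1.2 (Ne.symm hw.1.1)
        calc _ = l * (Zm R l (A.erase u) B * Zm R l (A.erase u) ((B.erase v).erase w)) := by ring
          _ ≤ l * (Zm R l (A.erase u) (B.erase v) * Zm R l (A.erase u) (B.erase w)) :=
            mul_le_mul_of_nonneg_left this hl
          _ = _ := by ring
      · exact Finset.filter_subset_filter _ (Finset.erase_subset _ _)
      · intro w _ _
        exact mul_nonneg (mul_nonneg hl (Zm_nonneg _ _ hl _ _)) (Zm_nonneg _ _ hl _ _)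
    · intro v hv v' hv' hne
      have ih' := (ih A (B.erase v) (by rw [Finset.card_erase_of_mem hv]; have := Finset.card_pos.2 ⟨v, hv⟩; omega)).1
      rw [Zm_rec' R l A B v hv, Zm_rec' R l A (B.erase v') v (Finset.mem_erase.2 ⟨hne, hv⟩),
        mul_add, add_mul, Finset.erase_right_comm (a := v')]
      refine add_le_add le_rfl ?_
      rw [Finset.mul_sum, Finset.sum_mul]
      refine Finset.sum_le_sum ?_
      intro w hw
      rw [Finset.mem_filter] at hw
      have := ih' w hw.1 v' (Finset.mem_erase.2 ⟨hne.symm, hv'⟩)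
      calc _ = l * (Zm R l (A.erase w) (B.erase v) * Zm R l A ((B.erase v).erase v')) := by ring
        _ ≤ l * _ := mul_le_mul_of_nonneg_left this hl
        _ = _ := by ring

theorem Zm_upper (R : V → V → Prop) (l : ℝ) (hl : 0 ≤ l) (s : ℕ) (B : Finset V)
    (hs : ∀ u, (B.filter (fun w => R u w)).card ≤ s) (A : Finset V) :
    Zm R l A B ≤ (1 + l * s) ^ A.card := by
  induction A using Finset.induction_on with
  | empty =>
    have : Mt R ∅ B = {∅} := by
      ext M
      rw [mem_Mt, Finset.mem_singleton]
      constructor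
      · rintro ⟨h, -⟩
        rw [Finset.eq_empty_iff_forall_notMem]
        intro e he
        simpa using (h e he).1
      · rintro rfl; simp
    simp [Zm, this]
  | insert a A ha ih =>
    rw [Zm_rec R l (insert a A) B a (Finset.mem_insert_self _ _), Finset.erase_insert ha,
      Finset.card_insert_of_notMem ha, pow_succ]
    have hmono : ∀ w, Zm R l A (B.erase w) ≤ Zm R l A B := by
      intro w
      apply Finset.sum_le_sum_of_subset_of_nonneg
      · intro M hM
        rw [mem_Mt] at hM ⊢
        exact ⟨fun e he => ⟨(hM.1 e he).1, Finset.mem_of_mem_erase (hM.1 e he).2.1, (hM.1 e he).2.2⟩, hM.2⟩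
      · intro _ _ _; positivity
    have h0 := Zm_nonneg R l hl A B
    have : ∑ w ∈ B.filter (fun w => R a w), l * Zm R l A (B.erase w) ≤ s * (l * Zm R l A B) := by
      refine (Finset.sum_le_card_nsmul _ _ (l * Zm R l A B)
        fun w _ => mul_le_mul_of_nonneg_left (hmono w) hl).trans ?_
      rw [nsmul_eq_mul]
      exact mul_le_mul_of_nonneg_right (by exact_mod_cast hs a) (by positivity)
    calc _ ≤ Zm R l A B + s * (l * Zm R l A B) := by linarith
      _ = Zm R l A B * (1 + l * s) := by ring
      _ ≤ _ := mul_le_mul_of_nonneg_right ih (by positivity)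

variable [Fintype V]

theorem sum_card_edge (R : V → V → Prop) (l : ℝ) :
    ∑ M ∈ Mt R Finset.univ Finset.univ, (M.card : ℝ) * l ^ M.card =
      ∑ u, ∑ w, if R u w then l * Zm R l (Finset.univ.erase u) (Finset.univ.erase w) else 0 := by
  have : ∀ u w, (if R u w then l * Zm R l (Finset.univ.erase u) (Finset.univ.erase w) else 0) =
      ∑ M ∈ Mt R Finset.univ Finset.univ, if (u, w) ∈ M then l ^ M.card else 0 := by
    intro u w
    split_ifs with h
    · rw [← Zm_edge R l _ _ u w (Finset.mem_univ _) (Finset.mem_univ _) h, Finset.sum_filter]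
    · rw [Finset.sum_eq_zero]
      intro M hM
      rw [if_neg]
      intro hm
      exact h ((mem_Mt.1 hM).1 _ hm).2.2
  simp_rw [this]
  rw [← Fintype.sum_prod_type (f := fun p : V × V => ∑ M ∈ Mt R Finset.univ Finset.univ, if p ∈ M then l ^ M.card else 0)]
  rw [Finset.sum_comm]
  apply Finset.sum_congr rfl
  intro M _
  simp

theorem sum_uncov (R : V → V → Prop) (l : ℝ) :
    ∑ M ∈ Mt R Finset.univ Finset.univ, ((Fintype.card V : ℝ) - M.card) * l ^ M.card =
      ∑ u, Zm R l (Finset.univ.erase u) Finset.univ := by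
  have : ∀ u, Zm R l (Finset.univ.erase u) Finset.univ =
      ∑ M ∈ Mt R Finset.univ Finset.univ, if (∀ e ∈ M, e.1 ≠ u) then l ^ M.card else 0 := by
    intro u
    rw [← Finset.sum_filter, Zm, ← Mt_erase]
    refine Finset.sum_congr ?_ (fun _ _ => rfl)
    ext; simp only [Finset.mem_filter]
  simp_rw [this]
  rw [Finset.sum_comm]
  apply Finset.sum_congr rfl
  intro M hM
  rw [← Finset.sum_filter, Finset.sum_const, nsmul_eq_mul]
  congr 1
  have h1 : (M.image Prod.fst).card = M.card := by
    apply Finset.card_image_of_injOn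
    intro e he e' he' h
    exact (mem_Mt.1 hM).2 e he e' he' (Or.inl h)
  have h2 : Finset.univ.filter (fun u => ∀ e ∈ M, e.1 ≠ u) = (M.image Prod.fst)ᶜ := by
    ext u; simp; grind
  rw [h2, Finset.card_compl, h1, Nat.cast_sub]
  rw [← h1]; exact Finset.card_le_univ _

theorem sum_uncov' (R : V → V → Prop) (l : ℝ) :
    ∑ u, Zm R l (Finset.univ.erase u) Finset.univ =
      ∑ u, Zm R l Finset.univ (Finset.univ.erase u) := by
  have h : ∀ R' : V → V → Prop, ∑ u, Zm R' l (Finset.univ.erase u) Finset.univ =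
      Fintype.card V * Zm R' l Finset.univ Finset.univ -
      ∑ u, ∑ w, if R' u w then l * Zm R' l (Finset.univ.erase u) (Finset.univ.erase w) else 0 := by
    intro R'
    rw [← sum_uncov, ← sum_card_edge, Zm, Finset.mul_sum, ← Finset.sum_sub_distrib]
    apply Finset.sum_congr rfl
    intro M _; ring
  simp_rw [Zm_swap R l Finset.univ (Finset.univ.erase _)]
  rw [h, h, Finset.sum_comm, Zm_swap R l Finset.univ Finset.univ]
  simp_rw [Zm_swap R l (Finset.univ.erase _) (Finset.univ.erase _)]

end matchings

section lift
open Classical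

theorem Zm_equiv {V : Type*} [DecidableEq V] (R : V → V → Prop) (l : ℝ) (t : V ≃ V)
    (ht : ∀ a b, R (t a) (t b) ↔ R a b) (A B : Finset V) :
    Zm R l (A.image t) (B.image t) = Zm R l A B := by
  have aux : ∀ (t : V ≃ V) (_ : ∀ a b, R (t a) (t b) ↔ R a b) (A B : Finset V) M, M ∈ Mt R A B →
      M.image (Prod.map t t) ∈ Mt R (A.image t) (B.image t) := by
    intro t ht A B M hM
    rw [mem_Mt] at hM ⊢
    refine ⟨?_, ?_⟩
    · intro e he
      rw [Finset.mem_image] at he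
      obtain ⟨e, he, rfl⟩ := he
      have := hM.1 e he
      exact ⟨Finset.mem_image_of_mem _ this.1, Finset.mem_image_of_mem _ this.2.1,
        (ht _ _).2 this.2.2⟩
    · intro e he e' he' h
      rw [Finset.mem_image] at he he'
      obtain ⟨e, he, rfl⟩ := he
      obtain ⟨e', he', rfl⟩ := he'
      rw [hM.2 e he e' he' (by simpa using h)]
  have sw : ∀ (t : V ≃ V) (M : Finset (V × V)),
      (M.image (Prod.map t t)).image (Prod.map t.symm t.symm) = M := by
    intro t M
    rw [Finset.image_image, Prod.map_comp_map]
    simp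
  have sw1 : ∀ (A : Finset V), (A.image t).image t.symm = A := by
    intro A; rw [Finset.image_image]; simp
  symm
  refine Finset.sum_bij' (fun M _ => M.image (Prod.map t t))
    (fun M _ => M.image (Prod.map t.symm t.symm)) ?_ ?_ ?_ ?_ ?_
  · intro M hM; exact aux t ht _ _ _ hM
  · intro M hM
    have := aux t.symm (fun a b => by rw [← ht]; simp) _ _ _ hM
    rwa [sw1, sw1] at this
  · intro M _; exact sw t M
  · intro M _; exact sw t.symm M
  · intro M _
    rw [Finset.card_image_of_injective _ (Function.Injective.prodMap t.injective t.injective)]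

/-- the lift relation -/
def LR {ι Γ : Type*} [AddCommGroup Γ] (ψ : ι → ι → Γ) (a b : ι × Γ) : Prop :=
  b.2 - a.2 = ψ a.1 b.1

variable {ι Γ : Type*} [AddCommGroup Γ] [Fintype ι] [Fintype Γ] [DecidableEq ι] [DecidableEq Γ] (ψ : ι → ι → Γ)

theorem LR_card (a : ι × Γ) :
    (Finset.univ.filter (fun b => LR ψ a b)).card ≤ Fintype.card ι := by
  rw [← Finset.card_univ]
  apply Finset.card_le_card_of_injOn (fun b => b.1) (by simp)
  intro b hb c hc h
  replace hb : b.2 - a.2 = ψ a.1 b.1 := (Finset.mem_filter.1 (Finset.mem_coe.1 hb)).2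
  replace hc : c.2 - a.2 = ψ a.1 c.1 := (Finset.mem_filter.1 (Finset.mem_coe.1 hc)).2
  simp only at h
  apply Prod.ext h
  rw [← h, ← hb] at hc
  exact (sub_left_injective hc).symm

theorem LR_ineq (l : ℝ) (hl : 0 ≤ l) :
    l * (∑ M ∈ Mt (LR ψ) Finset.univ Finset.univ, ((Fintype.card (ι × Γ) : ℝ) - M.card) * l ^ M.card) ^ 2
    ≤ Fintype.card Γ * (∑ M ∈ Mt (LR ψ) Finset.univ Finset.univ, (M.card : ℝ) * l ^ M.card) *
      Zm (LR ψ) l Finset.univ Finset.univ := by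
  have inv : ∀ γ : Γ, ∀ a b, LR ψ ((Equiv.prodCongr (Equiv.refl ι) (Equiv.addRight γ)) a)
      ((Equiv.prodCongr (Equiv.refl ι) (Equiv.addRight γ)) b) ↔ LR ψ a b := by
    intro γ a b; simp [LR]
  have im : ∀ i : ι, ∀ γ : Γ, (Finset.univ.erase (i, (0:Γ))).image
      (Equiv.prodCongr (Equiv.refl ι) (Equiv.addRight γ)) = Finset.univ.erase (i, γ) := by
    intro i γ
    rw [Finset.image_erase (Equiv.injective _), Finset.image_univ_equiv]
    simp
  have ha : ∀ i : ι, ∀ γ : Γ, Zm (LR ψ) l (Finset.univ.erase (i, γ)) Finset.univ =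
      Zm (LR ψ) l (Finset.univ.erase (i, 0)) Finset.univ := by
    intro i γ
    rw [← im i γ, ← Zm_equiv (LR ψ) l _ (inv γ) (Finset.univ.erase (i, 0)) Finset.univ]
    rw [Finset.image_univ_equiv]
  have hb : ∀ i : ι, ∀ γ : Γ, Zm (LR ψ) l Finset.univ (Finset.univ.erase (i, γ)) =
      Zm (LR ψ) l Finset.univ (Finset.univ.erase (i, 0)) := by
    intro i γ
    rw [← im i γ, ← Zm_equiv (LR ψ) l _ (inv γ) Finset.univ (Finset.univ.erase (i, 0))]
    rw [Finset.image_univ_equiv]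
  set a : ι → ℝ := fun i => Zm (LR ψ) l (Finset.univ.erase (i, 0)) Finset.univ with haa
  set b : ι → ℝ := fun i => Zm (LR ψ) l Finset.univ (Finset.univ.erase (i, 0)) with hbb
  set Z := Zm (LR ψ) l Finset.univ Finset.univ with hZ
  have Y1 : ∑ u, Zm (LR ψ) l (Finset.univ.erase u) Finset.univ = Fintype.card Γ * ∑ i, a i := by
    rw [Fintype.sum_prod_type]
    simp_rw [ha]
    simp [Finset.mul_sum, haa]
  have Y2 : ∑ u, Zm (LR ψ) l (Finset.univ.erase u) Finset.univ = Fintype.card Γ * ∑ i, b i := by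
    rw [sum_uncov', Fintype.sum_prod_type]
    simp_rw [hb]
    simp [Finset.mul_sum, hbb]
  rw [sum_uncov, sum_card_edge]
  have hX : l * (Fintype.card Γ * ((∑ i, a i) * ∑ j, b j)) ≤ (∑ u, ∑ w, if LR ψ u w then
      l * Zm (LR ψ) l (Finset.univ.erase u) (Finset.univ.erase w) else 0) * Z := by
    have e1 : l * (Fintype.card Γ * ((∑ i, a i) * ∑ j, b j)) =
        ∑ u : ι × Γ, ∑ w : ι × Γ, if LR ψ u w then l * (a u.1 * b w.1) else 0 := by
      have e2 : ∀ u : ι × Γ, (∑ w : ι × Γ, if LR ψ u w then l * (a u.1 * b w.1) else 0) =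
          ∑ j, l * (a u.1 * b j) := by
        intro u
        rw [Fintype.sum_prod_type]
        apply Finset.sum_congr rfl
        intro j _
        rw [Finset.sum_eq_single (ψ u.1 j + u.2)]
        · rw [if_pos]; simp [LR]
        · intro h _ hne
          rw [if_neg]
          intro hR
          apply hne
          rw [← hR]; simp
        · simp
      simp_rw [e2]
      rw [Fintype.sum_prod_type]
      simp only [Finset.sum_const, Finset.card_univ, nsmul_eq_mul]
      rw [Finset.sum_mul_sum, Finset.mul_sum, Finset.mul_sum]
      apply Finset.sum_congr rfl
      intro i _
      simp only [Finset.mul_sum]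
      apply Finset.sum_congr rfl
      intro j _
      ring
    rw [e1, Finset.sum_mul]
    apply Finset.sum_le_sum
    intro u _
    rw [Finset.sum_mul]
    apply Finset.sum_le_sum
    intro w _
    split_ifs with h
    · have := (Zm_corr (LR ψ) l hl _ Finset.univ Finset.univ le_rfl).1 u (Finset.mem_univ _) w (Finset.mem_univ _)
      have e1 := ha u.1 u.2
      have e2 := hb w.1 w.2
      simp only [Prod.mk.eta] at e1 e2
      rw [e1, e2] at this
      calc l * (a u.1 * b w.1) ≤ l * _ := mul_le_mul_of_nonneg_left this hl
        _ = _ := by ring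
    · simp
  calc _ = Fintype.card Γ * (l * (Fintype.card Γ * ((∑ i, a i) * ∑ j, b j))) := by
        rw [sq]; nth_rewrite 1 [Y1]; rw [Y2]; ring
    _ ≤ Fintype.card Γ * _ := mul_le_mul_of_nonneg_left hX (by positivity)
    _ = _ := by ring

theorem empty_mem_Mt {V : Type*} (R : V → V → Prop) (A B : Finset V) : ∅ ∈ Mt R A B := by
  rw [mem_Mt]; simp

theorem Zm_ge_one {V : Type*} (R : V → V → Prop) (l : ℝ) (hl : 0 ≤ l) (A B : Finset V) :
    1 ≤ Zm R l A B := by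
  have := Finset.single_le_sum (f := fun M : Finset (V × V) => l ^ M.card) (fun M _ => pow_nonneg hl _) (empty_mem_Mt R A B)
  simpa [Zm] using this

theorem LR_lower (hs : 1 ≤ Fintype.card ι) :
    (Fintype.card (ι × Γ) : ℝ) * (Real.log (Fintype.card ι : ℝ) - 2) ≤
      Real.log ((Mt (LR ψ) Finset.univ Finset.univ).card : ℝ) := by
  set s : ℝ := (Fintype.card ι : ℝ) with hsdef
  have hs1 : 1 ≤ s := by rw [hsdef]; exact_mod_cast hs
  set N : ℝ := (Fintype.card (ι × Γ) : ℝ) with hN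
  set 𝓜 := Mt (LR ψ) Finset.univ Finset.univ with hM
  set F : ℝ → ℝ := fun l => Zm (LR ψ) l Finset.univ Finset.univ with hF
  have hFpos : ∀ l, 0 ≤ l → 0 < F l := fun l hl => lt_of_lt_of_le one_pos (Zm_ge_one _ l hl _ _)
  have hNs : N = s * Fintype.card Γ := by rw [hN, hsdef]; simp
  have hG1 : (1:ℝ) ≤ Fintype.card Γ := by
    have : 0 < Fintype.card Γ := Fintype.card_pos
    exact_mod_cast this
  have hNpos : 0 < N := by rw [hNs]; positivity
  have hder : ∀ l, HasDerivAt F (∑ M ∈ 𝓜, (M.card : ℝ) * l ^ (M.card - 1)) l := by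
    intro l
    simp only [hF, Zm]
    apply HasDerivAt.fun_sum
    intro M _
    exact hasDerivAt_pow _ _
  -- the key inequality
  have hkey : ∀ x : ℝ, 1 ≤ x → 0 ≤ (x^2/s) * (∑ M ∈ 𝓜, (M.card : ℝ) * (x^2/s) ^ (M.card - 1)) / F (x^2/s) - N + N / x := by
    intro x hx
    set l := x^2/s with hl
    have hlpos : 0 < l := by positivity
    have e1 : l * (∑ M ∈ 𝓜, (M.card : ℝ) * l ^ (M.card - 1)) = ∑ M ∈ 𝓜, (M.card : ℝ) * l ^ M.card := by
      rw [Finset.mul_sum]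
      apply Finset.sum_congr rfl
      intro M _
      rcases Nat.eq_zero_or_pos M.card with h | h
      · simp [h]
      · rw [show l ^ M.card = l ^ (M.card - 1 + 1) by rw [Nat.sub_add_cancel h], pow_succ]; ring
    rw [e1]
    have hineq := LR_ineq ψ l hlpos.le
    rw [← hM, ← hN] at hineq
    set X := ∑ M ∈ 𝓜, (M.card : ℝ) * l ^ M.card with hX
    have hY : ∑ M ∈ 𝓜, (N - M.card) * l ^ M.card = N * F l - X := by
      simp only [hF, Zm, ← hM]
      rw [hX, Finset.mul_sum, ← Finset.sum_sub_distrib]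
      apply Finset.sum_congr rfl
      intro M _; ring
    rw [hY] at hineq
    change _ ≤ _ * F l at hineq
    have hf := hFpos l hlpos.le
    have hX0 : 0 ≤ X := Finset.sum_nonneg fun M _ => by positivity
    -- with `p = (N F - X)/(N F)`
    have hxs : x^2 * (N * F l - X)^2 ≤ N * X * F l := by
      have : s * (l * (N * F l - X)^2) ≤ s * (Fintype.card Γ * X * F l) :=
        mul_le_mul_of_nonneg_left hineq (by positivity)
      have h2 : s * l = x^2 := by rw [hl]; field_simp
      calc _ = s * (l * (N * F l - X)^2) := by rw [← h2]; ring
        _ ≤ _ := this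
        _ = _ := by rw [hNs]; ring
    by_cases hneg : N * F l - X ≤ 0
    · have : N ≤ X / F l := by rw [le_div_iff₀ hf]; linarith
      have : 0 ≤ N / x := by positivity
      linarith
    · push Not at hneg
      have h3 : (x * (N * F l - X))^2 ≤ (N * F l)^2 := by
        calc _ = x^2 * (N * F l - X)^2 := by ring
          _ ≤ N * X * F l := hxs
          _ ≤ N * (N * F l) * F l := by gcongr; linarith
          _ = _ := by ring
      have h4 := abs_le_of_sq_le_sq' h3 (by positivity)
      have h5 : (N * F l - X) / F l ≤ N / x := by
        rw [div_le_div_iff₀ hf (by positivity)]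
        linarith [h4.2]
      have : (N * F l - X) / F l = N - X / F l := by field_simp
      linarith
  set Φ : ℝ → ℝ := fun x => Real.log (F (x^2/s)) - 2 * N * Real.log x - 2 * N / x with hΦ
  have hΦd : ∀ x : ℝ, 1 ≤ x → HasDerivAt Φ ((2/x) * ((x^2/s) * (∑ M ∈ 𝓜, (M.card : ℝ) * (x^2/s) ^ (M.card - 1)) / F (x^2/s) - N + N / x)) x := by
    intro x hx
    have hx0 : x ≠ 0 := by positivity
    have hf := hFpos (x^2/s) (by positivity)
    have d1 : HasDerivAt (fun x : ℝ => x^2/s) (2*x/s) x := by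
      have := (hasDerivAt_pow 2 x).div_const s
      simpa using this
    have d2' : HasDerivAt (F ∘ fun x : ℝ => x^2/s) _ x := HasDerivAt.comp x (h := fun x : ℝ => x^2/s) (hder (x^2/s)) d1
    have d2 := d2'.log hf.ne'
    have d3 := (Real.hasDerivAt_log hx0).const_mul (2*N)
    have d4 := (hasDerivAt_inv hx0).const_mul (2*N)
    have d5 := (d2.sub d3).sub d4
    have : Φ = (fun y => Real.log ((F ∘ fun x => x ^ 2 / s) y)) - (fun y => 2 * N * Real.log y) - fun y => 2 * N * y⁻¹ := by
      funext y; simp [hΦ, div_eq_mul_inv]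
    rw [this]
    refine d5.congr_deriv ?_
    simp only [Function.comp]
    field_simp
    ring
  have hmono : MonotoneOn Φ (Set.Ici 1) := by
    apply monotoneOn_of_deriv_nonneg (convex_Ici 1)
    · intro x hx
      exact (hΦd x hx).continuousAt.continuousWithinAt
    · intro x hx
      rw [interior_Ici] at hx
      exact (hΦd x (le_of_lt hx)).differentiableAt.differentiableWithinAt
    · intro x hx
      rw [interior_Ici] at hx
      have hx1 : 1 ≤ x := le_of_lt hx
      rw [(hΦd x hx1).deriv]
      exact mul_nonneg (by positivity) (hkey x hx1)
  have hsq : 1 ≤ Real.sqrt s := by rw [Real.one_le_sqrt]; exact hs1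
  have := hmono (Set.mem_Ici.2 le_rfl) (Set.mem_Ici.2 hsq) hsq
  simp only [hΦ] at this
  rw [Real.sq_sqrt (by positivity), div_self (by positivity), Real.log_sqrt (by positivity)] at this
  simp only [Real.log_one, one_pow] at this
  have h1 : 0 ≤ Real.log (F (1/s)) := Real.log_nonneg (Zm_ge_one _ _ (by positivity) _ _)
  have h2 : F 1 = (𝓜.card : ℝ) := by simp [hF, Zm, ← hM]
  rw [h2] at this
  have h3 : 0 ≤ 2 * N / Real.sqrt s := by positivity
  linarith

end lift

section perms
open Classical

theorem exists_perm_extend {V : Type*} [Fintype V] (R : V → V → Prop) (M : Finset (V × V))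
    (hM : M ∈ Mt R Finset.univ Finset.univ) : ∃ σ : Equiv.Perm V, ∀ e ∈ M, σ e.1 = e.2 := by
  rw [mem_Mt] at hM
  let f : V → V := fun u => if h : ∃ w, (u, w) ∈ M then h.choose else u
  have hf : ∀ e ∈ M, f e.1 = e.2 := by
    intro e he
    have h : ∃ w, (e.1, w) ∈ M := ⟨e.2, he⟩
    simp only [f, dif_pos h]
    have := hM.2 _ h.choose_spec _ he (Or.inl rfl)
    exact congrArg Prod.snd this
  obtain ⟨g, hg⟩ := Finset.exists_equiv_extend_of_card_eq (α := V) (β := V) (t := Finset.univ)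
    (by simp) (s := M.image Prod.fst) (f := f) (by simp) (by
      intro u hu v hv h
      simp only [Finset.coe_image, Set.mem_image, Finset.mem_coe] at hu hv
      obtain ⟨e, he, rfl⟩ := hu
      obtain ⟨e', he', rfl⟩ := hv
      rw [hf e he, hf e' he'] at h
      rw [hM.2 e he e' he' (Or.inr h)])
  refine ⟨g.trans (Equiv.subtypeUnivEquiv (by simp)), ?_⟩
  intro e he
  have := hg e.1 (Finset.mem_image_of_mem _ he)
  rw [hf e he] at this
  simpa using this

/-- permutations with at most `d` defects -/
noncomputable def PP {V : Type*} [Fintype V] (R : V → V → Prop) (d : ℕ) : Finset (Equiv.Perm V) :=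
  Finset.univ.filter (fun σ => (Finset.univ.filter (fun u => ¬ R u (σ u))).card ≤ d)

theorem PP_large {V : Type*} [Fintype V] (R : V → V → Prop) (d : ℕ) :
    ((Mt R Finset.univ Finset.univ).filter (fun M => Fintype.card V ≤ M.card + d)).card ≤
      2 ^ Fintype.card V * (PP R d).card := by
  choose! φ hφ using exists_perm_extend R
  apply Finset.card_le_mul_card_image_of_maps_to (f := φ)
  · intro M hM
    rw [Finset.mem_filter] at hM
    rw [PP, Finset.mem_filter]
    refine ⟨Finset.mem_univ _, ?_⟩
    have h1 := hφ M hM.1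
    have h2 := mem_Mt.1 hM.1
    have hc : (M.image Prod.fst).card = M.card := by
      apply Finset.card_image_of_injOn
      intro e he e' he' h
      exact h2.2 e he e' he' (Or.inl h)
    have hsub : Finset.univ.filter (fun u => ¬ R u (φ M u)) ⊆ (M.image Prod.fst)ᶜ := by
      intro u hu
      rw [Finset.mem_filter] at hu
      rw [Finset.mem_compl]
      intro hm
      rw [Finset.mem_image] at hm
      obtain ⟨e, he, rfl⟩ := hm
      apply hu.2
      rw [h1 e he]
      exact (h2.1 e he).2.2
    have := Finset.card_le_card hsub
    rw [Finset.card_compl, hc] at this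
    omega
  · intro σ _
    have : (2:ℕ) ^ Fintype.card V = (Finset.univ : Finset (Finset V)).card := by simp
    rw [this]
    apply Finset.card_le_card_of_injOn (fun M => M.image Prod.fst) (by simp)
    have key : ∀ M, M ∈ (((Mt R Finset.univ Finset.univ).filter (fun M => Fintype.card V ≤ M.card + d)).filter (fun M => φ M = σ)) → M = (M.image Prod.fst).image (fun u => (u, σ u)) := by
      intro M hM
      rw [Finset.mem_filter, Finset.mem_filter] at hM
      have h1 := hφ M hM.1.1
      rw [hM.2] at h1
      rw [Finset.image_image]
      ext e
      rw [Finset.mem_image]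
      constructor
      · intro he
        exact ⟨e, he, Prod.ext rfl (h1 e he)⟩
      · rintro ⟨e', he', rfl⟩
        have : ((fun u => (u, σ u)) ∘ Prod.fst) e' = e' := Prod.ext rfl (h1 e' he')
        rwa [this]
    intro M hM M' hM' h
    rw [key M hM, key M' hM']
    simp only at h
    rw [h]

variable {ι Γ : Type*} [AddCommGroup Γ] [Fintype ι] [Fintype Γ]  (ψ : ι → ι → Γ)

theorem PP_lower (hs : 1 ≤ Fintype.card ι) (T d : ℕ)
    (hT : Fintype.card (ι × Γ) ≤ T * (d + 1))
    (hsT : (4 * Real.exp 2) ^ T ≤ (Fintype.card ι : ℝ)) :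
    ((Fintype.card ι : ℝ) / (4 * Real.exp 2)) ^ Fintype.card (ι × Γ) ≤ ((PP (LR ψ) d).card : ℝ) := by
  set s : ℝ := (Fintype.card ι : ℝ) with hsdef
  have hs1 : 1 ≤ s := by rw [hsdef]; exact_mod_cast hs
  set N := Fintype.card (ι × Γ) with hN
  have hNpos : 1 ≤ N := by
    rw [hN, Fintype.card_prod]
    have : 0 < Fintype.card Γ := Fintype.card_pos
    exact Nat.mul_pos hs this
  set 𝓜 := Mt (LR ψ) Finset.univ Finset.univ with hM
  set a := (s / Real.exp 2) ^ N with ha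
  clear_value N s
  have hapos : 0 < a := by positivity
  have hlow : a ≤ 𝓜.card := by
    have h := LR_lower ψ hs
    have hpos : (0:ℝ) < 𝓜.card := by
      have : 0 < 𝓜.card := Finset.card_pos.2 ⟨∅, empty_mem_Mt _ _ _⟩
      exact_mod_cast this
    rw [← Real.log_le_log_iff hapos hpos, ha, Real.log_pow, Real.log_div (by positivity) (by positivity), Real.log_exp]
    rw [← hsdef, ← hN] at h
    exact h
  have hsmall : ((𝓜.filter (fun M => ¬ N ≤ M.card + d)).card : ℝ) * s ^ (d+1) ≤ 2 ^ N * s ^ N := by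
    have hup := Zm_upper (LR ψ) (1/s) (by positivity) (Fintype.card ι) Finset.univ (fun u => LR_card ψ u) Finset.univ
    rw [← hsdef, one_div_mul_cancel (by positivity), Finset.card_univ, ← hN] at hup
    have h1 : ∑ M ∈ 𝓜.filter (fun M => ¬ N ≤ M.card + d), s ^ (d+1) / s ^ N ≤ Zm (LR ψ) (1/s) Finset.univ Finset.univ := by
      refine le_trans ?_ (Finset.sum_le_sum_of_subset_of_nonneg (Finset.filter_subset (fun M => ¬ N ≤ M.card + d) _) (fun _ _ _ => by positivity))
      apply Finset.sum_le_sum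
      intro M hM
      rw [Finset.mem_filter] at hM
      rw [one_div, inv_pow, ← one_div, div_le_div_iff₀ (by positivity) (by positivity), ← pow_add, one_mul]
      exact pow_le_pow_right₀ hs1 (by omega)
    rw [Finset.sum_const, nsmul_eq_mul] at h1
    have h2 := h1.trans hup
    rw [← mul_div_assoc, div_le_iff₀ (by positivity)] at h2
    calc _ ≤ _ := h2
      _ = _ := by norm_num
  have hq : 0 ≤ ((𝓜.filter (fun M => ¬ N ≤ M.card + d)).card : ℝ) := Nat.cast_nonneg _
  generalize hqq : ((𝓜.filter (fun M => ¬ N ≤ M.card + d)).card : ℝ) = q at hsmall hq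
  have hsd : (4 * Real.exp 2) ^ N ≤ s ^ (d+1) := by
    calc (4 * Real.exp 2) ^ N ≤ (4 * Real.exp 2) ^ (T * (d+1)) := by
          apply pow_le_pow_right₀ _ hT
          have := Real.add_one_le_exp 2
          linarith
      _ = ((4 * Real.exp 2) ^ T) ^ (d+1) := pow_mul _ _ _
      _ ≤ _ := by gcongr
  have h2N : (2:ℝ) ≤ 2 ^ N := by
    calc (2:ℝ) = 2 ^ 1 := by norm_num
      _ ≤ _ := pow_le_pow_right₀ (by norm_num) hNpos
  clear_value a 𝓜
  have hsm2 : q ≤ a / 2 := by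
    have h3 := (mul_le_mul_of_nonneg_left hsd hq).trans hsmall
    have h4 : (4 * Real.exp 2) ^ N = 2 ^ N * (2 ^ N * Real.exp 2 ^ N) := by
      rw [← mul_pow, ← mul_pow]; ring
    rw [h4] at h3
    have h5 : q * (2 ^ N * Real.exp 2 ^ N) ≤ s ^ N := by
      have : (0:ℝ) < 2 ^ N := by positivity
      nlinarith
    have h6 : q * 2 ^ N ≤ a := by
      rw [ha, div_pow, le_div_iff₀ (by positivity)]; linarith
    nlinarith
  have hlarge := PP_large (LR ψ) d
  rw [← hN, ← hM] at hlarge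
  have hlarge' : ((𝓜.filter (fun M => N ≤ M.card + d)).card : ℝ) ≤ 2 ^ N * ((PP (LR ψ) d).card : ℝ) := by
    exact_mod_cast hlarge
  have hsum : ((𝓜.filter (fun M => N ≤ M.card + d)).card : ℝ) + ((𝓜.filter (fun M => ¬ N ≤ M.card + d)).card : ℝ) = 𝓜.card := by
    exact_mod_cast Finset.card_filter_add_card_filter_not (s := 𝓜) (fun M => N ≤ M.card + d)
  rw [hqq] at hsum
  have h7 : a / 2 ≤ 2 ^ N * ((PP (LR ψ) d).card : ℝ) := by linarith
  have h8 : (s / (4 * Real.exp 2)) ^ N = a / (2 ^ N * 2 ^ N) := by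
    rw [ha, ← mul_pow, ← div_pow]; congr 1; field_simp; norm_num
  rw [h8, div_le_iff₀ (by positivity)]
  have : (0:ℝ) ≤ (PP (LR ψ) d).card := Nat.cast_nonneg _
  have h9 : 2 * (2 ^ N * ((PP (LR ψ) d).card : ℝ)) ≤ 2 ^ N * (2 ^ N * ((PP (LR ψ) d).card : ℝ)) := by
    apply mul_le_mul_of_nonneg_right h2N; positivity
  linarith

end perms

section orderings
open Classical

theorem exists_succ_fun {V : Type*} (l : List V) (hl : l.Nodup) :
    ∃ f : V → V, l.IsChain (fun u w => f u = w) := by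
  refine ⟨fun u => if h : l.idxOf u + 1 < l.length then l[l.idxOf u + 1] else u, ?_⟩
  rw [List.isChain_iff_getElem]
  intro i hi
  have : l.idxOf l[i] = i := hl.idxOf_getElem i (by omega)
  simp only [this]
  rw [dif_pos hi]

variable {W : Type*} [Fintype W] {T : ℕ}

/-- partial compositions -/
def rho (σ : Fin T → Equiv.Perm W) : Fin (T+1) → Equiv.Perm W :=
  fun t => Fin.induction (motive := fun _ => Equiv.Perm W) 1 (fun t ρ => σ t * ρ) t

theorem rho_succ (σ : Fin T → Equiv.Perm W) (t : Fin T) :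
    rho σ t.succ = σ t * rho σ t.castSucc := by
  simp [rho]

noncomputable def blk (σ : Fin T → Equiv.Perm W) (v : W) : List (Fin (T+1) × W) :=
  (List.finRange (T+1)).map (fun t => (t, rho σ t v))

noncomputable def ordl (σ : Fin T → Equiv.Perm W) : List (Fin (T+1) × W) :=
  ((Finset.univ : Finset W).toList.map (blk σ)).flatten

theorem blk_ne (σ : Fin T → Equiv.Perm W) (v : W) : blk σ v ≠ [] := by
  intro h
  have := congrArg List.length h
  simp [blk] at this

theorem ordl_nodup (σ : Fin T → Equiv.Perm W) : (ordl σ).Nodup := by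
  rw [ordl, ← List.flatMap_def, List.nodup_flatMap]
  refine ⟨?_, ?_⟩
  · intro v _
    apply List.Nodup.map _ (List.nodup_finRange _)
    intro t t' h
    exact congrArg Prod.fst h
  · refine (Finset.nodup_toList _).imp ?_
    intro v v' hne
    intro p hp hp'
    simp only [blk, List.mem_map] at hp hp'
    obtain ⟨t, -, rfl⟩ := hp
    obtain ⟨t', -, h⟩ := hp'
    simp only [Prod.mk.injEq] at h
    obtain ⟨rfl, h⟩ := h
    exact hne ((rho σ t').injective h).symm

theorem ordl_mem (σ : Fin T → Equiv.Perm W) (p) : p ∈ ordl σ := by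
  rw [ordl, ← List.flatMap_def, List.mem_flatMap]
  refine ⟨(rho σ p.1).symm p.2, by simp, ?_⟩
  simp only [blk, List.mem_map]
  exact ⟨p.1, by simp, by simp⟩

theorem ordl_chain (σ : Fin T → Equiv.Perm W) (P : Fin (T+1) × W → Fin (T+1) × W → Prop) :
    (ordl σ).IsChain P ↔ (∀ t : Fin T, ∀ u, P (t.castSucc, u) (t.succ, σ t u)) ∧
      ((Finset.univ : Finset W).toList.map (blk σ)).IsChain
        (fun l₁ l₂ => ∀ x ∈ l₁.getLast?, ∀ y ∈ l₂.head?, P x y) := by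
  rw [ordl, List.isChain_flatten]
  · apply and_congr_left
    intro _
    constructor
    · intro h t u
      have h1 := h (blk σ ((rho σ t.castSucc).symm u)) (by simp)
      rw [List.isChain_iff_getElem] at h1
      have h2 := h1 t.1 (by simp [blk])
      simp only [blk, List.getElem_map, List.getElem_finRange] at h2
      have e1 : (Fin.cast (List.length_finRange (n := T+1)) ⟨t.1, by simp⟩) = t.castSucc := by
        ext; simp
      have e2 : (Fin.cast (List.length_finRange (n := T+1)) ⟨t.1+1, by simp⟩) = t.succ := by
        ext; simp
      rw [e1, e2, rho_succ] at h2
      simpa using h2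
    · intro h l hl
      rw [List.mem_map] at hl
      obtain ⟨v, -, rfl⟩ := hl
      rw [List.isChain_iff_getElem]
      intro i hi
      have hi' : i < T := by simpa [blk] using hi
      simp only [blk, List.getElem_map, List.getElem_finRange]
      have e1 : (Fin.cast (List.length_finRange (n := T+1)) ⟨i, by simp; omega⟩) = (⟨i, hi'⟩ : Fin T).castSucc := by
        ext; simp
      have e2 : (Fin.cast (List.length_finRange (n := T+1)) ⟨i+1, by simpa using hi'⟩) = (⟨i, hi'⟩ : Fin T).succ := by
        ext; simp
      rw [e1, e2, rho_succ]
      exact h _ _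
  · intro h
    rw [List.mem_map] at h
    obtain ⟨v, -, h⟩ := h
    exact blk_ne σ v h

theorem ordl_inj : Function.Injective (ordl : (Fin T → Equiv.Perm W) → _) := by
  intro σ σ' h
  obtain ⟨f, hf⟩ := exists_succ_fun _ (ordl_nodup σ)
  have h1 := ((ordl_chain σ _).1 hf).1
  rw [h] at hf
  have h2 := ((ordl_chain σ' _).1 hf).1
  funext t
  ext u
  have := (h1 t u).symm.trans (h2 t u)
  exact congrArg Prod.snd this

noncomputable def Dset (Rt : Fin T → W → W → Prop) (σ : Fin T → Equiv.Perm W) :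
    Finset (Fin (T+1) × W) :=
  Finset.univ.filter (fun p => p.1 = Fin.last T ∨ ∃ t : Fin T, p.1 = t.castSucc ∧ ¬ Rt t p.2 (σ t p.2))

theorem Dset_card (Rt : Fin T → W → W → Prop) (d : ℕ) (σ : Fin T → Equiv.Perm W)
    (hσ : ∀ t, σ t ∈ PP (Rt t) d) : (Dset Rt σ).card ≤ Fintype.card W + T * d := by
  have hsub : Dset Rt σ ⊆ Finset.univ.image (fun w : W => (Fin.last T, w)) ∪
      Finset.univ.biUnion (fun t : Fin T => (Finset.univ.filter (fun u => ¬ Rt t u (σ t u))).image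
        (fun w => (t.castSucc, w))) := by
    intro p hp
    rw [Dset, Finset.mem_filter] at hp
    rw [Finset.mem_union]
    rcases hp.2 with h | ⟨t, h, h'⟩
    · left
      rw [Finset.mem_image]
      exact ⟨p.2, Finset.mem_univ _, Prod.ext h.symm rfl⟩
    · right
      rw [Finset.mem_biUnion]
      refine ⟨t, Finset.mem_univ _, Finset.mem_image.2 ⟨p.2, ?_, Prod.ext h.symm rfl⟩⟩
      rw [Finset.mem_filter]
      exact ⟨Finset.mem_univ _, h'⟩
  refine (Finset.card_le_card hsub).trans ((Finset.card_union_le _ _).trans ?_)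
  apply add_le_add
  · exact Finset.card_image_le
  · refine (Finset.card_biUnion_le_card_mul _ _ d ?_).trans (by simp)
    intro t _
    refine Finset.card_image_le.trans ?_
    have := hσ t
    rw [PP, Finset.mem_filter] at this
    exact this.2

theorem count_bound {n L : ℕ} [Nonempty W] (R : Fin (T+1) × W → Fin (T+1) × W → Prop)
    (hR : ∀ u, R u u) (hW : ∀ g, ¬ FunCyc (Wg R) L g)
    (Rt : Fin T → W → W → Prop) (hRt : ∀ t u w, Rt t u w → R (t.castSucc, u) (t.succ, w))
    (d : ℕ)
    (hn : 2 * ((T+1) * Fintype.card W) + (L + 1) * (Fintype.card W + T * d) ≤ n)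
    (F : Finset (SimpleGraph (Fin n))) (hF : ∀ G ∈ F, IsHamPathGraph G)
    (hF2 : ∀ G₁ ∈ F, ∀ G₂ ∈ F, G₁ ≠ G₂ → ContainsCycleLen (G₁ ⊔ G₂) L) :
    F.card * ∏ t, (PP (Rt t) d).card ≤
      n.factorial * (2 ^ ((T+1) * Fintype.card W) *
        ((T+1) * Fintype.card W) ^ (Fintype.card W + T * d)) := by
  set S : Finset (Fin T → Equiv.Perm W) := Fintype.piFinset (fun t => PP (Rt t) d) with hS
  rw [← Fintype.card_piFinset, ← hS]
  have hcV : Fintype.card (Fin (T+1) × W) = (T+1) * Fintype.card W := by simp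
  let V := Fin (T+1) × W
  rw [← hcV] at hn ⊢
  set D0 := Fintype.card W + T * d with hD0
  choose f hf using fun σ : Fin T → Equiv.Perm W => exists_succ_fun _ (ordl_nodup σ)
  let κ : (Fin T → Equiv.Perm W) → (Σ _ : Finset V, V → V) := fun σ =>
    ⟨Dset Rt σ, fun u => if u ∈ Dset Rt σ then f σ u else u⟩
  let Q : Finset (Σ _ : Finset V, V → V) := (Finset.univ.filter (fun D : Finset V => D.card ≤ D0)).sigma
    (fun D => Fintype.piFinset (fun u => if u ∈ D then Finset.univ else {u}))
  have hQ : Q.card ≤ 2 ^ Fintype.card V * Fintype.card V ^ D0 := by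
    rw [Finset.card_sigma]
    refine (Finset.sum_le_card_nsmul _ _ (Fintype.card V ^ D0) ?_).trans ?_
    · intro D hD
      rw [Finset.mem_filter] at hD
      rw [Fintype.card_piFinset]
      have : ∀ u : V, (if u ∈ D then (Finset.univ : Finset V) else {u}).card =
          if u ∈ D then Fintype.card V else 1 := by
        intro u; split_ifs <;> simp
      simp_rw [this]
      rw [Finset.prod_ite]
      simp only [Finset.prod_const, one_pow, mul_one]
      have e : (Finset.univ.filter (fun u => u ∈ D)) = D := by ext; simp
      rw [e]
      exact Nat.pow_le_pow_right Fintype.card_pos hD.2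
    · rw [smul_eq_mul]
      apply Nat.mul_le_mul_right
      refine (Finset.card_le_univ _).trans ?_
      simp
  have hmaps : ∀ σ ∈ S, κ σ ∈ Q := by
    intro σ hσ
    simp only [Q, κ, Finset.mem_sigma, Finset.mem_filter, Finset.mem_univ, true_and]
    refine ⟨Dset_card Rt d σ (Fintype.mem_piFinset.1 hσ), ?_⟩
    rw [Fintype.mem_piFinset]
    intro u
    split_ifs <;> simp
  rw [Finset.card_eq_sum_card_fiberwise hmaps, Finset.mul_sum]
  refine (Finset.sum_le_card_nsmul _ _ n.factorial ?_).trans ?_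
  · intro q hq
    set S' := S.filter (fun σ => κ σ = q) with hS'
    rcases S'.eq_empty_or_nonempty with he | ⟨σ0, hσ0⟩
    · rw [he]; simp
    have hc : S'.card = (S'.image ordl).card := (Finset.card_image_of_injective _ ordl_inj).symm
    rw [hc]
    rw [hS', Finset.mem_filter] at hσ0
    refine embed_bound R hR hW q.1 q.2 ?_ ?_ (S'.image ordl) ?_ F hF hF2
    · rw [← hσ0.2]
      obtain ⟨w⟩ := ‹Nonempty W›
      refine ⟨(Fin.last T, w), ?_⟩
      simp [κ, Dset]
    · refine le_trans ?_ hn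
      have : q.1.card ≤ D0 := by
        simp only [Q, Finset.mem_sigma, Finset.mem_filter] at hq
        exact hq.1.2
      gcongr
    · intro l hl
      rw [Finset.mem_image] at hl
      obtain ⟨σ, hσ, rfl⟩ := hl
      rw [hS', Finset.mem_filter] at hσ
      refine ⟨ordl_nodup σ, ordl_mem σ, ?_⟩
      rw [← hσ.2]
      have h1 := (ordl_chain σ _).1 (hf σ)
      rw [ordl_chain]
      refine ⟨?_, ?_⟩
      · intro t u
        by_cases hu : (t.castSucc, u) ∈ Dset Rt σ
        · simp only [κ, hu, if_true]
          exact h1.1 t u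
        · simp only [κ, hu, if_false]
          apply hRt
          by_contra hcon
          apply hu
          rw [Dset, Finset.mem_filter]
          exact ⟨Finset.mem_univ _, Or.inr ⟨t, rfl, hcon⟩⟩
      · have h2 := h1.2
        rw [List.isChain_map] at h2 ⊢
        refine h2.imp ?_
        intro v v' h x hx y hy
        have hxD : x ∈ Dset Rt σ := by
          have : x.1 = Fin.last T := by
            simp only [blk, List.getLast?_map, Option.mem_def, Option.map_eq_some_iff] at hx
            obtain ⟨t, ht, rfl⟩ := hx
            simp [List.getLast?_eq_getElem?] at ht
            exact ht.symm
          simp [Dset, this]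
        simp only [κ, hxD, if_true]
        exact h x hx y hy
  · rw [smul_eq_mul, mul_comm]
    exact Nat.mul_le_mul_left _ hQ

end orderings

section final

theorem main_count {n k r s T : ℕ} (hk : k = 2 ∨ k = 3 ∨ k = 5) (hr : r.Prime) (hs : 1 ≤ s)
    (hTs : (T+1) * s ≤ r) (hsT : (4 * Real.exp 2) ^ (T+1) ≤ (s : ℝ))
    (hn : 2 * (T + 1 + (2 * k + 1)) * (s * r ^ (k-1)) ≤ n)
    (F : Finset (SimpleGraph (Fin n))) (hF : ∀ G ∈ F, IsHamPathGraph G)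
    (hF2 : ∀ G₁ ∈ F, ∀ G₂ ∈ F, G₁ ≠ G₂ → ContainsCycleLen (G₁ ⊔ G₂) (2*k)) :
    (F.card : ℝ) * ((s : ℝ) / (4 * Real.exp 2)) ^ (s * r ^ (k-1) * T) ≤
      (n.factorial : ℝ) * (2 ^ n * (n:ℝ) ^ (2 * (s * r ^ (k-1)))) := by
  have : Fact r.Prime := ⟨hr⟩
  have : NeZero r := ⟨hr.ne_zero⟩
  have : NeZero s := ⟨by omega⟩
  let Γ := Fin (k-1) → ZMod r
  let X : Fin (T+1) × Fin s → ZMod r := fun p => ((finProdFinEquiv p : ℕ) : ZMod r)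
  have hX : Function.Injective X := by
    intro p q h
    have h1 := (ZMod.natCast_eq_natCast_iff' _ _ _).1 h
    rw [Nat.mod_eq_of_lt (lt_of_lt_of_le (finProdFinEquiv p).2 hTs),
      Nat.mod_eq_of_lt (lt_of_lt_of_le (finProdFinEquiv q).2 hTs)] at h1
    exact finProdFinEquiv.injective (Fin.ext h1)
  let x : Fin (T+1) × (Fin s × Γ) → ZMod r := fun p => X (p.1, p.2.1)
  let g : Fin (T+1) × (Fin s × Γ) → Γ := fun p => p.2.2
  let ψ : Fin T → Fin s → Fin s → Γ := fun t i j m =>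
    X (t.succ, j) * (X (t.succ, j) ^ (m.1+1) - X (t.castSucc, i) ^ (m.1+1))
  have hW := wenger_free k hk x g (by
    intro u w h1 h2
    have h3 := hX h1
    simp only [Prod.mk.injEq] at h3
    exact Prod.ext h3.1 (Prod.ext h3.2 h2))
  have hcW : Fintype.card (Fin s × Γ) = s * r ^ (k-1) := by simp [Γ, ZMod.card]
  set N0 := s * r ^ (k-1) with hN0
  have hN0pos : 0 < N0 := Nat.mul_pos hs (pow_pos hr.pos _)
  set d := N0 / (T+1) with hd
  have hd1 : N0 ≤ (T+1) * (d+1) := (Nat.lt_mul_div_succ N0 (Nat.succ_pos T)).le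
  have hd2 : T * d ≤ N0 := by
    have : d * (T+1) ≤ N0 := Nat.div_mul_le_self _ _
    nlinarith
  have hcount := count_bound (W := Fin s × Γ) (T := T) (n := n) (L := 2*k) (WR k x g)
    (by intro u m; simp) hW (fun t => LR (ψ t)) (by
      intro t u w h m
      exact congrFun h m) d (by rw [hcW]; nlinarith) F hF hF2
  rw [hcW] at hcount
  have hPP : ∀ t, ((s : ℝ) / (4 * Real.exp 2)) ^ N0 ≤ ((PP (LR (ψ t)) d).card : ℝ) := by
    intro t
    have := PP_lower (ψ t) (by simpa using hs) (T+1) d (by rw [hcW]; exact hd1) (by simpa using hsT)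
    rw [hcW] at this
    simpa using this
  have hprod : ((s : ℝ) / (4 * Real.exp 2)) ^ (N0 * T) ≤ ∏ t, ((PP (LR (ψ t)) d).card : ℝ) := by
    rw [pow_mul]
    calc _ = ∏ t : Fin T, ((s : ℝ) / (4 * Real.exp 2)) ^ N0 := by simp
      _ ≤ _ := Finset.prod_le_prod (fun _ _ => by positivity) (fun t _ => hPP t)
  have hTN : (T+1) * N0 ≤ n := by nlinarith
  have hn1 : 1 ≤ n := by nlinarith
  have hc2 : (F.card : ℝ) * ∏ t, ((PP (LR (ψ t)) d).card : ℝ) ≤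
      n.factorial * (2 ^ ((T+1) * N0) * (((T+1) * N0 : ℕ) : ℝ) ^ (N0 + T * d)) := by
    exact_mod_cast hcount
  have hn1' : (1:ℝ) ≤ n := by exact_mod_cast hn1
  calc _ ≤ (F.card : ℝ) * ∏ t, ((PP (LR (ψ t)) d).card : ℝ) := by gcongr
    _ ≤ _ := hc2
    _ ≤ _ := by
      have h1 : (2:ℝ) ^ ((T+1) * N0) ≤ 2 ^ n := pow_le_pow_right₀ (by norm_num) hTN
      have h2 : (((T+1) * N0 : ℕ) : ℝ) ^ (N0 + T * d) ≤ (n:ℝ) ^ (2 * N0) :=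
        calc _ ≤ (n:ℝ) ^ (N0 + T * d) := by
              apply pow_le_pow_left₀ (by positivity); exact_mod_cast hTN
          _ ≤ _ := pow_le_pow_right₀ hn1' (by omega)
      gcongr

theorem params (k T a : ℕ) (hk : 2 ≤ k) (ha : T + 1 ≤ a) (δ : ℝ) (hδ : 0 < δ) (C : ℝ) :
    ∀ᶠ n : ℕ in Filter.atTop, ∃ r s : ℕ, r.Prime ∧ 1 ≤ s ∧ (T+1) * s ≤ r ∧ C ≤ (s:ℝ) ∧
      2 * a * (s * r ^ (k-1)) ≤ n ∧ (1 - δ) * n ≤ 2 * a * ((s * r ^ (k-1) : ℕ) : ℝ) ∧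
      (1 / k - δ) * Real.log n ≤ Real.log s := by
  set B : ℝ := 2 * a * 4 ^ (k-1) with hB
  have ha1 : (1:ℝ) ≤ a := by exact_mod_cast (by omega : 1 ≤ a)
  have hBpos : 0 < B := by positivity
  have hk0 : (0:ℝ) < k := by positivity
  have hy : Filter.Tendsto (fun n : ℕ => (n:ℝ) ^ (1 / (k:ℝ))) Filter.atTop Filter.atTop :=
    (tendsto_rpow_atTop (by positivity)).comp tendsto_natCast_atTop_atTop
  have hlog : Filter.Tendsto (fun n : ℕ => Real.log n) Filter.atTop Filter.atTop :=
    Real.tendsto_log_atTop.comp tendsto_natCast_atTop_atTop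
  filter_upwards [hy.eventually_ge_atTop 1, hy.eventually_ge_atTop (B / δ),
    hy.eventually_ge_atTop (2 * B), hy.eventually_ge_atTop (2 * B * C), Filter.eventually_ge_atTop 1,
    hlog.eventually_ge_atTop (Real.log (2 * B) / δ)] with n h1 h2 h3 h4 h5 h6
  set y := (n:ℝ) ^ (1 / (k:ℝ)) with hydef
  have hn0 : (0:ℝ) < n := by exact_mod_cast h5
  have hyk : y ^ k = n := by
    rw [hydef, ← Real.rpow_natCast, ← Real.rpow_mul hn0.le]
    rw [one_div_mul_cancel hk0.ne', Real.rpow_one]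
  have hlogy : Real.log y = 1 / k * Real.log n := by rw [hydef, Real.log_rpow hn0]
  have hyk' : y ^ (k-1) * y = n := by rw [← pow_succ, Nat.sub_add_cancel (by omega), hyk]
  clear_value y
  obtain ⟨r, hr, hr1, hr2⟩ := Nat.exists_prime_lt_and_le_two_mul ⌈y⌉₊ (by
    have := Nat.ceil_pos.2 (lt_of_lt_of_le one_pos h1); omega)
  have hry : y ≤ r := (Nat.le_ceil y).trans (by exact_mod_cast hr1.le)
  have hr4 : (r:ℝ) ≤ 4 * y := by
    have e1 : (r:ℝ) ≤ 2 * (⌈y⌉₊ : ℝ) := by exact_mod_cast hr2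
    have e2 := Nat.ceil_lt_add_one (a := y) (by linarith)
    linarith
  have hypos : 0 < y := by linarith
  have hrpos : (0:ℝ) < r := by linarith
  set q : ℝ := 2 * a * (r:ℝ) ^ (k-1) with hq
  have hqpos : 0 < q := by positivity
  have hq1 : q ≤ B * y ^ (k-1) := by
    rw [hq, hB]
    calc _ ≤ 2 * a * (4 * y) ^ (k-1) := by gcongr
      _ = _ := by rw [mul_pow]; ring
  have hq2 : 2 * a * y ^ (k-1) ≤ q := by rw [hq]; gcongr
  have hqn : ((2 * a * r ^ (k-1) : ℕ) : ℝ) = q := by rw [hq]; push_cast; ring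
  set s := n / (2 * a * r ^ (k-1)) with hs
  have hsq : (s:ℝ) * q ≤ n := by
    rw [← hqn]; exact_mod_cast Nat.div_mul_le_self n _
  have hqnat : 0 < 2 * a * r ^ (k-1) := by
    have := hr.pos
    have : 0 < a := by omega
    positivity
  have hsq2 : (n:ℝ) ≤ (s + 1) * q := by
    rw [← hqn]
    have := (Nat.lt_mul_div_succ n hqnat).le
    rw [← hs] at this
    rw [mul_comm]
    exact_mod_cast this
  clear_value s q
  have hyp : 0 < y ^ (k-1) := by positivity
  -- y ≤ (s+1) B
  have hsB : y ≤ (s + 1) * B := by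
    have : y ^ (k-1) * y ≤ y ^ (k-1) * ((s+1) * B) := by
      rw [hyk']
      calc (n:ℝ) ≤ (s+1) * q := hsq2
        _ ≤ (s+1) * (B * y ^ (k-1)) := by gcongr
        _ = _ := by ring
    exact le_of_mul_le_mul_left this hyp
  have hs2 : y / (2 * B) ≤ s := by
    rw [div_le_iff₀ (by positivity)]
    linarith
  have hs1 : (1:ℝ) ≤ s := by
    refine le_trans ?_ hs2
    rw [le_div_iff₀ (by positivity)]; linarith
  have hsy : 2 * a * (s:ℝ) ≤ y := by
    have : y ^ (k-1) * (2 * a * (s:ℝ)) ≤ y ^ (k-1) * y := by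
      rw [hyk']
      calc _ = (s:ℝ) * (2 * a * y ^ (k-1)) := by ring
        _ ≤ s * q := by gcongr
        _ ≤ _ := hsq
    exact le_of_mul_le_mul_left this hyp
  refine ⟨r, s, hr, by exact_mod_cast hs1, ?_, ?_, ?_, ?_, ?_⟩
  · have : ((T:ℝ) + 1) * s ≤ r := by
      have hT : (T:ℝ) + 1 ≤ a := by exact_mod_cast ha
      nlinarith
    exact_mod_cast this
  · refine le_trans ?_ hs2
    rw [le_div_iff₀ (by positivity)]; linarith
  · have : (2 * a * (s * r ^ (k-1)) : ℝ) ≤ n := by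
      calc _ = (s:ℝ) * q := by rw [hq]; ring
        _ ≤ _ := hsq
    exact_mod_cast this
  · push_cast
    have e : (2 * a * (s * r ^ (k-1)) : ℝ) = s * q := by rw [hq]; ring
    rw [e]
    have : q ≤ δ * n := by
      rw [div_le_iff₀ hδ] at h2
      calc q ≤ B * y ^ (k-1) := hq1
        _ ≤ (y * δ) * y ^ (k-1) := by gcongr
        _ = _ := by rw [← hyk']; ring
    linarith
  · have : Real.log (y / (2 * B)) ≤ Real.log s := Real.log_le_log (by positivity) hs2
    rw [Real.log_div (by positivity) (by positivity), hlogy] at this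
    rw [div_le_iff₀ hδ] at h6
    linarith

theorem arith_final (k T a ε δ C n l ls lF M : ℝ) (hkr : 2 ≤ k) (har : a = T + 2 * k + 2)
    (haε : k + 2 ≤ δ * a) (hδ : δ = ε / 3) (hδpos : 0 < δ) (hCpos : 0 ≤ C) (hn0 : 0 < n)
    (hl : Real.log 2 + C / 2 ≤ l * δ) (hn2 : (1 - δ) * n ≤ 2 * a * M) (hls : (1 / k - δ) * l ≤ ls)
    (hlogc : lF + M * T * (ls - C) ≤ n * l + (n * Real.log 2 + 2 * M * l))
    (hn' : 2 * a * M ≤ n) (hl0 : 0 ≤ l) (hNn : 0 ≤ M) (hTn : 0 ≤ T) :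
    lF ≤ l * ((1 - 1 / k ^ 2 + ε) * n) := by
  have hMT : M * T ≤ n / 2 := by rw [har] at hn'; nlinarith [mul_nonneg hNn (by linarith : (0:ℝ) ≤ 2 * k + 2)]
  have hkk : 1 / k^2 ≤ 1 / (2 * k) := by
    apply one_div_le_one_div_of_le (by positivity); nlinarith
  -- lower bound for `M T`
  have hMa : M ≤ δ * n / (2 * (k + 2)) := by
    rw [le_div_iff₀ (by positivity)]
    have := mul_le_mul_of_nonneg_left haε hNn
    have h2 := mul_le_mul_of_nonneg_left hn' hδpos.le
    linarith
  have hMT2 : (1 - δ) * n / 2 - M * (2 * k + 2) ≤ M * T := by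
    rw [har] at hn2; linarith
  have e1 : M * T * (1 / k - δ) * l ≤ M * T * ls := by
    rw [mul_assoc]; exact mul_le_mul_of_nonneg_left hls (by positivity)
  have hkinv : (1:ℝ) / k ≤ 1 / 2 := one_div_le_one_div_of_le (by norm_num) hkr
  have hkinv0 : (0:ℝ) < 1 / k := by positivity
  have e2 : n / (2 * k) - δ * n / 4 - M * (2 * k + 2) / k - δ * n / 2 ≤ M * T * (1 / k - δ) := by
    have f1 : ((1 - δ) * n / 2 - M * (2 * k + 2)) * (1 / k) ≤ M * T * (1 / k) :=
      mul_le_mul_of_nonneg_right hMT2 hkinv0.le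
    have f2 : M * T * δ ≤ n / 2 * δ := mul_le_mul_of_nonneg_right hMT hδpos.le
    have f3 : δ * n / 2 * (1 / k) ≤ δ * n / 2 * (1 / 2) := mul_le_mul_of_nonneg_left hkinv (by positivity)
    have f4 : ((1 - δ) * n / 2 - M * (2 * k + 2)) * (1 / k) = n / (2 * k) - δ * n / 2 * (1 / k) - M * (2 * k + 2) / k := by
      field_simp
    linarith
  have e3 : M * (2 * k + 2) / k + 2 * M ≤ δ * n := by
    have g1 : M * (2 * k + 2) / k ≤ M * 3 := by
      rw [div_le_iff₀ (by positivity)]; nlinarith [mul_nonneg hNn (by linarith : (0:ℝ) ≤ k - 2)]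
    have g2 : M * (2 * (k + 2)) ≤ δ * n := by rwa [le_div_iff₀ (by positivity)] at hMa
    nlinarith [mul_nonneg hNn (by linarith : (0:ℝ) ≤ k - 2)]
  have e4 : n / (2 * k) + 2 * M ≤ M * T * (1 / k - δ) + 7 / 4 * δ * n := by linarith
  have e5 := mul_le_mul_of_nonneg_right e4 hl0
  have e6 : n * (Real.log 2 + C / 2) ≤ n * (l * δ) := mul_le_mul_of_nonneg_left hl hn0.le
  have e7 : M * T * C ≤ n / 2 * C := mul_le_mul_of_nonneg_right hMT hCpos
  have e8 : 1 / k^2 * (n * l) ≤ 1 / (2 * k) * (n * l) := mul_le_mul_of_nonneg_right hkk (by positivity)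
  have e9 : n / (2 * k) * l = 1 / (2 * k) * (n * l) := by ring
  have e10 : l * ((1 - 1 / k^2 + ε) * n) = n * l - 1 / k^2 * (n * l) + 3 * (δ * n * l) := by
    rw [hδ]; ring
  rw [e10]
  have e11 : 0 ≤ δ * n * l := by positivity
  linarith

theorem main_bound (k : ℕ) (hk : k = 2 ∨ k = 3 ∨ k = 5) (ε : ℝ) (hε : 0 < ε) :
    ∀ᶠ n : ℕ in Filter.atTop, ∀ F : Finset (SimpleGraph (Fin n)), (∀ G ∈ F, IsHamPathGraph G) →
      (∀ G₁ ∈ F, ∀ G₂ ∈ F, G₁ ≠ G₂ → ContainsCycleLen (G₁ ⊔ G₂) (2*k)) →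
      (F.card : ℝ) ≤ (n:ℝ) ^ ((1 - 1 / (k:ℝ)^2 + ε) * n) := by
  have hk2 : 2 ≤ k := by omega
  have hkr : (2:ℝ) ≤ k := by exact_mod_cast hk2
  obtain ⟨T, hT⟩ := exists_nat_gt ((k + 2) / (ε / 3))
  set a := T + 1 + (2 * k + 1) with ha
  have har : (a:ℝ) = T + 2 * k + 2 := by rw [ha]; push_cast; ring
  have haε : ((k:ℝ) + 2) ≤ ε / 3 * a := by
    rw [div_lt_iff₀ (by positivity)] at hT
    rw [har]
    nlinarith
  set δ := ε / 3 with hδ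
  have hδpos : 0 < δ := by positivity
  set C := Real.log (4 * Real.exp 2) with hC
  have hCpos : 0 ≤ C := by
    apply Real.log_nonneg
    have := Real.add_one_le_exp 2
    linarith
  have hlog : Filter.Tendsto (fun n : ℕ => Real.log n) Filter.atTop Filter.atTop :=
    Real.tendsto_log_atTop.comp tendsto_natCast_atTop_atTop
  filter_upwards [params k T a hk2 (by omega) δ hδpos ((4 * Real.exp 2) ^ (T+1)),
    hlog.eventually_ge_atTop ((Real.log 2 + C / 2) / δ), Filter.eventually_ge_atTop 1]
    with n hp hl hn1 F hF hF2
  have hn0 : (0:ℝ) < n := by exact_mod_cast hn1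
  rcases Nat.eq_zero_or_pos F.card with h0 | hFpos
  · rw [h0]; simp only [Nat.cast_zero]; positivity
  obtain ⟨r, s, hr, hs, hTs, hsC, hn, hn2, hls⟩ := hp
  have hcount := main_count hk hr hs hTs hsC hn F hF hF2
  set N0 := s * r ^ (k-1) with hN0
  have hFr : (0:ℝ) < F.card := by exact_mod_cast hFpos
  have hsr : (0:ℝ) < s := by exact_mod_cast hs
  have hfac : (n.factorial : ℝ) ≤ (n:ℝ) ^ n := by exact_mod_cast Nat.factorial_le_pow n
  have hcount2 : (F.card : ℝ) * ((s : ℝ) / (4 * Real.exp 2)) ^ (N0 * T) ≤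
      (n:ℝ) ^ n * (2 ^ n * (n:ℝ) ^ (2 * N0)) := hcount.trans (by gcongr)
  have hlogc := Real.log_le_log (by positivity) hcount2
  rw [Real.log_mul (by positivity) (by positivity), Real.log_mul (by positivity) (by positivity),
    Real.log_mul (by positivity) (by positivity), Real.log_pow, Real.log_pow, Real.log_pow,
    Real.log_pow, Real.log_div (by positivity) (by positivity), ← hC] at hlogc
  have hn' : 2 * (a:ℝ) * N0 ≤ n := by exact_mod_cast hn
  clear_value N0 C
  push_cast at hlogc
  have hl0 : 0 ≤ Real.log n := Real.log_natCast_nonneg n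
  rw [div_le_iff₀ hδpos] at hl
  rw [Real.rpow_def_of_pos hn0, ← Real.log_le_iff_le_exp hFr]
  have hNn : (0:ℝ) ≤ N0 := Nat.cast_nonneg _
  have hTn : (0:ℝ) ≤ T := Nat.cast_nonneg _
  exact arith_final k T a ε δ C n _ _ _ N0 hkr har haε hδ hδpos hCpos hn0 hl hn2 hls hlogc hn' hl0 hNn hTn

end final

/-- For `k ∈ {2,3,5}`, `H(n,2k) ≤ n^((1 - 1/k²)n - o(n))`. -/
theorem stmt_6 (k : ℕ) (hk : k ∈ ({2, 3, 5} : Set ℕ)) :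
    ∀ ε : ℝ, 0 < ε → ∃ N : ℕ, ∀ n : ℕ, N ≤ n →
      (Hnum n (2 * k) : ℝ) ≤
        (n : ℝ) ^ ((1 - 1 / (k : ℝ) ^ 2 + ε) * n) := by
  intro ε hε
  have hk' : k = 2 ∨ k = 3 ∨ k = 5 := by simpa using hk
  obtain ⟨N, hN⟩ := Filter.eventually_atTop.1 (main_bound k hk' ε hε)
  refine ⟨N, fun n hn => ?_⟩
  have hmem : Hnum n (2 * k) ∈ {m | ∃ F : Finset (SimpleGraph (Fin n)), F.card = m ∧
    (∀ G ∈ F, IsHamPathGraph G) ∧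
    ∀ G₁ ∈ F, ∀ G₂ ∈ F, G₁ ≠ G₂ → ContainsCycleLen (G₁ ⊔ G₂) (2 * k)} := by
    apply Nat.sSup_mem
    · exact ⟨0, ∅, by simp⟩
    · classical
      refine ⟨Fintype.card (SimpleGraph (Fin n)), ?_⟩
      rintro m ⟨F, rfl, -⟩
      exact Finset.card_le_univ _
  obtain ⟨F, hc, h1, h2⟩ := hmem
  rw [← hc]
  exact hN n hn F h1 h2
end

section
/- For every odd integer k ≥ 7, H(n,2k) ≤ n^{(1 − 2/(3k² − 3k))n − o(n)}; precisely, for every ε > 0 there exists N such that for all n ≥ N, H(n,2k) ≤ n^{(1 − 2/(3k² − 3k) + ε)n}. -/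
open SimpleGraph

/-- One step of a closed walk in the block structure; `p` is the block, `i` the offset. -/
def BStep (k : ℕ) (G : ℕ → ℕ → Prop) (p i p' i' : ℕ) : Prop :=
  (p' = p ∧ i' = i + 1) ∨ (p' = p ∧ i = i' + 1) ∨ (i = k - 1 ∧ i' = 0 ∧ G p p') ∨
    (i' = k - 1 ∧ i = 0 ∧ G p' p)

structure BCycle (k : ℕ) (G : ℕ → ℕ → Prop) (p i : ℕ → ℕ) : Prop where
  lt : ∀ t, i t < k
  perp : ∀ t, p (t + 2 * k) = p t
  peri : ∀ t, i (t + 2 * k) = i t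
  inj : ∀ t j, 0 < j → j < 2 * k → ¬ (p (t + j) = p t ∧ i (t + j) = i t)
  step : ∀ t, BStep k G (p t) (i t) (p (t + 1)) (i (t + 1))

theorem BCycle.shift {k : ℕ} {G : ℕ → ℕ → Prop} {p i : ℕ → ℕ} (h : BCycle k G p i) (a : ℕ) :
    BCycle k G (fun t => p (a + t)) (fun t => i (a + t)) where
  lt t := h.lt _
  perp t := by simpa only [add_assoc] using h.perp (a + t)
  peri t := by simpa only [add_assoc] using h.peri (a + t)
  inj t j := by simpa only [add_assoc] using h.inj (a + t) j
  step t := h.step (a + t)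

theorem BCycle.up {k : ℕ} {G : ℕ → ℕ → Prop} {p i : ℕ → ℕ} (hk : 3 ≤ k) (h : BCycle k G p i)
    (t : ℕ) (h1 : p (t + 1) = p t) (h2 : i (t + 1) = i t + 1) :
    ∀ j, i t + j < k → p (t + j) = p t ∧ i (t + j) = i t + j := by
  intro j
  induction j using Nat.strong_induction_on with
  | _ j ih =>
    intro hj
    match j, ih, hj with
    | 0, _, _ => simp
    | 1, _, _ => exact ⟨h1, h2⟩
    | j + 2, ih, hj =>
      have e1 := ih j (by omega) (by omega)
      have e2 := ih (j + 1) (by omega) (by omega)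
      have hn := h.inj (t + j) 2 (by omega) (by omega)
      have hs := h.step (t + (j + 1))
      rw [show t + (j + 1) + 1 = t + (j + 2) by ring] at hs
      rw [show t + j + 2 = t + (j + 2) by ring] at hn
      unfold BStep at hs
      have := h.lt (t + (j+2))
      rcases hs with a | a | a | a
      · omega
      · exfalso; apply hn; omega
      · omega
      · omega

theorem BCycle.down {k : ℕ} {G : ℕ → ℕ → Prop} {p i : ℕ → ℕ} (hk : 3 ≤ k) (h : BCycle k G p i)
    (t : ℕ) (h1 : p (t + 1) = p t) (h2 : i (t + 1) + 1 = i t) :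
    ∀ j, j ≤ i t → p (t + j) = p t ∧ i (t + j) + j = i t := by
  intro j
  induction j using Nat.strong_induction_on with
  | _ j ih =>
    intro hj
    match j, ih, hj with
    | 0, _, _ => simp
    | 1, _, _ => exact ⟨h1, h2⟩
    | j + 2, ih, hj =>
      have e1 := ih j (by omega) (by omega)
      have e2 := ih (j + 1) (by omega) (by omega)
      have hn := h.inj (t + j) 2 (by omega) (by omega)
      have hs := h.step (t + (j + 1))
      rw [show t + (j + 1) + 1 = t + (j + 2) by ring] at hs
      rw [show t + j + 2 = t + (j + 2) by ring] at hn
      unfold BStep at hs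
      have := h.lt (t + j)
      rcases hs with a | a | a | a
      · exfalso; apply hn; omega
      · omega
      · omega
      · omega

/-- the reversed cycle -/
theorem BCycle.rev {k : ℕ} {G : ℕ → ℕ → Prop} {p i : ℕ → ℕ} (hk : 3 ≤ k) (h : BCycle k G p i) :
    BCycle k G (fun t => p (t * (2 * k - 1))) (fun t => i (t * (2 * k - 1))) := by
  have perp : ∀ m t, p (t + 2 * k * m) = p t := by
    intro m; induction m with
    | zero => simp
    | succ m ih => intro t; rw [show t + 2 * k * (m+1) = t + 2 * k * m + 2 * k by ring, h.perp, ih]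
  have peri : ∀ m t, i (t + 2 * k * m) = i t := by
    intro m; induction m with
    | zero => simp
    | succ m ih => intro t; rw [show t + 2 * k * (m+1) = t + 2 * k * m + 2 * k by ring, h.peri, ih]
  obtain ⟨K, hK⟩ : ∃ K, 2 * k = K + 1 := ⟨2 * k - 1, by omega⟩
  have hK' : 2 * k - 1 = K := by omega
  refine ⟨fun t => h.lt _, ?_, ?_, ?_, ?_⟩
  · intro t
    rw [add_mul]
    rw [perp]
  · intro t
    rw [add_mul]
    rw [peri]
  · intro t j h1 h2 hh
    have e : t * (2 * k - 1) + 2 * k * j = (t + j) * (2 * k - 1) + j := by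
      rw [hK', hK]; ring
    apply h.inj ((t + j) * (2 * k - 1)) j h1 h2
    rw [← e, perp, peri, hh.1, hh.2]; simp
  · intro t
    have e : t * (2 * k - 1) + 2 * k = (t + 1) * (2 * k - 1) + 1 := by
      rw [hK', hK]; ring
    have hs := h.step ((t + 1) * (2 * k - 1))
    rw [← e, h.perp, h.peri] at hs
    unfold BStep at hs ⊢
    rcases hs with a | a | a | a
    · right; left; omega
    · left; omega
    · right; right; right; exact ⟨a.1, a.2.1, a.2.2⟩
    · right; right; left; exact ⟨a.1, a.2.1, a.2.2⟩

theorem BCycle.no_up0 {k : ℕ} {G : ℕ → ℕ → Prop} {p i : ℕ → ℕ} (hk : 3 ≤ k) (hodd : Odd k)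
    (h : BCycle k G p i) (hG : ∀ a b, G a b → ¬ G b a) (h0 : i 0 = 0)
    (h1 : p 1 = p 0) (h2 : i 1 = 1) : False := by
  have run := h.up hk 0 (by simpa using h1) (by simpa [h0] using h2)
  simp only [zero_add, h0] at run
  obtain ⟨q, hq⟩ := hodd
  have r1 := run (k - 1) (by omega)
  have r2 := run (k - 2) (by omega)
  have per0 := h.perp 0
  have peri0 := h.peri 0
  simp only [zero_add] at per0 peri0
  have hs := h.step (k - 1)
  have hn := h.inj (k - 2) 2 (by omega) (by omega)
  rw [show k - 2 + 2 = k by omega] at hn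
  rw [show k - 1 + 1 = k by omega] at hs
  have ltk := h.lt k
  have hL : i k = 0 ∧ G (p 0) (p k) := by
    unfold BStep at hs
    rcases hs with a | a | a | a
    · omega
    · exfalso; apply hn; omega
    · rw [r1.1] at a; exact a.2
    · omega
  have hs := h.step k
  have hne : ¬ (p (k+1) = p k ∧ i (k+1) = i k + 1) := by
    rintro ⟨a, b⟩
    have run2 := h.up hk k a b
    have r3 := run2 (k - 1) (by omega)
    rw [show k + (k - 1) = 2 * k - 1 by omega] at r3
    have hs := h.step (2 * k - 1)
    rw [show 2 * k - 1 + 1 = 2 * k by omega] at hs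
    rw [r3.1, r3.2, per0, peri0] at hs
    unfold BStep at hs
    rcases hs with a | a | a | a
    · omega
    · omega
    · exact hG _ _ hL.2 a.2.2
    · omega
  have htop : i (k + 1) = k - 1 := by
    unfold BStep at hs
    rcases hs with a | a | a | a
    · exact absurd a hne
    · omega
    · omega
    · omega
  have key : ∀ m, k + 1 + 2 * m ≤ 2 * k → i (k + 1 + 2 * m) = k - 1 := by
    intro m
    induction m with
    | zero => intro _; simpa using htop
    | succ m ih =>
      intro hm
      have e1 := ih (by omega)
      have e2 : i (k + 1 + 2 * m + 1) = 0 := by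
        have hs := h.step (k + 1 + 2 * m)
        have := h.lt (k + 1 + 2 * m + 1)
        unfold BStep at hs
        rcases hs with a | a | a | a
        · omega
        · exfalso
          have run3 := h.down hk _ a.1 a.2.symm
          have r4 := run3 (2 * k - (k + 1 + 2 * m)) (by omega)
          rw [show k + 1 + 2 * m + (2 * k - (k + 1 + 2 * m)) = 2 * k by omega] at r4
          rw [per0, peri0] at r4
          have hm0 : m = 0 := by omega
          subst hm0
          have hn := h.inj (k - 1) 2 (by omega) (by omega)
          rw [show k - 1 + 2 = k + 1 + 2 * 0 by omega] at hn
          apply hn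
          omega
        · exact a.2.1
        · omega
      have hs := h.step (k + 1 + 2 * m + 1)
      rw [show k + 1 + 2 * m + 1 + 1 = k + 1 + 2 * (m + 1) by ring] at hs
      unfold BStep at hs
      rcases hs with a | a | a | a
      · exfalso
        have run3 := h.up hk (k + 1 + 2 * m + 1) a.1 a.2
        have r4 := run3 (2 * k - (k + 1 + 2 * m + 1)) (by omega)
        rw [show k + 1 + 2 * m + 1 + (2 * k - (k + 1 + 2 * m + 1)) = 2 * k by omega] at r4
        omega
      · omega
      · omega
      · exact a.1
  have := key q (by omega)
  rw [show k + 1 + 2 * q = 2 * k by omega] at this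
  omega

theorem BCycle.no_up {k : ℕ} {G : ℕ → ℕ → Prop} {p i : ℕ → ℕ} (hk : 3 ≤ k) (hodd : Odd k)
    (h : BCycle k G p i) (hG : ∀ a b, G a b → ¬ G b a) (t : ℕ)
    (h1 : p (t + 1) = p t) (h2 : i (t + 1) = i t + 1) : False := by
  have main : ∀ m t, i t = m → p (t + 1) = p t → i (t + 1) = i t + 1 → False := by
    intro m
    induction m with
    | zero =>
      intro t h0 h1 h2
      exact (h.shift t).no_up0 hk hodd hG (by simpa using h0) (by simpa using h1)
        (by simpa [h0] using h2)
    | succ m ih =>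
      intro t h0 h1 h2
      have hs := h.step (t + 2 * k - 1)
      have hn := h.inj (t + 2 * k - 1) 2 (by omega) (by omega)
      rw [show t + 2 * k - 1 + 2 = t + 1 + 2 * k by omega, h.perp, h.peri] at hn
      rw [show t + 2 * k - 1 + 1 = t + 2 * k by omega] at hs
      rw [h.perp, h.peri] at hs
      have h3 := h.lt (t + 1)
      have h4 := h.lt (t + 2 * k - 1)
      have e : t + 2 * k - 1 + 1 = t + 2 * k := by omega
      unfold BStep at hs
      rcases hs with a | a | a | a
      · apply ih (t + 2 * k - 1)
        · omega
        · rw [e, h.perp]; exact a.1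
        · rw [e, h.peri]; exact a.2
      · apply hn; omega
      · omega
      · omega
  exact main _ t rfl h1 h2

/-- main combinatorial lemma -/
theorem BCycle.alt {k : ℕ} {G : ℕ → ℕ → Prop} {p i : ℕ → ℕ} (hk : 3 ≤ k) (hodd : Odd k)
    (h : BCycle k G p i) (hG : ∀ a b, G a b → ¬ G b a) :
    ∃ a b : ℕ → ℕ, (∀ t, a (t + k) = a t) ∧ (∀ t, b (t + k) = b t) ∧
      (∀ t, G (a t) (b t)) ∧ (∀ t, G (a (t + 1)) (b t)) ∧
      (∀ t, a (t + 1) ≠ a t) ∧ (∀ t, b (t + 1) ≠ b t) := by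
  have hnu := fun t => h.no_up hk hodd hG t
  have hnd : ∀ t, p (t + 1) = p t → i t = i (t + 1) + 1 → False := by
    intro t h1 h2
    have hr := h.rev hk
    have perp : ∀ m t, p (t + 2 * k * m) = p t := by
      intro m; induction m with
      | zero => simp
      | succ m ih => intro t; rw [show t + 2 * k * (m+1) = t + 2 * k * m + 2 * k by ring, h.perp, ih]
    have peri : ∀ m t, i (t + 2 * k * m) = i t := by
      intro m; induction m with
      | zero => simp
      | succ m ih => intro t; rw [show t + 2 * k * (m+1) = t + 2 * k * m + 2 * k by ring, h.peri, ih]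
    obtain ⟨K, hK⟩ : ∃ K, 2 * k = K + 2 := ⟨2 * k - 2, by omega⟩
    have hK' : 2 * k - 1 = K + 1 := by omega
    have e1 : ∃ m, (t + 1) * (2 * k - 1) * (2 * k - 1) = (t + 1) + 2 * k * m :=
      ⟨(t + 1) * K, by rw [hK', hK]; ring⟩
    have e2 : ∃ m, ((t + 1) * (2 * k - 1) + 1) * (2 * k - 1) = t + 2 * k * m :=
      ⟨(t + 1) * K + 1, by rw [hK', hK]; ring⟩
    obtain ⟨m1, e1⟩ := e1
    obtain ⟨m2, e2⟩ := e2
    apply hr.no_up hk hodd hG ((t + 1) * (2 * k - 1))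
    · rw [e1, e2, perp, perp, h1]
    · rw [e1, e2, peri, peri, h2]
  have hst : ∀ t, (i t = k - 1 ∧ i (t+1) = 0 ∧ G (p t) (p (t+1))) ∨
    (i (t+1) = k - 1 ∧ i t = 0 ∧ G (p (t+1)) (p t)) := by
    intro t
    rcases h.step t with a | a | a | a
    · exact (hnu t a.1 a.2).elim
    · exact (hnd t a.1 a.2).elim
    · exact Or.inl a
    · exact Or.inr a
  obtain ⟨s, hs⟩ : ∃ s, i s = k - 1 := by
    rcases hst 0 with a | a
    · exact ⟨_, a.1⟩
    · exact ⟨_, a.1⟩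
  have ev : ∀ t, i (s + 2 * t) = k - 1 ∧ i (s + 2 * t + 1) = 0 := by
    intro t
    induction t with
    | zero =>
      rcases hst s with a | a
      · exact ⟨a.1, a.2.1⟩
      · omega
    | succ t ih =>
      have a1 := hst (s + 2 * t + 1)
      have a2 := hst (s + 2 * (t + 1))
      rw [show s + 2 * t + 1 + 1 = s + 2 * (t + 1) by ring] at a1
      omega
  refine ⟨fun t => p (s + 2 * t), fun t => p (s + 2 * t + 1), ?_, ?_, ?_, ?_, ?_, ?_⟩
  · intro t
    beta_reduce
    rw [show s + 2 * (t + k) = s + 2 * t + 2 * k by ring, h.perp]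
  · intro t
    beta_reduce
    rw [show s + 2 * (t + k) + 1 = s + 2 * t + 1 + 2 * k by ring, h.perp]
  · intro t
    have := ev t
    rcases hst (s + 2 * t) with a | a
    · exact a.2.2
    · omega
  · intro t
    have := ev t
    rcases hst (s + 2 * t + 1) with a | a
    · omega
    · exact a.2.2
  · intro t hh
    beta_reduce at hh
    have h1 := ev t
    have h2 := ev (t + 1)
    apply h.inj (s + 2 * t) 2 (by omega) (by omega)
    rw [show s + 2 * t + 2 = s + 2 * (t + 1) by ring]
    omega
  · intro t hh
    beta_reduce at hh
    have h1 := ev t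
    have h2 := ev (t + 1)
    apply h.inj (s + 2 * t + 1) 2 (by omega) (by omega)
    rw [show s + 2 * t + 1 + 2 = s + 2 * (t + 1) + 1 by ring]
    omega

theorem cycle_fun {V : Type*} {G : SimpleGraph V} {m : ℕ} (hm : 3 ≤ m)
    (h : ContainsCycleLen G m) : ∃ c : ℕ → V, (∀ t, c (t + m) = c t) ∧
      (∀ t, G.Adj (c t) (c (t + 1))) ∧ ∀ t j, 0 < j → j < m → c (t + j) ≠ c t := by
  obtain ⟨u, w, hw, hl⟩ := h
  refine ⟨fun t => w.getVert (t % m), ?_, ?_, ?_⟩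
  · intro t; simp
  · intro t
    have h1 : t % m < m := Nat.mod_lt _ (by omega)
    have := w.adj_getVert_succ (i := t % m) (by omega)
    by_cases h2 : t % m + 1 < m
    · rwa [← Nat.mod_eq_of_lt h2, Nat.mod_add_mod] at this
    · have h3 : t % m + 1 = m := by omega
      have h4 : (t + 1) % m = 0 := by rw [← Nat.mod_add_mod, h3, Nat.mod_self]
      rw [h3, ← hl, Walk.getVert_length, hl] at this
      simpa [h4] using this
  · intro t j h1 h2 hh
    have a1 : (t + j) % m < m := Nat.mod_lt _ (by omega)
    have a2 : t % m < m := Nat.mod_lt _ (by omega)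
    have := hw.getVert_injOn' (by simp only [Set.mem_ofPred_eq]; omega)
      (by simp only [Set.mem_ofPred_eq]; omega) hh
    have h5 : (t + j) ≡ t + 0 [MOD m] := this
    have h6 := Nat.ModEq.add_left_cancel' t h5
    have h7 := (Nat.modEq_zero_iff_dvd).1 h6
    have := Nat.le_of_dvd h1 h7
    omega

/-- The directed edges of the big graph containing all the Hamiltonian paths. -/
def HatE (k N : ℕ) (Γ : ℕ → ℕ → Prop) (v w : ℕ) : Prop :=
  (w = v + 1 ∧ (w % k ≠ 0 ∨ k * N ≤ w)) ∨
    ∃ p p', p + 1 < N ∧ p' < N ∧ v = k * p + (k - 1) ∧ w = k * p' ∧ Γ p p'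

theorem hat_step {k N : ℕ} {Γ : ℕ → ℕ → Prop} (hk : 3 ≤ k) {v w : ℕ} (h : HatE k N Γ v w)
    (hw : w < k * N) : (w / k = v / k ∧ w % k = v % k + 1) ∨
      (v % k = k - 1 ∧ w % k = 0 ∧ Γ (v / k) (w / k)) := by
  have hk0 : 0 < k := by omega
  rcases h with ⟨h1, h2⟩ | ⟨p, p', h1, h2, rfl, rfl, h5⟩
  · left
    have h2 : w % k ≠ 0 := by omega
    subst h1
    have : v % k + 1 < k := by
      by_contra hcon
      have h3 := Nat.mod_lt v hk0
      apply h2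
      rw [← Nat.mod_add_mod, show v % k + 1 = k by omega, Nat.mod_self]
    constructor
    · rw [Nat.div_eq_of_lt_le (m := v + 1) (k := v / k)]
      · have := Nat.div_add_mod v k
        rw [mul_comm]; omega
      · have := Nat.div_add_mod v k
        rw [add_mul, mul_comm]; omega
    · rw [← Nat.mod_add_mod, Nat.mod_eq_of_lt this]
  · right
    have e1 : (k * p + (k - 1)) % k = k - 1 := by
      rw [Nat.mul_add_mod, Nat.mod_eq_of_lt (by omega)]
    have e2 : (k * p + (k - 1)) / k = p := by
      rw [Nat.mul_add_div hk0, Nat.div_eq_of_lt (by omega)]; simp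
    rw [e1, e2, Nat.mul_mod_right, Nat.mul_div_cancel_left _ hk0]
    exact ⟨rfl, rfl, h5⟩

theorem hat_no_cycle {k N n : ℕ} (hk : 3 ≤ k) (hodd : Odd k) (hN : 0 < N) {Γ : ℕ → ℕ → Prop}
    (no2 : ∀ a b, Γ a b → ¬ Γ b a)
    (noalt : ¬ ∃ a b : ℕ → ℕ, (∀ t, a (t + k) = a t) ∧ (∀ t, b (t + k) = b t) ∧
      (∀ t, Γ (a t) (b t)) ∧ (∀ t, Γ (a (t + 1)) (b t)) ∧
      (∀ t, a (t + 1) ≠ a t) ∧ (∀ t, b (t + 1) ≠ b t))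
    (H : SimpleGraph (Fin n)) (hH : ∀ u v : Fin n, H.Adj u v → HatE k N Γ u v ∨ HatE k N Γ v u) :
    ¬ ContainsCycleLen H (2 * k) := by
  intro hc
  obtain ⟨c, hper, hadj, hinj⟩ := cycle_fun (by omega) hc
  obtain ⟨N, rfl⟩ : ∃ M, N = M + 1 := ⟨N - 1, by omega⟩
  have hk0 : 0 < k := by omega
  have hinj' : ∀ t j, 0 < j → j < 2 * k → (c (t + j) : ℕ) ≠ c t := fun t j h1 h2 h3 =>
    hinj t j h1 h2 (Fin.ext h3)
  have hbd : ∀ t, (c t : ℕ) ≤ k * N := by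
    have hfin : ∃ t0, ∀ t, (c t : ℕ) ≤ c t0 := by
      have hne : (Set.range c).Nonempty := ⟨c 0, 0, rfl⟩
      obtain ⟨x, ⟨t0, rfl⟩, hx⟩ := Set.exists_max_image (Set.range c) (fun x => (x : ℕ))
        (Set.toFinite _) hne
      exact ⟨t0, fun t => hx _ ⟨t, rfl⟩⟩
    obtain ⟨t0, ht0⟩ := hfin
    intro t
    refine (ht0 t).trans ?_
    by_contra hcon
    push Not at hcon
    have key : ∀ x : ℕ, (c x : ℕ) ≠ c t0 → (H.Adj (c x) (c t0)) → (c x : ℕ) + 1 = c t0 := by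
      intro x hx hadj
      have hle := ht0 x
      rcases hH _ _ hadj with h | h
      · rcases h with h | ⟨p, p', h1, h2, h3, h4, h5⟩
        · omega
        · have : k * p' ≤ k * N := Nat.mul_le_mul_left _ (by omega)
          omega
      · rcases h with h | ⟨p, p', h1, h2, h3, h4, h5⟩
        · omega
        · have : k * (p + 1) ≤ k * N := Nat.mul_le_mul_left _ (by omega)
          rw [mul_add] at this
          omega
    have a1 := key (t0 + 1) (hinj' t0 1 (by omega) (by omega)) (hadj t0).symm
    have e : t0 + 2 * k - 1 + 1 = t0 + 2 * k := by omega
    have a2 := key (t0 + 2 * k - 1) (by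
        have := hinj' (t0 + 2 * k - 1) 1 (by omega) (by omega)
        rw [e, hper] at this
        exact this.symm) (by
        have := hadj (t0 + 2 * k - 1)
        rwa [e, hper] at this)
    have a3 := hinj' (t0 + 2 * k - 1) 2 (by omega) (by omega)
    rw [show t0 + 2 * k - 1 + 2 = t0 + 1 + 2 * k by omega, hper] at a3
    omega
  have hbd' : ∀ t, (c t : ℕ) < k * (N + 1) := by
    intro t; have := hbd t; rw [mul_add]; omega
  apply noalt
  refine BCycle.alt (G := Γ) (p := fun t => (c t : ℕ) / k) (i := fun t => (c t : ℕ) % k) hk hodd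
    ⟨fun t => Nat.mod_lt _ hk0, fun t => by simp only [hper], fun t => by simp only [hper],
      ?_, ?_⟩ no2
  · rintro t j h1 h2 ⟨h3, h4⟩
    apply hinj' t j h1 h2
    have e1 := Nat.div_add_mod (c (t + j) : ℕ) k
    have e2 := Nat.div_add_mod (c t : ℕ) k
    rw [← e1, ← e2]
    rw [h3, h4]
  · intro t
    unfold BStep
    rcases hH _ _ (hadj t) with h | h
    · rcases hat_step hk h (hbd' _) with h | h
      · exact Or.inl h
      · exact Or.inr (Or.inr (Or.inl h))
    · rcases hat_step hk h (hbd' _) with h | h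
      · exact Or.inr (Or.inl ⟨h.1.symm, h.2⟩)
      · exact Or.inr (Or.inr (Or.inr ⟨h.1, h.2.1, h.2.2⟩))

/-- vertex to position, for the block order `ρ` -/
def blockFun (k N : ℕ) (ρ : Equiv.Perm (Fin N)) (v : ℕ) : ℕ :=
  if h : v < k * N then k * (ρ ⟨v / k, Nat.div_lt_of_lt_mul h⟩ : ℕ) + v % k else v

theorem blockFun_of_lt {k N : ℕ} (ρ : Equiv.Perm (Fin N)) (p : Fin N) {i : ℕ} (hi : i < k) :
    blockFun k N ρ (k * p + i) = k * (ρ p : ℕ) + i := by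
  have hk0 : 0 < k := by omega
  have h1 : k * (p : ℕ) + i < k * N := by
    have : k * ((p : ℕ) + 1) ≤ k * N := Nat.mul_le_mul_left _ p.2
    rw [mul_add] at this; omega
  have e2 : (k * (p : ℕ) + i) / k = p := by
    rw [Nat.mul_add_div hk0, Nat.div_eq_of_lt hi]; simp
  unfold blockFun
  rw [dif_pos h1]
  simp only [e2, Nat.mul_add_mod, Nat.mod_eq_of_lt hi]

theorem blockFun_of_ge {k N : ℕ} (ρ : Equiv.Perm (Fin N)) {v : ℕ} (hv : k * N ≤ v) :
    blockFun k N ρ v = v := by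
  unfold blockFun
  rw [dif_neg (by omega)]

theorem exists_block {k N v : ℕ} (hk : 0 < k) (hv : v < k * N) :
    ∃ (p : Fin N) (i : ℕ), i < k ∧ v = k * p + i :=
  ⟨⟨v / k, Nat.div_lt_of_lt_mul hv⟩, v % k, Nat.mod_lt _ hk, (Nat.div_add_mod v k).symm⟩

theorem block_lt {k N i : ℕ} (p : Fin N) (hi : i < k) : k * (p : ℕ) + i < k * N := by
  have : k * ((p : ℕ) + 1) ≤ k * N := Nat.mul_le_mul_left _ p.2
  rw [mul_add] at this; omega

theorem block_unique {k i i' a b : ℕ} (hi : i < k) (hi' : i' < k) (h : k * a + i = k * b + i') :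
    a = b ∧ i = i' := by
  have hk0 : 0 < k := by omega
  have e1 : (k * a + i) / k = a := by rw [Nat.mul_add_div hk0, Nat.div_eq_of_lt hi]; simp
  have e2 : (k * b + i') / k = b := by rw [Nat.mul_add_div hk0, Nat.div_eq_of_lt hi']; simp
  have e3 : a = b := by rw [← e1, ← e2, h]
  subst e3
  exact ⟨rfl, by omega⟩

theorem blockFun_lt {k N n : ℕ} (hk : 0 < k) (hn : k * N ≤ n) (ρ : Equiv.Perm (Fin N)) {v : ℕ}
    (hv : v < n) : blockFun k N ρ v < n := by
  by_cases h : v < k * N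
  · obtain ⟨p, i, hi, rfl⟩ := exists_block hk h
    rw [blockFun_of_lt _ _ hi]
    exact (block_lt _ hi).trans_le hn
  · rw [blockFun_of_ge _ (by omega)]; exact hv

theorem blockFun_inj {k N : ℕ} (hk : 0 < k) (ρ : Equiv.Perm (Fin N)) :
    Function.Injective (blockFun k N ρ) := by
  intro v w hvw
  by_cases h : v < k * N <;> by_cases h' : w < k * N
  · obtain ⟨p, i, hi, rfl⟩ := exists_block hk h
    obtain ⟨p', i', hi', rfl⟩ := exists_block hk h'
    rw [blockFun_of_lt _ _ hi, blockFun_of_lt _ _ hi'] at hvw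
    obtain ⟨h1, h2⟩ := block_unique hi hi' hvw
    have := ρ.injective (Fin.ext h1)
    rw [this, h2]
  · obtain ⟨p, i, hi, rfl⟩ := exists_block hk h
    rw [blockFun_of_lt _ _ hi, blockFun_of_ge _ (by omega)] at hvw
    have := block_lt (ρ p) hi
    omega
  · obtain ⟨p', i', hi', rfl⟩ := exists_block hk h'
    rw [blockFun_of_lt _ _ hi', blockFun_of_ge _ (by omega)] at hvw
    have := block_lt (ρ p') hi'
    omega
  · rwa [blockFun_of_ge _ (by omega), blockFun_of_ge _ (by omega)] at hvw

/-- the permutation of the vertices given by a block order -/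
noncomputable def blockPerm {k N n : ℕ} (hk : 0 < k) (hn : k * N ≤ n) (ρ : Equiv.Perm (Fin N)) :
    Equiv.Perm (Fin n) :=
  Equiv.ofBijective (fun v => (⟨blockFun k N ρ v, blockFun_lt hk hn ρ v.2⟩ : Fin n))
    (Finite.injective_iff_bijective.1 (fun v w h => by
      have := blockFun_inj hk ρ (Fin.mk.inj h)
      exact Fin.ext this))

theorem blockPerm_val {k N n : ℕ} (hk : 0 < k) (hn : k * N ≤ n) (ρ : Equiv.Perm (Fin N))
    (v : Fin n) : (blockPerm hk hn ρ v : ℕ) = blockFun k N ρ v := rfl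

theorem blockPerm_inj {k N n : ℕ} (hk : 0 < k) (hn : k * N ≤ n) :
    Function.Injective (blockPerm (N := N) hk hn) := by
  intro ρ ρ' h
  ext p
  have hlt := block_lt (i := 0) (k := k) p hk
  have := congrArg (fun f => ((f ⟨k * p + 0, by omega⟩ : Fin n) : ℕ)) h
  simp only [blockPerm_val] at this
  rw [blockFun_of_lt _ _ hk, blockFun_of_lt _ _ hk] at this
  exact (block_unique hk hk this).1

theorem blockFun_hat {k N : ℕ} (hk : 3 ≤ k) {Γ : ℕ → ℕ → Prop} (ρ : Equiv.Perm (Fin N))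
    (hlast : ∀ p : Fin N, (p : ℕ) + 1 = N → (ρ p : ℕ) + 1 = N)
    (hΓ : ∀ p p' : Fin N, (ρ p : ℕ) + 1 = ρ p' → Γ p p') {v w : ℕ}
    (h : blockFun k N ρ v + 1 = blockFun k N ρ w) : HatE k N Γ v w := by
  have hk0 : 0 < k := by omega
  by_cases h1 : v < k * N <;> by_cases h2 : w < k * N
  · obtain ⟨p, i, hi, rfl⟩ := exists_block hk0 h1
    obtain ⟨p', i', hi', rfl⟩ := exists_block hk0 h2
    rw [blockFun_of_lt _ _ hi, blockFun_of_lt _ _ hi'] at h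
    by_cases hi2 : i + 1 < k
    · rw [add_assoc] at h
      obtain ⟨e1, e2⟩ := block_unique hi2 hi' h
      have := ρ.injective (Fin.ext e1)
      subst this
      left
      refine ⟨by omega, Or.inl ?_⟩
      rw [Nat.mul_add_mod, Nat.mod_eq_of_lt hi']
      omega
    · have : k * ((ρ p : ℕ) + 1) + 0 = k * (ρ p' : ℕ) + i' := by rw [mul_add]; omega
      obtain ⟨e1, e2⟩ := block_unique hk0 hi' this
      right
      refine ⟨p, p', ?_, p'.2, by omega, by omega, hΓ _ _ e1⟩
      by_contra hcon
      have := hlast p (by have := p.2; omega)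
      have := (ρ p').2
      omega
  · left
    obtain ⟨p, i, hi, rfl⟩ := exists_block hk0 h1
    rw [blockFun_of_lt _ _ hi, blockFun_of_ge _ (by omega)] at h
    have e := block_lt (ρ p) hi
    have e3 : w = k * N := by omega
    have e4 : k * ((ρ p : ℕ) + 1) ≤ k * N := Nat.mul_le_mul_left _ (ρ p).2
    rw [mul_add] at e4
    have e5 : k * (ρ p : ℕ) + i = k * (N - 1) + (k - 1) := by
      have : k * N = k * (N - 1) + k := by
        have := p.2
        rw [← Nat.mul_succ]; congr 1; omega
      omega
    obtain ⟨e6, e7⟩ := block_unique hi (by omega) e5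
    have hp := p.2
    have hl : p = ⟨N - 1, by omega⟩ := by
      apply ρ.injective
      apply Fin.ext
      have := hlast ⟨N - 1, by omega⟩ (by simp; omega)
      omega
    refine ⟨?_, Or.inr (by omega)⟩
    have : (p : ℕ) = ρ p := by rw [e6, hl]
    have : k * (p : ℕ) = k * (ρ p : ℕ) := by rw [← this]
    omega
  · exfalso
    obtain ⟨p', i', hi', rfl⟩ := exists_block hk0 h2
    rw [blockFun_of_lt _ _ hi', blockFun_of_ge _ (by omega)] at h
    have := block_lt (ρ p') hi'
    omega
  · left
    rw [blockFun_of_ge _ (by omega), blockFun_of_ge _ (by omega)] at h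
    exact ⟨h.symm, Or.inr (by omega)⟩

/-- the Hamiltonian path of a permutation -/
def permPath {n : ℕ} (σ : Equiv.Perm (Fin n)) : SimpleGraph (Fin n) := (pathGraph n).comap σ

theorem permPath_cycle_comp {n : ℕ} (σ σ' τ : Equiv.Perm (Fin n)) (m : ℕ)
    (h : ContainsCycleLen (permPath (τ.trans σ) ⊔ permPath (τ.trans σ')) m) :
    ContainsCycleLen (permPath σ ⊔ permPath σ') m := by
  obtain ⟨u, w, hw, hl⟩ := h
  let f : (permPath (τ.trans σ) ⊔ permPath (τ.trans σ')) →g (permPath σ ⊔ permPath σ') :=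
    ⟨τ, by
      intro a b hab
      simpa [permPath] using hab⟩
  refine ⟨f u, w.map f, ?_, by simpa using hl⟩
  exact hw.map (f := f) τ.injective

theorem Hnum_mul_le {n m : ℕ} (C : Finset (Equiv.Perm (Fin n)))
    (hC : ∀ σ ∈ C, ∀ σ' ∈ C, ¬ ContainsCycleLen (permPath σ ⊔ permPath σ') m) :
    Hnum n m * C.card ≤ n.factorial := by
  classical
  have hmem : Hnum n m ∈ {m' | ∃ F : Finset (SimpleGraph (Fin n)), F.card = m' ∧
    (∀ G ∈ F, IsHamPathGraph G) ∧
    ∀ G₁ ∈ F, ∀ G₂ ∈ F, G₁ ≠ G₂ → ContainsCycleLen (G₁ ⊔ G₂) m} := by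
    apply Nat.sSup_mem
    · exact ⟨0, ∅, by simp⟩
    · refine ⟨Fintype.card (SimpleGraph (Fin n)), ?_⟩
      rintro x ⟨F, rfl, -⟩
      exact Finset.card_le_univ _
  obtain ⟨F, hF, hF1, hF2⟩ := hmem
  rw [← hF, ← Finset.card_product]
  have hex : ∀ G : SimpleGraph (Fin n), ∃ σ : Equiv.Perm (Fin n), G ∈ F → G = permPath σ := by
    intro G
    by_cases hG : G ∈ F
    · obtain ⟨σ, hσ⟩ := hF1 G hG
      refine ⟨σ, fun _ => ?_⟩
      ext a b
      simp [permPath, hσ a b]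
    · exact ⟨1, fun h => absurd h hG⟩
  choose s hs using hex
  have hcard : n.factorial = (Finset.univ : Finset (Equiv.Perm (Fin n))).card := by
    rw [Finset.card_univ, Fintype.card_perm, Fintype.card_fin]
  rw [hcard]
  apply Finset.card_le_card_of_injOn (fun x : SimpleGraph (Fin n) × Equiv.Perm (Fin n) =>
    (s x.1).trans x.2.symm) (fun _ _ => Finset.mem_coe.2 (Finset.mem_univ _))
  rintro ⟨G, c⟩ h1 ⟨G', c'⟩ h2 heq
  simp only [Finset.coe_product, Set.mem_prod, Finset.mem_coe] at h1 h2 heq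
  have e1 : ((s G).trans c.symm).trans c = s G := by ext; simp
  have e2 : ((s G).trans c.symm).trans c' = s G' := by rw [heq]; ext; simp
  by_cases hGG : G = G'
  · subst hGG
    have : c = c' := by
      have h3 : c.symm = c'.symm := by
        ext x
        have := Equiv.congr_fun heq ((s G).symm x)
        simpa using congrArg Fin.val this
      rw [← c.symm_symm, h3, c'.symm_symm]
    rw [this]
  · exfalso
    have := hF2 G h1.1 G' h2.1 hGG
    rw [hs G h1.1, hs G' h2.1, ← e1, ← e2] at this
    exact hC c h1.2 c' h2.2 (permPath_cycle_comp _ _ _ _ this)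

/-- from a good set of block orders to a bound on `Hnum` -/
theorem Hnum_mul_le_of_orders {k N n : ℕ} (hk : 3 ≤ k) (hodd : Odd k) (hN : 0 < N)
    (hn : k * N ≤ n) {Γ : ℕ → ℕ → Prop} (no2 : ∀ a b, Γ a b → ¬ Γ b a)
    (noalt : ¬ ∃ a b : ℕ → ℕ, (∀ t, a (t + k) = a t) ∧ (∀ t, b (t + k) = b t) ∧
      (∀ t, Γ (a t) (b t)) ∧ (∀ t, Γ (a (t + 1)) (b t)) ∧
      (∀ t, a (t + 1) ≠ a t) ∧ (∀ t, b (t + 1) ≠ b t))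
    (R : Finset (Equiv.Perm (Fin N)))
    (hlast : ∀ ρ ∈ R, ∀ p : Fin N, (p : ℕ) + 1 = N → (ρ p : ℕ) + 1 = N)
    (hΓ : ∀ ρ ∈ R, ∀ p p' : Fin N, (ρ p : ℕ) + 1 = ρ p' → Γ p p') :
    Hnum n (2 * k) * R.card ≤ n.factorial := by
  classical
  have hk0 : 0 < k := by omega
  rw [← Finset.card_image_of_injective R (blockPerm_inj hk0 hn)]
  apply Hnum_mul_le
  intro σ hσ σ' hσ'
  obtain ⟨ρ, hρ, rfl⟩ := Finset.mem_image.1 hσ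
  obtain ⟨ρ', hρ', rfl⟩ := Finset.mem_image.1 hσ'
  apply hat_no_cycle hk hodd hN no2 noalt
  have aux : ∀ ρ ∈ R, ∀ u v : Fin n, (permPath (blockPerm hk0 hn ρ)).Adj u v →
      HatE k N Γ u v ∨ HatE k N Γ v u := by
    intro ρ hρ u v h
    simp only [permPath, SimpleGraph.comap_adj, pathGraph_adj, blockPerm_val] at h
    rcases h with h | h
    · exact Or.inl (blockFun_hat hk ρ (hlast ρ hρ) (hΓ ρ hρ) h)
    · exact Or.inr (blockFun_hat hk ρ (hlast ρ hρ) (hΓ ρ hρ) h)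
  intro u v h
  rcases h with h | h
  · exact aux ρ hρ u v h
  · exact aux ρ' hρ' u v h

theorem pow_self_le_factorial (d : ℕ) : d ^ d ≤ 3 ^ d * d.factorial := by
  have h1 := Real.pow_div_factorial_le_exp (d : ℝ) (by positivity) d
  have h2 : Real.exp d ≤ 3 ^ d := by
    have h3 : Real.exp 1 ≤ 3 := by linarith [Real.exp_one_lt_d9]
    calc Real.exp d = (Real.exp 1) ^ d := by rw [← Real.exp_nat_mul]; simp
      _ ≤ 3 ^ d := pow_le_pow_left₀ (Real.exp_pos _).le h3 d
  have h4 : (0 : ℝ) < d.factorial := by positivity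
  rw [div_le_iff₀ h4] at h1
  have : (d : ℝ) ^ d ≤ 3 ^ d * d.factorial := h1.trans (mul_le_mul_of_nonneg_right h2 h4.le)
  exact_mod_cast this

/-- size of a fiber -/
def fibc {N : ℕ} {L : Type} [DecidableEq L] (μ : Fin N → L) (l : L) : ℕ :=
  (Finset.univ.filter (fun b => μ b = l)).card

theorem sum_fibc {N : ℕ} {L : Type} [DecidableEq L] [Fintype L] (μ : Fin N → L) :
    ∑ l, fibc μ l = N := by
  have := Finset.card_eq_sum_card_fiberwise (f := μ) (s := Finset.univ) (t := Finset.univ)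
    (fun _ _ => by simp)
  simpa [fibc] using this.symm

theorem sum_prod_factorial {L : Type} [DecidableEq L] [Fintype L] (i : ℕ) :
    ∑ μ : Fin i → L, ∏ l, (fibc μ l).factorial ≤ (Fintype.card L + i) ^ i := by
  induction i with
  | zero => simp [fibc]
  | succ i ih =>
    rw [← (Fin.consEquiv (fun _ : Fin (i + 1) => L)).sum_comp, Fintype.sum_prod_type_right]
    have key : ∀ μ : Fin i → L, ∑ a : L, ∏ l, (fibc (Fin.consEquiv (fun _ : Fin (i + 1) => L)
        (a, μ)) l).factorial = (Fintype.card L + i) * ∏ l, (fibc μ l).factorial := by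
      intro μ
      have h1 : ∀ a : L, ∏ l, (fibc (Fin.consEquiv (fun _ : Fin (i + 1) => L) (a, μ)) l).factorial
          = (fibc μ a + 1) * ∏ l, (fibc μ l).factorial := by
        intro a
        have h2 : ∀ l, fibc (Fin.consEquiv (fun _ : Fin (i + 1) => L) (a, μ)) l =
            if l = a then fibc μ l + 1 else fibc μ l := by
          intro l
          unfold fibc
          rw [Fin.card_filter_univ_succ]
          by_cases hl : l = a
          · subst hl; simp [Fin.consEquiv]
          · simp [Fin.consEquiv, hl, Ne.symm hl]
        rw [← Finset.mul_prod_erase _ _ (Finset.mem_univ a),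
          ← Finset.mul_prod_erase _ (fun l => (fibc μ l).factorial) (Finset.mem_univ a), ← mul_assoc]
        congr 1
        · rw [h2, if_pos rfl, Nat.factorial_succ]
        · apply Finset.prod_congr rfl
          intro l hl
          rw [h2, if_neg (Finset.ne_of_mem_erase hl)]
      rw [Finset.sum_congr rfl (fun a _ => h1 a), ← Finset.sum_mul, Finset.sum_add_distrib,
        sum_fibc]
      simp [add_comm]
    rw [Finset.sum_congr rfl (fun μ _ => key μ), ← Finset.mul_sum, pow_succ, mul_comm]
    apply Nat.mul_le_mul
    · exact ih.trans (Nat.pow_le_pow_left (by omega) _)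
    · omega

theorem prod_fibc_le {N : ℕ} {L : Type} [DecidableEq L] [Fintype L] (μ : Fin N → L) :
    ∏ b, fibc μ (μ b) ≤ 3 ^ N * ∏ l, (fibc μ l).factorial := by
  rw [← Finset.prod_fiberwise' Finset.univ μ (fun l => fibc μ l)]
  have : 3 ^ N = ∏ l, 3 ^ (fibc μ l) := by
    rw [Finset.prod_pow_eq_pow_sum, sum_fibc]
  rw [this, ← Finset.prod_mul_distrib]
  apply Finset.prod_le_prod'
  intro l _
  rw [Finset.prod_const]
  exact pow_self_le_factorial _

theorem sum_prod_fibc_le {N : ℕ} {L : Type} [DecidableEq L] [Fintype L]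
    (hL : Fintype.card L = N) :
    ∑ μ : Fin N → L, ∏ b, fibc μ (μ b) ≤ 18 ^ N * N.factorial := by
  calc ∑ μ : Fin N → L, ∏ b, fibc μ (μ b)
      ≤ ∑ μ : Fin N → L, 3 ^ N * ∏ l, (fibc μ l).factorial :=
        Finset.sum_le_sum (fun μ _ => prod_fibc_le μ)
    _ = 3 ^ N * ∑ μ : Fin N → L, ∏ l, (fibc μ l).factorial := by rw [Finset.mul_sum]
    _ ≤ 3 ^ N * (N + N) ^ N := by
        apply Nat.mul_le_mul_left
        have := sum_prod_factorial (L := L) N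
        rwa [hL] at this
    _ = 6 ^ N * N ^ N := by rw [← two_mul, mul_pow, ← mul_assoc, ← mul_pow]; norm_num
    _ ≤ 6 ^ N * (3 ^ N * N.factorial) := Nat.mul_le_mul_left _ (pow_self_le_factorial N)
    _ = 18 ^ N * N.factorial := by rw [← mul_assoc, ← mul_pow]; norm_num

theorem card_fix_last (m : ℕ) : (m + 1).factorial ≤ (m + 1) *
    (Finset.univ.filter (fun ρ : Equiv.Perm (Fin (m + 1)) => ρ (Fin.last m) = Fin.last m)).card := by
  classical
  have h1 : (m + 1).factorial = (Finset.univ : Finset (Equiv.Perm (Fin (m + 1)))).card := by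
    rw [Finset.card_univ, Fintype.card_perm, Fintype.card_fin]
  have h2 : ∀ S : Finset (Equiv.Perm (Fin (m + 1))),
      (m + 1) * S.card = ((Finset.univ : Finset (Fin (m + 1))) ×ˢ S).card := by
    intro S; rw [Finset.card_product, Finset.card_univ, Fintype.card_fin]
  rw [h1, h2]
  apply Finset.card_le_card_of_injOn
    (fun ρ => (ρ (Fin.last m), Equiv.swap (ρ (Fin.last m)) (Fin.last m) * ρ))
  · intro ρ _
    simp
  · intro ρ _ ρ' _ h
    simp only [Prod.mk.injEq] at h
    rw [h.1] at h
    exact mul_left_cancel h.2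

/-- The cyclic successor of a block in the order `ρ`. -/
def succT {N : ℕ} (ρ : Equiv.Perm (Fin N)) : Equiv.Perm (Fin N) :=
  ρ.trans ((finRotate N).trans ρ.symm)

theorem succT_of {N : ℕ} (ρ : Equiv.Perm (Fin N)) (p p' : Fin N) (h : (ρ p : ℕ) + 1 = ρ p') :
    succT ρ p = p' := by
  obtain ⟨m, rfl⟩ : ∃ m, N = m + 1 := ⟨N - 1, by have := p.2; omega⟩
  simp only [succT, Equiv.trans_apply]
  rw [Equiv.symm_apply_eq]
  apply Fin.ext
  rw [coe_finRotate_of_ne_last, h]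
  intro hl
  rw [hl] at h
  have := (ρ p').2
  simp at h
  omega

theorem exists_J {N : ℕ} {K L : Type} [DecidableEq L] [Fintype L] [DecidableEq K] [Fintype K]
    (hN : 0 < N) (line : Fin N → K → L) (μ : Fin N → L)
    (A : Finset (Equiv.Perm (Fin N) × (Fin N → K)))
    (hA : ∀ a ∈ A, ∀ p, μ (succT a.1 p) = line p (a.2 p)) :
    ∃ J : Fin N × K → Fin N, A.card ≤ (∏ b, fibc μ (μ b)) *
      (A.filter (fun a => ∀ p, J (p, a.2 p) = succT a.1 p)).card := by
  classical
  set W := ∏ b, fibc μ (μ b) with hW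
  let t : Fin N × K → Finset (Fin N) := fun e =>
    if (Finset.univ.filter (fun b => μ b = line e.1 e.2)).Nonempty then
      Finset.univ.filter (fun b => μ b = line e.1 e.2) else Finset.univ
  have ht : ∀ e, (t e).Nonempty := by
    intro e
    by_cases h : (Finset.univ.filter (fun b => μ b = line e.1 e.2)).Nonempty
    · simp only [t, if_pos h]; exact h
    · simp only [t, if_neg h]; exact ⟨⟨0, hN⟩, Finset.mem_univ _⟩
  set ALL := Fintype.piFinset t with hALL
  have hne : ALL.Nonempty := Fintype.piFinset_nonempty.2 ht
  have good : ∀ a ∈ A, ALL.card = W *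
      (ALL.filter (fun J => ∀ p, J (p, a.2 p) = succT a.1 p)).card := by
    intro a ha
    let t' : Fin N × K → Finset (Fin N) := fun e =>
      if e.2 = a.2 e.1 then {succT a.1 e.1} else t e
    have hmem : ∀ p, succT a.1 p ∈ Finset.univ.filter (fun b => μ b = line p (a.2 p)) := by
      intro p; simp [hA a ha p]
    have htp : ∀ p, t (p, a.2 p) = Finset.univ.filter (fun b => μ b = line p (a.2 p)) := by
      intro p; simp only [t]; rw [if_pos ⟨_, hmem p⟩]
    have e1 : ALL.filter (fun J => ∀ p, J (p, a.2 p) = succT a.1 p) = Fintype.piFinset t' := by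
      ext J
      simp only [hALL, Finset.mem_filter, Fintype.mem_piFinset]
      constructor
      · rintro ⟨h1, h2⟩ ⟨p, x⟩
        simp only [t']
        split_ifs with h
        · subst h; simp [h2 p]
        · exact h1 _
      · intro h
        constructor
        · rintro ⟨p, x⟩
          have := h (p, x)
          simp only [t'] at this
          split_ifs at this with hx
          · subst hx
            rw [Finset.mem_singleton] at this
            rw [this, htp]; exact hmem p
          · exact this
        · intro p
          have := h (p, a.2 p)
          simpa [t'] using this
    have hW2 : W = ∏ p, fibc μ (μ (succT a.1 p)) :=
      (Equiv.prod_comp (succT a.1) (fun b => fibc μ (μ b))).symm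
    rw [e1, hALL, Fintype.card_piFinset, Fintype.card_piFinset, Fintype.prod_prod_type,
      Fintype.prod_prod_type, hW2, ← Finset.prod_mul_distrib]
    apply Finset.prod_congr rfl
    intro p _
    rw [← Finset.mul_prod_erase _ _ (Finset.mem_univ (a.2 p)),
      ← Finset.mul_prod_erase _ (fun x => (t' (p, x)).card) (Finset.mem_univ (a.2 p)), ← mul_assoc]
    congr 1
    · rw [htp, hA a ha p]
      simp [t', fibc]
    · apply Finset.prod_congr rfl
      intro x hx
      simp only [t']
      rw [if_neg (Finset.ne_of_mem_erase hx)]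
  have hsum : ∑ _J ∈ ALL, A.card ≤ ∑ J ∈ ALL,
      W * (A.filter (fun a => ∀ p, J (p, a.2 p) = succT a.1 p)).card := by
    rw [← Finset.mul_sum]
    have h3 := Finset.sum_card_bipartiteAbove_eq_sum_card_bipartiteBelow (s := ALL) (t := A)
      (fun (J : Fin N × K → Fin N) (a : Equiv.Perm (Fin N) × (Fin N → K)) =>
        ∀ p, J (p, a.2 p) = succT a.1 p)
    simp only [Finset.bipartiteAbove, Finset.bipartiteBelow] at h3
    rw [h3, Finset.mul_sum, Finset.sum_const, smul_eq_mul, mul_comm, ← smul_eq_mul,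
      ← Finset.sum_const]
    exact Finset.sum_le_sum (fun a ha => (good a ha).le)
  obtain ⟨J, -, hJ⟩ := Finset.exists_le_of_sum_le hne hsum
  exact ⟨J, hJ⟩

theorem exists_orders {N : ℕ} {K L : Type} [DecidableEq L] [Fintype L] [DecidableEq K] [Fintype K]
    (hN : 0 < N) (hL : Fintype.card L = N) (line : Fin N → K → L)
    (linj : ∀ p, Function.Injective (line p)) :
    ∃ (μ : Fin N → L) (col : Fin N → ZMod 3) (J : Fin N × K → Fin N)
      (R : Finset (Equiv.Perm (Fin N))), Fintype.card K ^ N ≤ R.card * (N * 54 ^ N) ∧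
      ∀ ρ ∈ R, (∀ p : Fin N, (p : ℕ) + 1 = N → (ρ p : ℕ) + 1 = N) ∧
        ∀ p p' : Fin N, (ρ p : ℕ) + 1 = ρ p' → col p' = col p + 1 ∧
          ∃ s, J (p, s) = p' ∧ line p s = μ p' := by
  classical
  obtain ⟨m, rfl⟩ : ∃ m, N = m + 1 := ⟨N - 1, by omega⟩
  set S := Finset.univ.filter (fun ρ : Equiv.Perm (Fin (m + 1)) => ρ (Fin.last m) = Fin.last m)
    with hS
  have hScard := card_fix_last m
  rw [← hS] at hScard
  set A : Finset (Equiv.Perm (Fin (m + 1)) × (Fin (m + 1) → K)) := S ×ˢ Finset.univ with hA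
  let key : Equiv.Perm (Fin (m + 1)) × (Fin (m + 1) → K) →
    (Fin (m + 1) → L) × (Fin (m + 1) → ZMod 3) := fun a =>
      (fun b => line ((succT a.1).symm b) (a.2 ((succT a.1).symm b)), fun p => ((a.1 p : ℕ) : ZMod 3))
  have hAc := Finset.card_eq_sum_card_fiberwise (f := key) (s := A) (t := Finset.univ)
    (fun _ _ => by simp)
  have hsum : ∑ x : (Fin (m + 1) → L) × (Fin (m + 1) → ZMod 3),
      Fintype.card K ^ (m + 1) * ∏ b, fibc x.1 (x.1 b) ≤
      ∑ x : (Fin (m + 1) → L) × (Fin (m + 1) → ZMod 3),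
        (A.filter (fun a => key a = x)).card * ((m + 1) * 54 ^ (m + 1)) := by
    rw [← Finset.sum_mul, ← hAc, Fintype.sum_prod_type]
    simp only [Finset.sum_const, smul_eq_mul]
    rw [← Finset.mul_sum, ← Finset.mul_sum, hA, Finset.card_product, Finset.card_univ,
      Finset.card_univ, Fintype.card_fun, Fintype.card_fun, Fintype.card_fin, ZMod.card]
    have h1 := sum_prod_fibc_le (L := L) hL
    calc 3 ^ (m + 1) * (Fintype.card K ^ (m + 1) * ∑ μ : Fin (m + 1) → L, ∏ b, fibc μ (μ b))
        ≤ 3 ^ (m + 1) * (Fintype.card K ^ (m + 1) * (18 ^ (m + 1) * ((m + 1) * S.card))) := by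
          gcongr
          exact h1.trans (Nat.mul_le_mul_left _ hScard)
      _ = _ := by
          rw [show 54 = 3 * 18 by norm_num, mul_pow]; ring
  have : Nonempty L := Fintype.card_pos_iff.1 (by omega)
  obtain ⟨⟨μ, col⟩, -, hx⟩ := Finset.exists_le_of_sum_le Finset.univ_nonempty hsum
  set B := A.filter (fun a => key a = (μ, col)) with hB
  have hBp : ∀ a ∈ B, a.1 (Fin.last m) = Fin.last m ∧
      (∀ p, μ (succT a.1 p) = line p (a.2 p)) ∧ ∀ p, col p = ((a.1 p : ℕ) : ZMod 3) := by
    intro a ha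
    rw [hB, Finset.mem_filter, hA, Finset.mem_product, hS, Finset.mem_filter] at ha
    obtain ⟨⟨⟨-, h1⟩, -⟩, h2⟩ := ha
    simp only [key, Prod.mk.injEq] at h2
    refine ⟨h1, fun p => ?_, fun p => ?_⟩
    · rw [← h2.1]; simp
    · rw [← h2.2]
  obtain ⟨J, hJ⟩ := exists_J hN line μ B (fun a ha => (hBp a ha).2.1)
  set C := B.filter (fun a => ∀ p, J (p, a.2 p) = succT a.1 p) with hC
  refine ⟨μ, col, J, C.image Prod.fst, ?_, ?_⟩
  · have hinj : Set.InjOn Prod.fst (C : Set (Equiv.Perm (Fin (m + 1)) × (Fin (m + 1) → K))) := by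
      rintro ⟨ρ, s⟩ h1 ⟨ρ', s'⟩ h2 h
      simp only at h
      subst h
      have h1 := hBp _ (Finset.mem_filter.1 (Finset.mem_coe.1 h1)).1
      have h2 := hBp _ (Finset.mem_filter.1 (Finset.mem_coe.1 h2)).1
      congr 1
      ext p
      exact linj p ((h1.2.1 p).symm.trans (h2.2.1 p))
    rw [Finset.card_image_of_injOn hinj]
    have hWpos : 0 < ∏ b, fibc μ (μ b) := by
      apply Finset.prod_pos
      intro b _
      exact Finset.card_pos.2 ⟨b, by simp⟩
    apply Nat.le_of_mul_le_mul_right _ hWpos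
    calc _ ≤ B.card * ((m + 1) * 54 ^ (m + 1)) := hx
      _ ≤ ((∏ b, fibc μ (μ b)) * C.card) * ((m + 1) * 54 ^ (m + 1)) :=
        Nat.mul_le_mul_right _ hJ
      _ = _ := by ring
  · intro ρ hρ
    obtain ⟨⟨ρ', s⟩, h1, rfl⟩ := Finset.mem_image.1 hρ
    rw [hC, Finset.mem_filter] at h1
    obtain ⟨h1, h2⟩ := h1
    obtain ⟨h3, h4, h5⟩ := hBp _ h1
    refine ⟨?_, ?_⟩
    · intro p hp
      have : p = Fin.last m := Fin.ext (by simp; omega)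
      rw [this]
      simp only at h3
      simp [h3]
    · intro p p' hpp
      have hT := succT_of ρ' p p' hpp
      refine ⟨?_, s p, ?_, ?_⟩
      · rw [h5, h5]
        simp only at hpp ⊢
        rw [← hpp]; push_cast; rfl
      · have := h2 p; simp only at this; rw [this, hT]
      · have := h4 p; simp only at this; rw [← this, hT]

theorem Hnum_le_of_group {G K : Type} [Group G] [Finite G] [AddGroup K] [Fintype K]
    [DecidableEq K] (A B : Multiplicative K →* G) (hAinj : Function.Injective A)
    (hBinj : Function.Injective B)
    (hAB : ∀ s t : K, A (Multiplicative.ofAdd s) = B (Multiplicative.ofAdd t) → s = 0)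
    {k : ℕ} (hk : 3 ≤ k) (hodd : Odd k)
    (hno : ∀ (a b : ℕ → K), (∀ i, a i ≠ 0) → (∀ i, b i ≠ 0) → ∀ g : ℕ → G,
      (∀ i, g (i + 1) = g i * A (Multiplicative.ofAdd (a i)) * B (Multiplicative.ofAdd (b i))) →
      g k ≠ g 0) :
    ∃ N0 : ℕ, 0 < N0 ∧ N0 * Fintype.card K = Nat.card G ∧ ∀ M : ℕ, 0 < M → ∀ n : ℕ,
      k * (M * N0) ≤ n →
      Hnum n (2 * k) * Fintype.card K ^ (M * N0) ≤ n.factorial * (M * N0 * 54 ^ (M * N0)) := by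
  classical
  let P := G ⧸ A.range
  let L0 := G ⧸ B.range
  have : Fintype P := Fintype.ofFinite P
  have : Fintype L0 := Fintype.ofFinite L0
  have cA : Nat.card A.range = Fintype.card K := by
    rw [← Nat.card_congr (MonoidHom.ofInjective hAinj).toEquiv, ← Nat.card_eq_fintype_card]
    exact Nat.card_congr Multiplicative.toAdd
  have cB : Nat.card B.range = Fintype.card K := by
    rw [← Nat.card_congr (MonoidHom.ofInjective hBinj).toEquiv, ← Nat.card_eq_fintype_card]
    exact Nat.card_congr Multiplicative.toAdd
  have hP : Fintype.card P * Fintype.card K = Nat.card G := by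
    rw [← cA, ← Nat.card_eq_fintype_card]
    exact (Subgroup.card_eq_card_quotient_mul_card_subgroup _).symm
  have hL : Fintype.card L0 * Fintype.card K = Nat.card G := by
    rw [← cB, ← Nat.card_eq_fintype_card]
    exact (Subgroup.card_eq_card_quotient_mul_card_subgroup _).symm
  have hKpos : 0 < Fintype.card K := Fintype.card_pos_iff.2 ⟨0⟩
  have hLP : Fintype.card L0 = Fintype.card P :=
    Nat.eq_of_mul_eq_mul_right hKpos (hL.trans hP.symm)
  have hPpos : 0 < Fintype.card P := Fintype.card_pos_iff.2 ⟨((1 : G) : G ⧸ A.range)⟩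
  refine ⟨Fintype.card P, hPpos, hP, ?_⟩
  intro M hM n hn
  set N := M * Fintype.card P with hNdef
  have hN : 0 < N := Nat.mul_pos hM hPpos
  have ecard : Fintype.card (P × Fin M) = N := by
    rw [Fintype.card_prod, Fintype.card_fin, hNdef, mul_comm]
  let e : Fin N ≃ P × Fin M := (Fintype.equivFinOfCardEq ecard).symm
  have lcard : Fintype.card (L0 × Fin M) = N := by
    rw [Fintype.card_prod, Fintype.card_fin, hNdef, hLP, mul_comm]
  let o : Fin N → G := fun p => Quotient.out (e p).1
  let line : Fin N → K → L0 × Fin M := fun p s =>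
    (((o p * A (Multiplicative.ofAdd s) : G) : G ⧸ B.range), (e p).2)
  have hline : ∀ p p' s s', line p s = line p' s' → ∃ t : K,
      o p' * A (Multiplicative.ofAdd s') =
        o p * A (Multiplicative.ofAdd s) * B (Multiplicative.ofAdd t) ∧ (t = 0 → p = p') := by
    intro p p' s s' h
    have h1 := congrArg Prod.fst h
    have h2 := congrArg Prod.snd h
    simp only [line] at h1 h2
    rw [QuotientGroup.eq] at h1
    obtain ⟨t, ht⟩ := h1
    refine ⟨Multiplicative.toAdd t, ?_, ?_⟩
    · rw [ofAdd_toAdd, ht]; group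
    · intro h0
      have ht1 : t = 1 := h0
      rw [ht1, map_one] at ht
      have h3 : o p * A (Multiplicative.ofAdd s) = o p' * A (Multiplicative.ofAdd s') := by
        have := inv_mul_eq_one.1 ht.symm
        exact this
      apply e.injective
      refine Prod.ext ?_ h2
      have h4 : ((o p : G) : G ⧸ A.range) = ((o p' : G) : G ⧸ A.range) := by
        rw [QuotientGroup.eq]
        refine ⟨Multiplicative.ofAdd s * (Multiplicative.ofAdd s')⁻¹, ?_⟩
        rw [map_mul, map_inv]
        rw [eq_inv_mul_iff_mul_eq, ← mul_assoc, h3]; group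
      simp only [o] at h4
      rw [QuotientGroup.out_eq', QuotientGroup.out_eq'] at h4
      exact h4
  have linj : ∀ p, Function.Injective (line p) := by
    intro p s s' h
    have h1 := congrArg Prod.fst h
    simp only [line] at h1
    rw [QuotientGroup.eq] at h1
    obtain ⟨t, ht⟩ := h1
    have h2 : A (Multiplicative.ofAdd (-s + s')) = B (Multiplicative.ofAdd (Multiplicative.toAdd t)) := by
      rw [ofAdd_toAdd, ht, ofAdd_add, map_mul, ofAdd_neg, map_inv]; group
    have := hAB _ _ h2
    exact neg_add_eq_zero.1 this
  obtain ⟨μ, col, J, R, hR, hR2⟩ := exists_orders hN lcard line linj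
  let Γ' : Fin N → Fin N → Prop := fun p p' => col p' = col p + 1 ∧
          ∃ s, J (p, s) = p' ∧ line p s = μ p'
  let Γ : ℕ → ℕ → Prop := fun p p' => ∃ (hp : p < N) (hp' : p' < N), Γ' ⟨p, hp⟩ ⟨p', hp'⟩
  have hS : ∀ p b : Fin N, ∃ s, Γ' p b → J (p, s) = b ∧ line p s = μ b := by
    intro p b
    by_cases h : Γ' p b
    · obtain ⟨-, s, hs⟩ := h
      exact ⟨s, fun _ => hs⟩
    · exact ⟨0, fun h' => absurd h' h⟩
  choose S hS using hS
  have main := Hnum_mul_le_of_orders (n := n) hk hodd hN hn (Γ := Γ) ?_ ?_ R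
    (fun ρ hρ => (hR2 ρ hρ).1) (fun ρ hρ p p' h => ⟨p.2, p'.2, (hR2 ρ hρ).2 p p' h⟩)
  · calc Hnum n (2 * k) * Fintype.card K ^ N
        ≤ Hnum n (2 * k) * (R.card * (N * 54 ^ N)) := Nat.mul_le_mul_left _ hR
      _ = (Hnum n (2 * k) * R.card) * (N * 54 ^ N) := by ring
      _ ≤ _ := Nat.mul_le_mul_right _ main
  · rintro a b ⟨ha, hb, h1, -⟩ ⟨hb', ha', h2, -⟩
    rw [h1, add_assoc] at h2
    have : (1 + 1 : ZMod 3) = 0 := by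
      have := h2.symm
      rwa [add_eq_left] at this
    exact absurd this (by decide)
  · rintro ⟨a, b, pa, pb, h1, h2, na, nb⟩
    let a' : ℕ → Fin N := fun t => ⟨a t, (h1 t).1⟩
    let b' : ℕ → Fin N := fun t => ⟨b t, (h1 t).2.1⟩
    have g1 : ∀ t, Γ' (a' t) (b' t) := fun t => (h1 t).2.2
    have g2 : ∀ t, Γ' (a' (t + 1)) (b' t) := fun t => (h2 t).2.2
    have na' : ∀ t, a' (t + 1) ≠ a' t := fun t h => na t (congrArg Fin.val h)
    have nb' : ∀ t, b' (t + 1) ≠ b' t := fun t h => nb t (congrArg Fin.val h)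
    let S1 : ℕ → K := fun t => S (a' t) (b' t)
    let S2 : ℕ → K := fun t => S (a' (t + 1)) (b' t)
    have e1 := fun t => hS _ _ (g1 t)
    have e2 := fun t => hS _ _ (g2 t)
    have hl : ∀ t, line (a' (t + 1)) (S1 (t + 1)) = line (a' (t + 2)) (S2 (t + 1)) := by
      intro t
      exact (e1 (t + 1)).2.trans (e2 (t + 1)).2.symm
    choose β hβ using fun t => hline _ _ _ _ (hl t)
    refine hno (fun t => - S2 t + S1 (t + 1)) β ?_ ?_
      (fun t => o (a' (t + 1)) * A (Multiplicative.ofAdd (S2 t))) ?_ ?_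
    · intro t h
      have h3 : S2 t = S1 (t + 1) := neg_add_eq_zero.1 h
      apply nb' t
      have h4 := (e1 (t + 1)).1
      have h5 := (e2 t).1
      simp only [S1, S2] at h3
      rw [← h4, ← h5, h3]
    · intro t h
      exact na' (t + 1) ((hβ t).2 h).symm
    · intro t
      have := (hβ t).1
      rw [this, ofAdd_add, map_mul, ofAdd_neg, map_inv]
      group
    · have ea : a' (k + 1) = a' (0 + 1) := Fin.ext (by
        simp only [a']; rw [add_comm k 1, pa, zero_add])
      have eb : b' k = b' 0 := Fin.ext (by simp only [b']; rw [← pb 0, zero_add])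
      simp only [S2, ea, eb]

open Polynomial in
/-- The row recursion for a product of elementary matrices. -/
theorem row_rec {K : Type} [Field K] (a b : ℕ → K) (ha : ∀ i, a i ≠ 0) (hb : ∀ i, b i ≠ 0)
    (u v : ℕ → K[X]) (hu0 : u 0 = 1) (hv0 : v 0 = 0)
    (hv : ∀ i, v (i + 1) = v i + C (a i) * u i)
    (hu : ∀ i, u (i + 1) = u i + C (b i) * X * v (i + 1)) (j : ℕ) :
    (u j).coeff j ≠ 0 ∧ (∀ m, j < m → (u j).coeff m = 0) ∧ (∀ m, j ≤ m → (v j).coeff m = 0) := by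
  induction j with
  | zero =>
    rw [hu0, hv0]
    refine ⟨by simp, ?_, by simp⟩
    intro m hm
    rw [coeff_one, if_neg (by omega)]
  | succ j ih =>
    obtain ⟨h1, h2, h3⟩ := ih
    have hvj : (v (j + 1)).coeff j ≠ 0 := by
      rw [hv, coeff_add, coeff_C_mul, h3 j le_rfl, zero_add]
      exact mul_ne_zero (ha j) h1
    have hvm : ∀ m, j + 1 ≤ m → (v (j + 1)).coeff m = 0 := by
      intro m hm
      rw [hv, coeff_add, coeff_C_mul, h3 m (by omega), h2 m (by omega)]; simp
    refine ⟨?_, ?_, hvm⟩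
    · rw [hu, coeff_add, mul_assoc, coeff_C_mul, coeff_X_mul, h2 (j + 1) (by omega), zero_add]
      exact mul_ne_zero (hb j) hvj
    · intro m hm
      obtain ⟨m, rfl⟩ : ∃ m', m = m' + 1 := ⟨m - 1, by omega⟩
      rw [hu, coeff_add, mul_assoc, coeff_C_mul, coeff_X_mul, h2 (m + 1) (by omega),
        hvm m (by omega)]
      simp

/-- truncated polynomials -/
abbrev TR (q h : ℕ) : Type := AdjoinRoot (Polynomial.X ^ (h + 1) : Polynomial (ZMod q))

/-- constant coefficient -/
noncomputable def TReps (q h : ℕ) : TR q h →+* ZMod q :=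
  AdjoinRoot.lift (RingHom.id _) 0 (by simp)

theorem TReps_mk (q h : ℕ) (p : Polynomial (ZMod q)) :
    TReps q h (AdjoinRoot.mk _ p) = p.coeff 0 := by
  rw [TReps, AdjoinRoot.lift_mk, Polynomial.eval₂_id, Polynomial.coeff_zero_eq_eval_zero]

theorem TReps_nilp (q h : ℕ) (a : TR q h) (ha : TReps q h a = 0) : IsNilpotent a := by
  obtain ⟨p, rfl⟩ := AdjoinRoot.mk_surjective a
  rw [TReps_mk] at ha
  obtain ⟨r, rfl⟩ := Polynomial.X_dvd_iff.2 ha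
  refine ⟨h + 1, ?_⟩
  rw [← map_pow, AdjoinRoot.mk_eq_zero, mul_pow]
  exact dvd_mul_right _ _

theorem TR_card (q h : ℕ) [Fact q.Prime] : Finite (TR q h) ∧ Nat.card (TR q h) = q ^ (h + 1) := by
  have hm : (Polynomial.X ^ (h + 1) : Polynomial (ZMod q)).Monic := Polynomial.monic_X_pow _
  have : Module.Finite (ZMod q) (TR q h) := hm.finite_adjoinRoot
  have hf : Finite (TR q h) := Module.finite_of_finite (ZMod q)
  refine ⟨hf, ?_⟩
  rw [Module.natCard_eq_pow_finrank (K := ZMod q), Nat.card_zmod]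
  congr 1
  rw [(AdjoinRoot.powerBasis' hm).finrank, AdjoinRoot.powerBasis'_dim, Polynomial.natDegree_X_pow]

/-- The group of matrices upper unipotent modulo `x`. -/
def TG (q h : ℕ) : Subgroup (Matrix.SpecialLinearGroup (Fin 2) (TR q h)) where
  carrier := {g | TReps q h (g 0 0) = 1 ∧ TReps q h (g 1 0) = 0 ∧ TReps q h (g 1 1) = 1}
  mul_mem' := by
    rintro g g' ⟨h1, h2, h3⟩ ⟨h4, h5, h6⟩
    simp [Matrix.mul_apply, Fin.sum_univ_two, h1, h2, h3, h4, h5, h6]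
  one_mem' := by simp
  inv_mem' := by
    rintro g ⟨h1, h2, h3⟩
    rw [Set.mem_ofPred_eq, Matrix.SpecialLinearGroup.SL2_inv_expl]
    simp [h1, h2, h3]

theorem TG_card (q h : ℕ) [Fact q.Prime] :
    Finite (TG q h) ∧ Nat.card (TG q h) ≤ q ^ (3 * h + 1) := by
  obtain ⟨hf, hc⟩ := TR_card q h
  let I := (TReps q h).toAddMonoidHom.ker
  have hI : Nat.card I * q = q ^ (h + 1) := by
    have h1 := AddSubgroup.card_mul_index I
    have h2 : I.index = q := by
      rw [AddSubgroup.index_ker]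
      have : (TReps q h).toAddMonoidHom.range = ⊤ := by
        rw [AddMonoidHom.range_eq_top]
        intro c
        exact ⟨AdjoinRoot.mk _ (Polynomial.C c),
          (TReps_mk q h (Polynomial.C c)).trans (by simp)⟩
      rw [this, AddSubgroup.card_top, Nat.card_zmod]
    rw [h2, hc] at h1
    exact h1
  have hq : 0 < q := (Fact.out : q.Prime).pos
  have hI2 : Nat.card I = q ^ h := by
    exact Nat.eq_of_mul_eq_mul_right hq (hI.trans (pow_succ q h))
  let f : TG q h → I × TR q h × I := fun g =>
    (⟨g.1 0 0 - 1, by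
      show TReps q h _ = 0
      rw [map_sub, g.2.1, map_one, sub_self]⟩, g.1 0 1, ⟨g.1 1 0, g.2.2.1⟩)
  have hinj : Function.Injective f := by
    intro g g' hg
    have h1 : g.1 0 0 = g'.1 0 0 := sub_left_inj.1 (congrArg (fun z => (z.1 : TR q h)) hg)
    have h2 : g.1 0 1 = g'.1 0 1 := congrArg (fun z => z.2.1) hg
    have h3 : g.1 1 0 = g'.1 1 0 := congrArg (fun z => (z.2.2 : TR q h)) hg
    have d1 := g.1.det_coe
    have d2 := g'.1.det_coe
    rw [Matrix.det_fin_two] at d1 d2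
    have hu : IsUnit (g.1 0 0) := by
      have : g.1 0 0 = (g.1 0 0 - 1) + 1 := by ring
      rw [this]
      apply IsNilpotent.isUnit_add_one
      apply TReps_nilp
      rw [map_sub, g.2.1, map_one, sub_self]
    have h4 : g.1 1 1 = g'.1 1 1 := by
      apply hu.mul_left_cancel
      have : g.1 0 0 * g.1 1 1 = 1 + g.1 0 1 * g.1 1 0 := by linear_combination d1
      rw [this, h1, h2, h3]
      linear_combination -d2
    apply Subtype.ext
    ext i j
    fin_cases i <;> fin_cases j
    · exact h1
    · exact h2
    · exact h3
    · exact h4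
  have hfin : Finite (TG q h) := Finite.of_injective f hinj
  refine ⟨hfin, ?_⟩
  refine (Nat.card_le_card_of_injective f hinj).trans ?_
  rw [Nat.card_prod, Nat.card_prod, hI2, hc]
  apply le_of_eq
  ring


/-- upper unipotents -/
def eA {R : Type} [CommRing R] (c : R) : Matrix.SpecialLinearGroup (Fin 2) R :=
  ⟨!![1, c; 0, 1], by simp [Matrix.det_fin_two]⟩

/-- lower unipotents -/
def eB {R : Type} [CommRing R] (c : R) : Matrix.SpecialLinearGroup (Fin 2) R :=
  ⟨!![1, 0; c, 1], by simp [Matrix.det_fin_two]⟩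

theorem mul_eA_zero {R : Type} [CommRing R] (g : Matrix.SpecialLinearGroup (Fin 2) R) (c : R)
    (i : Fin 2) : (g * eA c) i 0 = g i 0 := by
  rw [Matrix.SpecialLinearGroup.coe_mul, Matrix.mul_apply, Fin.sum_univ_two]
  simp [eA]

theorem mul_eA_one {R : Type} [CommRing R] (g : Matrix.SpecialLinearGroup (Fin 2) R) (c : R)
    (i : Fin 2) : (g * eA c) i 1 = g i 1 + c * g i 0 := by
  rw [Matrix.SpecialLinearGroup.coe_mul, Matrix.mul_apply, Fin.sum_univ_two]
  simp [eA]; ring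

theorem mul_eB_zero {R : Type} [CommRing R] (g : Matrix.SpecialLinearGroup (Fin 2) R) (c : R)
    (i : Fin 2) : (g * eB c) i 0 = g i 0 + c * g i 1 := by
  rw [Matrix.SpecialLinearGroup.coe_mul, Matrix.mul_apply, Fin.sum_univ_two]
  simp [eB]; ring

theorem mul_eB_one {R : Type} [CommRing R] (g : Matrix.SpecialLinearGroup (Fin 2) R) (c : R)
    (i : Fin 2) : (g * eB c) i 1 = g i 1 := by
  rw [Matrix.SpecialLinearGroup.coe_mul, Matrix.mul_apply, Fin.sum_univ_two]
  simp [eB]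

theorem eA_add {R : Type} [CommRing R] (c d : R) : eA (c + d) = eA c * eA d := by
  ext i j
  fin_cases j
  · simp only [Fin.zero_eta]
    rw [mul_eA_zero]; fin_cases i <;> simp [eA]
  · simp only [Fin.mk_one]
    rw [mul_eA_one]; fin_cases i <;> simp [eA, add_comm]

theorem eB_add {R : Type} [CommRing R] (c d : R) : eB (c + d) = eB c * eB d := by
  ext i j
  fin_cases j
  · simp only [Fin.zero_eta]
    rw [mul_eB_zero]; fin_cases i <;> simp [eB]
  · simp only [Fin.mk_one]
    rw [mul_eB_one]; fin_cases i <;> simp [eB]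

theorem eA_zero {R : Type} [CommRing R] : eA (0 : R) = 1 := by
  ext i j; fin_cases i <;> fin_cases j <;> simp [eA]

theorem eB_zero {R : Type} [CommRing R] : eB (0 : R) = 1 := by
  ext i j; fin_cases i <;> fin_cases j <;> simp [eB]

/-- upper unipotents in the group -/
noncomputable def TA (q h : ℕ) : Multiplicative (ZMod q) →* TG q h where
  toFun s := ⟨eA (AdjoinRoot.mk _ (Polynomial.C s.toAdd)), by
    refine ⟨?_, ?_, ?_⟩ <;> simp [eA]⟩
  map_one' := by
    apply Subtype.ext
    show eA _ = 1
    rw [toAdd_one, Polynomial.C_0, map_zero, eA_zero]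
  map_mul' s t := by
    apply Subtype.ext
    show eA _ = eA _ * eA _
    rw [← eA_add, toAdd_mul, Polynomial.C_add, map_add]

/-- lower unipotents in the group -/
noncomputable def TB (q h : ℕ) : Multiplicative (ZMod q) →* TG q h where
  toFun s := ⟨eB (AdjoinRoot.mk _ (Polynomial.C s.toAdd * Polynomial.X)), by
    refine ⟨by simp [eB], ?_, by simp [eB]⟩
    show TReps q h (AdjoinRoot.mk _ (Polynomial.C s.toAdd * Polynomial.X)) = 0
    rw [TReps_mk]; simp⟩
  map_one' := by
    apply Subtype.ext
    show eB _ = 1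
    rw [toAdd_one, Polynomial.C_0, zero_mul, map_zero, eB_zero]
  map_mul' s t := by
    apply Subtype.ext
    show eB _ = eB _ * eB _
    rw [← eB_add, toAdd_mul, Polynomial.C_add, add_mul, map_add]

theorem TA_coe (q h : ℕ) (s : ZMod q) : (TA q h (Multiplicative.ofAdd s)).1 =
    eA (AdjoinRoot.mk _ (Polynomial.C s)) := rfl

theorem TB_coe (q h : ℕ) (s : ZMod q) : (TB q h (Multiplicative.ofAdd s)).1 =
    eB (AdjoinRoot.mk _ (Polynomial.C s * Polynomial.X)) := rfl

open Polynomial in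
theorem TR_mk_eq (q h : ℕ) (p p' : (ZMod q)[X])
    (e : AdjoinRoot.mk (X ^ (h + 1) : (ZMod q)[X]) p = AdjoinRoot.mk _ p') (m : ℕ) (hm : m ≤ h) :
    p.coeff m = p'.coeff m := by
  rw [AdjoinRoot.mk_eq_mk, X_pow_dvd_iff] at e
  have := e m (by omega)
  rwa [coeff_sub, sub_eq_zero] at this

open Polynomial in
/-- the first row of a product -/
theorem row_group (q h : ℕ) (a b : ℕ → ZMod q)
    (z : ℕ → Matrix.SpecialLinearGroup (Fin 2) (TR q h)) (h00 : z 0 0 0 = 1) (h01 : z 0 0 1 = 0)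
    (hz : ∀ i, z (i + 1) = z i * eA (AdjoinRoot.mk _ (C (a i))) *
      eB (AdjoinRoot.mk _ (C (b i) * X))) :
    ∃ u v : ℕ → (ZMod q)[X], u 0 = 1 ∧ v 0 = 0 ∧ (∀ i, v (i + 1) = v i + C (a i) * u i) ∧
      (∀ i, u (i + 1) = u i + C (b i) * X * v (i + 1)) ∧
      (∀ i, z i 0 0 = AdjoinRoot.mk _ (u i)) ∧ (∀ i, z i 0 1 = AdjoinRoot.mk _ (v i)) := by
  let w : ℕ → (ZMod q)[X] × (ZMod q)[X] := fun n => Nat.rec (1, 0) (fun i x =>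
    (x.1 + C (b i) * X * (x.2 + C (a i) * x.1), x.2 + C (a i) * x.1)) n
  have key : ∀ i, z i 0 0 = AdjoinRoot.mk _ (w i).1 ∧ z i 0 1 = AdjoinRoot.mk _ (w i).2 := by
    intro i
    induction i with
    | zero => exact ⟨by rw [h00]; exact (map_one _).symm, by rw [h01]; exact (map_zero _).symm⟩
    | succ i ih =>
      have hw : w (i + 1) = ((w i).1 + C (b i) * X * ((w i).2 + C (a i) * (w i).1),
        (w i).2 + C (a i) * (w i).1) := rfl
      rw [hz, mul_eB_zero, mul_eB_one, mul_eA_zero, mul_eA_one, ih.1, ih.2, hw]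
      simp only [map_add, map_mul]
      exact ⟨trivial, trivial⟩
  exact ⟨fun i => (w i).1, fun i => (w i).2, rfl, rfl, fun i => rfl, fun i => rfl,
    fun i => (key i).1, fun i => (key i).2⟩

open Polynomial in
theorem TG_no_cycle (q h : ℕ) [Fact q.Prime] (a b : ℕ → ZMod q) (ha : ∀ i, a i ≠ 0)
    (hb : ∀ i, b i ≠ 0) (g : ℕ → TG q h)
    (hg : ∀ i, g (i + 1) = g i * TA q h (Multiplicative.ofAdd (a i)) *
      TB q h (Multiplicative.ofAdd (b i))) : g (2 * h + 1) ≠ g 0 := by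
  intro hcyc
  have hg' : ∀ i, (g (i + 1)).1 = (g i).1 * eA (AdjoinRoot.mk _ (C (a i))) *
      eB (AdjoinRoot.mk _ (C (b i) * X)) := by
    intro i
    rw [hg, Subgroup.coe_mul, Subgroup.coe_mul, TA_coe, TB_coe]
  let z : ℕ → Matrix.SpecialLinearGroup (Fin 2) (TR q h) := fun i => (g 0).1⁻¹ * (g i).1
  obtain ⟨u, v, hu0, hv0, hv, hu, zu, zv⟩ := row_group q h a b z (by simp [z]) (by simp [z])
    (fun i => by simp only [z]; rw [hg', mul_assoc, mul_assoc, mul_assoc])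
  obtain ⟨c1, -, c3⟩ := row_rec a b ha hb u v hu0 hv0 hv hu h
  set U := z h * eA (AdjoinRoot.mk _ (C (a h))) with hU
  have hU1 : U 0 1 = AdjoinRoot.mk _ (v (h + 1)) := by
    rw [hU, mul_eA_one, zu, zv, hv, map_add, map_mul]
  have cU : (v (h + 1)).coeff h ≠ 0 := by
    rw [hv, coeff_add, coeff_C_mul, c3 h le_rfl, zero_add]
    exact mul_ne_zero (ha h) c1
  let y : ℕ → Matrix.SpecialLinearGroup (Fin 2) (TR q h) := fun j => U⁻¹ * z (h + 1 + j)
  have y0 : y 0 = 1 * eB (AdjoinRoot.mk _ (C (b h) * X)) := by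
    have : z (h + 1) = U * eB (AdjoinRoot.mk _ (C (b h) * X)) := by
      simp only [hU, z]; rw [hg', mul_assoc, mul_assoc, mul_assoc]
    simp only [y, add_zero]
    rw [this, ← mul_assoc, inv_mul_cancel]
  obtain ⟨u', v', hu0', hv0', hv', hu', -, zv'⟩ := row_group q h (fun j => a (h + 1 + j))
    (fun j => b (h + 1 + j)) y (by rw [y0, mul_eB_zero]; simp) (by rw [y0, mul_eB_one]; simp)
    (fun j => by
      simp only [y, z]; rw [← add_assoc, hg']; simp only [mul_assoc])
  obtain ⟨-, -, d3⟩ := row_rec _ _ (fun j => ha (h + 1 + j)) (fun j => hb (h + 1 + j))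
    u' v' hu0' hv0' hv' hu' h
  have yh : y h = U⁻¹ := by
    simp only [y, z]
    rw [show h + 1 + h = 2 * h + 1 by ring, hcyc, inv_mul_cancel, mul_one]
  have e1 : (U⁻¹) 0 1 = - U 0 1 := by
    rw [Matrix.SpecialLinearGroup.SL2_inv_expl]; rfl
  have e2 := zv' h
  rw [yh, e1, hU1, ← map_neg] at e2
  have e3 := TR_mk_eq q h _ _ e2 h le_rfl
  rw [d3 h le_rfl, coeff_neg, neg_eq_zero] at e3
  exact cU e3

theorem TA_injective (q h : ℕ) : Function.Injective (TA q h) := by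
  intro s t e
  have e1 := congrArg (fun g : TG q h => g.1 0 1) e
  exact Multiplicative.toAdd.injective
    (by simpa using TR_mk_eq q h (Polynomial.C s.toAdd) (Polynomial.C t.toAdd) e1 0 (by omega))

theorem TB_injective (q h : ℕ) (hh : 1 ≤ h) : Function.Injective (TB q h) := by
  intro s t e
  have e1 := congrArg (fun g : TG q h => g.1 1 0) e
  have e2 := TR_mk_eq q h (Polynomial.C s.toAdd * Polynomial.X)
    (Polynomial.C t.toAdd * Polynomial.X) e1 1 hh
  exact Multiplicative.toAdd.injective (by simpa using e2)

theorem TA_eq_TB (q h : ℕ) (s t : ZMod q)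
    (e : TA q h (Multiplicative.ofAdd s) = TB q h (Multiplicative.ofAdd t)) : s = 0 := by
  have e1 := congrArg (fun g : TG q h => g.1 0 1) e
  have e2 : AdjoinRoot.mk (Polynomial.X ^ (h + 1) : Polynomial (ZMod q)) (Polynomial.C s) =
      AdjoinRoot.mk _ 0 := e1.trans (map_zero _).symm
  simpa using TR_mk_eq q h _ _ e2 0 (by omega)

theorem Hnum_le_base (q h : ℕ) (hq : q.Prime) (hh : 1 ≤ h) :
    ∃ N0 : ℕ, 0 < N0 ∧ N0 ≤ q ^ (3 * h) ∧ ∀ M : ℕ, 0 < M → ∀ n : ℕ,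
      (2 * h + 1) * (M * N0) ≤ n →
      Hnum n (2 * (2 * h + 1)) * q ^ (M * N0) ≤ n.factorial * (M * N0 * 54 ^ (M * N0)) := by
  have : Fact q.Prime := ⟨hq⟩
  obtain ⟨hf, hc⟩ := TG_card q h
  obtain ⟨N0, h1, h2, h3⟩ := Hnum_le_of_group (TA q h) (TB q h) (TA_injective q h)
    (TB_injective q h hh) (TA_eq_TB q h) (k := 2 * h + 1) (by omega) ⟨h, rfl⟩
    (fun a b ha hb g hg => TG_no_cycle q h a b ha hb g hg)
  rw [ZMod.card] at h2 h3
  refine ⟨N0, h1, ?_, h3⟩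
  rw [← h2, pow_succ] at hc
  exact Nat.le_of_mul_le_mul_right hc hq.pos

theorem asym_ev (h k : ℝ) (hh : 1 ≤ h) (hk : 1 ≤ k) (ε δ : ℝ) (hδ : 0 < δ) (hδ1 : δ < 1)
    (hδε : δ < ε) : ∀ᶠ x : ℝ in Filter.atTop,
      x ^ (-δ) < 1 / k ∧ 0 < (1 - δ) / (3 * h) - Real.log 2 / Real.log x ∧
      2 ≤ x ^ ((1 - δ) / (3 * h)) ∧ 2 ≤ x ∧
      1 / (3 * h * k) - ε < (1 / k - x ^ (-δ)) * ((1 - δ) / (3 * h) - Real.log 2 / Real.log x)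
        - 1 / x - Real.log 54 / Real.log x := by
  have t1 : Filter.Tendsto (fun x : ℝ => x ^ (-δ)) Filter.atTop (nhds 0) :=
    tendsto_rpow_neg_atTop hδ
  have t2 : ∀ c : ℝ, Filter.Tendsto (fun x : ℝ => c / Real.log x) Filter.atTop (nhds 0) :=
    fun c => Filter.Tendsto.const_div_atTop Real.tendsto_log_atTop c
  have t3 : Filter.Tendsto (fun x : ℝ => 1 / x) Filter.atTop (nhds 0) :=
    Filter.Tendsto.const_div_atTop Filter.tendsto_id 1
  have hpos : 0 < (1 - δ) / (3 * h) := by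
    apply div_pos <;> linarith
  have t4 : Filter.Tendsto (fun x : ℝ => (1 - δ) / (3 * h) - Real.log 2 / Real.log x)
      Filter.atTop (nhds ((1 - δ) / (3 * h) - 0)) := tendsto_const_nhds.sub (t2 _)
  have t5 := (((tendsto_const_nhds (x := 1 / k)).sub t1).mul t4).sub t3 |>.sub (t2 (Real.log 54))
  have e1 : ∀ᶠ x : ℝ in Filter.atTop, x ^ (-δ) < 1 / k :=
    t1.eventually_lt_const (by positivity)
  have e2 := t4.eventually_const_lt (show 0 < (1 - δ) / (3 * h) - 0 by linarith)
  have e3 := (tendsto_rpow_atTop hpos).eventually_ge_atTop 2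
  have hlt : 1 / (3 * h * k) - ε < (1 / k - 0) * ((1 - δ) / (3 * h) - 0) - 0 - 0 := by
    have h1 : (1 / k - 0) * ((1 - δ) / (3 * h) - 0) - 0 - 0 =
        1 / (3 * h * k) - δ * (1 / (3 * h * k)) := by
      field_simp; ring
    have h2 : 1 / (3 * h * k) ≤ 1 := by
      rw [div_le_one (by positivity)]; nlinarith
    rw [h1]; nlinarith
  have e5 := t5.eventually_const_lt hlt
  filter_upwards [e1, e2, e3, Filter.eventually_ge_atTop 2, e5] with x a b c d e
  exact ⟨a, b, c, d, e⟩

theorem final_bound (h : ℕ) (hh : 1 ≤ h) (ε : ℝ) (hε : 0 < ε) :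
    ∃ n0 : ℕ, ∀ n : ℕ, n0 ≤ n → (Hnum n (2 * (2 * h + 1)) : ℝ) ≤
      (n : ℝ) ^ ((1 - 1 / (3 * (h : ℝ) * (2 * h + 1)) + ε) * n) := by
  obtain ⟨δ, hδ, hδ1, hδε⟩ : ∃ δ : ℝ, 0 < δ ∧ δ < 1 ∧ δ < ε :=
    ⟨min (1 / 2) (ε / 2), by positivity, (min_le_left _ _).trans_lt (by norm_num),
      (min_le_right _ _).trans_lt (by linarith)⟩
  have hhr : (1 : ℝ) ≤ h := by exact_mod_cast hh
  have ev := tendsto_natCast_atTop_atTop.eventually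
    (asym_ev h (2 * h + 1) hhr (by linarith) ε δ hδ hδ1 hδε)
  obtain ⟨n0, hn0⟩ := Filter.eventually_atTop.1 ev
  refine ⟨n0, fun n hn => ?_⟩
  obtain ⟨a1, a2, a3, a4, a5⟩ := hn0 n hn
  set x : ℝ := (n : ℝ) with hx
  have hx0 : 0 < x := by linarith
  set k : ℝ := 2 * (h : ℝ) + 1 with hk
  have hk0 : 0 < k := by positivity
  set Lg := Real.log x with hLg
  have hL : 0 < Lg := Real.log_pos (by linarith)
  set y := x ^ ((1 - δ) / (3 * h)) with hy
  have hy0 : 0 < y := by linarith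
  have hm : ⌊y / 2⌋₊ ≠ 0 := by
    have : 1 ≤ ⌊y / 2⌋₊ := Nat.le_floor (by push_cast; linarith)
    omega
  obtain ⟨q, hq, hq1, hq2⟩ := Nat.exists_prime_lt_and_le_two_mul _ hm
  have hqy : (q : ℝ) ≤ y := by
    have h1 : (⌊y / 2⌋₊ : ℝ) ≤ y / 2 := Nat.floor_le (by positivity)
    have h2 : (q : ℝ) ≤ 2 * (⌊y / 2⌋₊ : ℝ) := by exact_mod_cast hq2
    linarith
  have hqy2 : y / 2 ≤ q := by
    have h1 := Nat.lt_floor_add_one (y / 2)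
    have h2 : (⌊y / 2⌋₊ : ℝ) + 1 ≤ q := by exact_mod_cast hq1
    linarith
  have hq0 : (0 : ℝ) < q := by linarith
  have hlogq : (1 - δ) / (3 * h) * Lg - Real.log 2 ≤ Real.log q := by
    have h1 := Real.log_le_log (by positivity) hqy2
    rw [Real.log_div hy0.ne' (by norm_num), hy, Real.log_rpow hx0] at h1
    exact h1
  obtain ⟨N0, N0pos, N0le, hmain⟩ := Hnum_le_base q h hq hh
  have hN0 : (N0 : ℝ) ≤ x * x ^ (-δ) := by
    calc (N0 : ℝ) ≤ (q : ℝ) ^ (3 * h) := by exact_mod_cast N0le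
      _ ≤ y ^ (3 * h) := pow_le_pow_left₀ hq0.le hqy _
      _ = x ^ (1 - δ) := by
          rw [hy, ← Real.rpow_natCast, ← Real.rpow_mul hx0.le]
          congr 1
          push_cast
          field_simp
      _ = x * x ^ (-δ) := by
          rw [sub_eq_add_neg, Real.rpow_add hx0, Real.rpow_one]
  have hkN0 : (2 * h + 1) * N0 ≤ n := by
    have : k * (N0 : ℝ) ≤ x := by
      calc k * (N0 : ℝ) ≤ k * (x * (1 / k)) := by
            apply mul_le_mul_of_nonneg_left _ hk0.le
            exact hN0.trans (mul_le_mul_of_nonneg_left a1.le hx0.le)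
        _ = x := by field_simp
    rw [hk, hx] at this
    exact_mod_cast this
  set D := (2 * h + 1) * N0 with hD
  have hDpos : 0 < D := by positivity
  set M := n / D with hM
  have hMpos : 0 < M := Nat.div_pos hkN0 hDpos
  have hMle : M * D ≤ n := Nat.div_mul_le_self _ _
  have hMlt : n < M * D + D := by
    have := Nat.lt_div_mul_add (a := n) hDpos
    exact this
  have hm2 := hmain M hMpos n (by
    calc (2 * h + 1) * (M * N0) = M * D := by rw [hD]; ring
      _ ≤ n := hMle)
  set N := M * N0 with hN
  have hkN : k * (N : ℝ) ≤ x := by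
    have : (2 * h + 1) * N ≤ n := by
      calc (2 * h + 1) * N = M * D := by rw [hD, hN]; ring
        _ ≤ n := hMle
    rw [hk, hx]
    exact_mod_cast this
  have hkN2 : x ≤ k * (N : ℝ) + k * N0 := by
    have : n ≤ (2 * h + 1) * N + (2 * h + 1) * N0 := by
      calc n ≤ M * D + D := hMlt.le
        _ = _ := by rw [hD, hN]; ring
    rw [hk, hx]
    exact_mod_cast this
  have hNpos : 0 < N := Nat.mul_pos hMpos N0pos
  have hNpos' : (0 : ℝ) < N := by exact_mod_cast hNpos
  have hk1 : 1 ≤ k := by rw [hk]; linarith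
  have hNx : (N : ℝ) ≤ x := by nlinarith
  have hNlow : x * (1 / k - x ^ (-δ)) ≤ N := by
    have h1 : x / k ≤ N + N0 := by
      rw [div_le_iff₀ hk0]; linarith
    have h2 : x * (1 / k - x ^ (-δ)) = x / k - x * x ^ (-δ) := by ring
    rw [h2]; linarith
  have key : x * Lg + Lg + N * Real.log 54 ≤
      (1 - 1 / (3 * (h : ℝ) * k) + ε) * x * Lg + N * Real.log q := by
    have b1 : x * (1 / k - x ^ (-δ)) * ((1 - δ) / (3 * h) * Lg - Real.log 2) ≤ N * Real.log q := by
      have h0 : 0 ≤ (1 - δ) / (3 * h) * Lg - Real.log 2 := by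
        have := mul_pos a2 hL
        rw [sub_mul, div_mul_cancel₀ _ hL.ne'] at this
        exact this.le
      exact mul_le_mul hNlow hlogq h0 hNpos'.le
    have b2 := mul_lt_mul_of_pos_right a5 (mul_pos hx0 hL)
    have b3 : ((1 / k - x ^ (-δ)) * ((1 - δ) / (3 * h) - Real.log 2 / Lg)
        - 1 / x - Real.log 54 / Lg) * (x * Lg) =
        x * (1 / k - x ^ (-δ)) * ((1 - δ) / (3 * h) * Lg - Real.log 2) - Lg - x * Real.log 54 := by
      field_simp
    rw [b3] at b2
    have b4 : N * Real.log 54 ≤ x * Real.log 54 :=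
      mul_le_mul_of_nonneg_right hNx (Real.log_nonneg (by norm_num))
    nlinarith
  have hfac : (n.factorial : ℝ) ≤ x ^ n := by
    rw [hx]; exact_mod_cast Nat.factorial_le_pow n
  have hm3 : (Hnum n (2 * (2 * h + 1)) : ℝ) * (q : ℝ) ^ N ≤ x ^ n * (x * 54 ^ N) := by
    calc (Hnum n (2 * (2 * h + 1)) : ℝ) * (q : ℝ) ^ N ≤ n.factorial * (N * 54 ^ N) := by
          exact_mod_cast hm2
      _ ≤ _ := by gcongr
  have ex : ∀ (c : ℝ) (m : ℕ), 0 < c → c ^ m = Real.exp (m * Real.log c) := by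
    intro c m hc
    rw [Real.exp_nat_mul, Real.exp_log hc]
  have e3 : x ^ n * (x * 54 ^ N) = Real.exp (x * Lg + Lg + N * Real.log 54) := by
    rw [ex x n hx0, ex 54 N (by norm_num), Real.exp_add, Real.exp_add, hLg, Real.exp_log hx0,
      mul_assoc]
  have e4 : x ^ ((1 - 1 / (3 * (h : ℝ) * k) + ε) * x) * (q : ℝ) ^ N =
      Real.exp ((1 - 1 / (3 * (h : ℝ) * k) + ε) * x * Lg + N * Real.log q) := by
    rw [ex _ N hq0, Real.exp_add, Real.rpow_def_of_pos hx0]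
    congr 2
    ring
  have hqN : (0 : ℝ) < (q : ℝ) ^ N := by positivity
  apply le_of_mul_le_mul_right _ hqN
  rw [e4]
  refine hm3.trans ?_
  rw [e3]
  exact Real.exp_le_exp.2 key

/-- For odd `k ≥ 7`, `H(n,2k) ≤ n^((1 - 2/(3k² - 3k))n - o(n))`. -/
theorem stmt_7 (k : ℕ) (hodd : Odd k) (hk : 7 ≤ k) :
    ∀ ε : ℝ, 0 < ε → ∃ N : ℕ, ∀ n : ℕ, N ≤ n →
      (Hnum n (2 * k) : ℝ) ≤
        (n : ℝ) ^ ((1 - 2 / (3 * (k : ℝ) ^ 2 - 3 * k) + ε) * n) := by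
  intro ε hε
  obtain ⟨h, rfl⟩ := hodd
  have hh : 1 ≤ h := by omega
  obtain ⟨n0, hn0⟩ := final_bound h hh ε hε
  refine ⟨n0, fun n hn => ?_⟩
  have hhr : (1 : ℝ) ≤ h := by exact_mod_cast hh
  have e : 2 / (3 * (((2 * h + 1 : ℕ)) : ℝ) ^ 2 - 3 * ((2 * h + 1 : ℕ) : ℝ)) =
      1 / (3 * (h : ℝ) * (2 * h + 1)) := by
    push_cast
    rw [show 3 * (2 * (h : ℝ) + 1) ^ 2 - 3 * (2 * h + 1) = 2 * (3 * (h : ℝ) * (2 * h + 1)) by ring]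
    field_simp
  rw [e]
  exact hn0 n hn
end
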